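/- arXiv:1908.03196 — 5 statements merged into one kernel-verified Lean document; each statement's English description precedes it below -/
import Mathlib

section
/- Let P and Q be convex bodies in ℝ^n with vol_n(P) = vol_n(Q) and with the same brightness function, i.e. vol_{n−1}(P | u^⊥) = vol_{n−1}(Q | u^⊥) for every unit vector u ∈ ℝ^n. Identify ℝ^n with the subspace ℝ^n × {0} of ℝ^{n+1} and, for a fixed a > 0, form the prisms H_P = P × [0,a] and H_Q = Q × [0,a] in ℝ^{n+1}. Then vol_{n+1}(H_P) = vol_{n+1}(H_Q), and for every unit vector u ∈ ℝ^{n+1} the orthogonal projections of H_P and H_Q onto the hyperplane u^⊥ have equal n-dimensional Hausdorff measure. -/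
open MeasureTheory

/-- The orthogonal projection (shadow) of a set `A ⊆ ℝ^m` onto the hyperplane
`u^⊥` through the origin orthogonal to `u`. -/
noncomputable def shadow {m : ℕ} (u : EuclideanSpace ℝ (Fin m))
    (A : Set (EuclideanSpace ℝ (Fin m))) : Set (EuclideanSpace ℝ (Fin m)) :=
  (fun x => (Submodule.orthogonalProjectionOnto ((Submodule.span ℝ {u})ᗮ) x : EuclideanSpace ℝ (Fin m))) '' A

/-- The prism `P × [0,a] ⊆ ℝ^{n+1}` over a set `P ⊆ ℝ^n`, identifying `ℝ^n`
with the coordinate subspace `ℝ^n × {0}` of `ℝ^{n+1}`. -/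
def prism {n : ℕ} (P : Set (EuclideanSpace ℝ (Fin n))) (a : ℝ) :
    Set (EuclideanSpace ℝ (Fin (n + 1))) :=
  {y | (show EuclideanSpace ℝ (Fin n) from WithLp.toLp 2 fun i => y i.castSucc) ∈ P ∧
    y (Fin.last n) ∈ Set.Icc 0 a}

lemma haar_scale {E F : Type*} [NormedAddCommGroup E] [NormedSpace ℝ E] [FiniteDimensional ℝ E]
    [MeasurableSpace E] [BorelSpace E] [NormedAddCommGroup F] [NormedSpace ℝ F]
    [FiniteDimensional ℝ F] [MeasurableSpace F] [BorelSpace F]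
    (μ : Measure E) [μ.IsAddHaarMeasure] (ν : Measure F) [ν.IsAddHaarMeasure]
    (f : E →ₗ[ℝ] F) (hf : Function.Injective f)
    (hd : Module.finrank ℝ E = Module.finrank ℝ F) :
    ∃ c : ENNReal, ∀ S : Set E, ν (f '' S) = c * μ S := by
  let L : E ≃L[ℝ] F := (LinearEquiv.ofInjectiveOfFinrankEq f hf hd).toContinuousLinearEquiv
  have hL : ∀ x, L x = f x := fun x => rfl
  have : (ν.map L.symm).IsAddHaarMeasure := L.symm.isAddHaarMeasure_map ν
  have hc := Measure.isAddLeftInvariant_eq_smul (ν.map L.symm) μ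
  refine ⟨(Measure.addHaarScalarFactor (ν.map L.symm) μ : ENNReal), fun S => ?_⟩
  have h2 : (ν.map L.symm) S = ν (L.symm ⁻¹' S) :=
    L.symm.toHomeomorph.toMeasurableEquiv.map_apply S
  have h3 : f '' S = L.symm ⁻¹' S := by
    rw [← ContinuousLinearEquiv.image_eq_preimage_symm]; rfl
  rw [h3, ← h2]; exact congrArg (fun m : Measure E => m S) hc

lemma vol_sum_aux (K J : Set ℝ) (hK : IsCompact K) (hKc : Convex ℝ K) (hJ : IsCompact J)
    (hJc : Convex ℝ J) (hK0 : K.Nonempty) (hJ0 : J.Nonempty) :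
    volume ((fun p : ℝ × ℝ => p.1 + p.2) '' (K ×ˢ J)) = volume K + volume J := by
  have e1 := eq_Icc_of_connected_compact ⟨hK0, hKc.isPreconnected⟩ hK
  have e2 := eq_Icc_of_connected_compact ⟨hJ0, hJc.isPreconnected⟩ hJ
  generalize sInf K = a at *
  generalize sSup K = b at *
  generalize sInf J = c at *
  generalize sSup J = d at *
  subst e1 e2
  have hab : a ≤ b := by simpa using hK0
  have hcd : c ≤ d := by simpa using hJ0
  have : (fun p : ℝ × ℝ => p.1 + p.2) '' (Set.Icc a b ×ˢ Set.Icc c d) = Set.Icc (a+c) (b+d) := by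
    rw [← Set.Icc_add_Icc hab hcd]
    rw [Set.image_prod, Set.image2_add]
  rw [this, Real.volume_Icc, Real.volume_Icc, Real.volume_Icc,
    ← ENNReal.ofReal_add (by linarith) (by linarith)]
  congr 1; ring

lemma prod_sum {V : Type*} [NormedAddCommGroup V] [NormedSpace ℝ V] [FiniteDimensional ℝ V]
    [MeasurableSpace V] [BorelSpace V] (μ : Measure V) [μ.IsAddHaarMeasure]
    (S : Set (V × ℝ)) (hS : IsCompact S) (hSc : Convex ℝ S) (J : Set ℝ) (hJ : IsCompact J)
    (hJc : Convex ℝ J) (hJ0 : J.Nonempty) :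
    (μ.prod volume) ((fun p : (V × ℝ) × ℝ => (p.1.1, p.1.2 + p.2)) '' (S ×ˢ J))
      = (μ.prod volume) S + volume J * μ (Prod.fst '' S) := by
  have hT : IsCompact ((fun p : (V × ℝ) × ℝ => (p.1.1, p.1.2 + p.2)) '' (S ×ˢ J)) :=
    (hS.prod hJ).image (by fun_prop)
  have hF : MeasurableSet (Prod.fst '' S) := (hS.image continuous_fst).measurableSet
  rw [Measure.prod_apply hT.measurableSet, Measure.prod_apply hS.measurableSet,
    ← lintegral_indicator_const hF, ← lintegral_add_right _ (measurable_const.indicator hF)]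
  refine lintegral_congr fun v => ?_
  have hfib : Prod.mk v ⁻¹' ((fun p : (V × ℝ) × ℝ => (p.1.1, p.1.2 + p.2)) '' (S ×ˢ J)) =
      (fun p : ℝ × ℝ => p.1 + p.2) '' ((Prod.mk v ⁻¹' S) ×ˢ J) := by
    ext s
    constructor
    · rintro ⟨⟨⟨w, r⟩, j⟩, ⟨h1, h2⟩, h3⟩
      simp only [Prod.mk.injEq] at h3
      obtain ⟨rfl, rfl⟩ := h3
      exact ⟨(r, j), ⟨h1, h2⟩, rfl⟩
    · rintro ⟨⟨r, j⟩, ⟨h1, h2⟩, rfl⟩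
      exact ⟨((v, r), j), ⟨h1, h2⟩, rfl⟩
  rw [hfib]
  by_cases hv : v ∈ Prod.fst '' S
  · rw [Set.indicator_of_mem hv]
    obtain ⟨⟨v', r⟩, hr, rfl⟩ := hv
    refine vol_sum_aux _ _ ?_ ?_ hJ hJc ⟨r, hr⟩ hJ0
    · have hcl : IsClosed (Prod.mk v' ⁻¹' S) :=
        hS.isClosed.preimage (by fun_prop)
      exact (hS.image continuous_snd).of_isClosed_subset hcl fun r hr => ⟨_, hr, rfl⟩
    · intro x hx y hy a b ha hb hab
      have := hSc hx hy ha hb hab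
      simpa [← add_smul, hab] using this
  · rw [Set.indicator_of_notMem hv]
    have : Prod.mk v ⁻¹' S = ∅ := by
      ext r; simp only [Set.mem_preimage, Set.mem_empty_iff_false, iff_false]
      exact fun h => hv ⟨_, h, rfl⟩
    simp [this]

lemma ker_proj {m : ℕ} (u x : EuclideanSpace ℝ (Fin m))
    (h : Submodule.orthogonalProjectionOnto ((Submodule.span ℝ {u})ᗮ) x = 0) :
    ∃ c : ℝ, x = c • u := by
  rw [Submodule.orthogonalProjectionOnto_eq_zero_iff, Submodule.orthogonal_orthogonal,
    Submodule.mem_span_singleton] at h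
  obtain ⟨c, hc⟩ := h
  exact ⟨c, hc.symm⟩

lemma finrank_perp {m : ℕ} (u : EuclideanSpace ℝ (Fin m)) (hu : u ≠ 0) :
    Module.finrank ℝ ((Submodule.span ℝ {u})ᗮ : Submodule ℝ _) + 1 = m := by
  have := Submodule.finrank_add_finrank_orthogonal (Submodule.span ℝ {u})
  rw [finrank_span_singleton hu, finrank_euclideanSpace_fin] at this
  omega

lemma shadow_measure {m k : ℕ} (u : EuclideanSpace ℝ (Fin m))
    (hk : Module.finrank ℝ ((Submodule.span ℝ {u})ᗮ : Submodule ℝ _) = k)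
    (A : Set (EuclideanSpace ℝ (Fin m))) :
    μH[(k : ℝ)] (shadow u A) =
      μH[(Module.finrank ℝ ((Submodule.span ℝ {u})ᗮ : Submodule ℝ _) : ℝ)]
        (Submodule.orthogonalProjectionOnto ((Submodule.span ℝ {u})ᗮ) '' A) := by
  rw [hk, ← (isometry_subtype_coe (s := (((Submodule.span ℝ {u})ᗮ : Submodule ℝ _) :
    Set (EuclideanSpace ℝ (Fin m))))).hausdorffMeasure_image (Or.inl (Nat.cast_nonneg k))]
  rw [shadow, Set.image_image]

/-- coordinates -/
noncomputable def jmap (n : ℕ) :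
    (EuclideanSpace ℝ (Fin n) × ℝ) →ₗ[ℝ] EuclideanSpace ℝ (Fin (n + 1)) where
  toFun p := WithLp.toLp 2 (Fin.snoc (α := fun _ => ℝ) (fun i => p.1 i) p.2)
  map_add' p q := by
    ext i
    refine Fin.lastCases ?_ (fun i => ?_) i <;> simp
  map_smul' c p := by
    ext i
    refine Fin.lastCases ?_ (fun i => ?_) i <;> simp

lemma jmap_last (n : ℕ) (p) : jmap n p (Fin.last n) = p.2 := by simp [jmap]

lemma jmap_cast (n : ℕ) (p) (i : Fin n) : jmap n p i.castSucc = p.1 i := by simp [jmap]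

lemma jmap_inj (n : ℕ) : Function.Injective (jmap n) := by
  intro p q h
  ext i
  · rw [← jmap_cast, h, jmap_cast]
  · rw [← jmap_last, h, jmap_last]

lemma jmap_surj (n : ℕ) : Function.Surjective (jmap n) := by
  intro y
  refine ⟨(WithLp.toLp 2 fun i => y i.castSucc, y (Fin.last n)), ?_⟩
  ext i
  refine Fin.lastCases ?_ (fun i => ?_) i
  · rw [jmap_last]
  · rw [jmap_cast]

lemma prism_eq {n : ℕ} (P : Set (EuclideanSpace ℝ (Fin n))) (a : ℝ) :
    prism P a = jmap n '' (P ×ˢ Set.Icc 0 a) := by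
  ext y
  obtain ⟨p, rfl⟩ := jmap_surj n y
  rw [(jmap_inj n).mem_set_image]
  simp only [prism, Set.mem_ofPred_eq, jmap_last, jmap_cast, Set.mem_prod]

lemma vol_prism {n : ℕ} (a : ℝ) :
    ∃ c : ENNReal, ∀ P : Set (EuclideanSpace ℝ (Fin n)), volume (prism P a) = c * volume P := by
  obtain ⟨c, hc⟩ := haar_scale
    ((volume : Measure (EuclideanSpace ℝ (Fin n))).prod (volume : Measure ℝ))
    (volume : Measure (EuclideanSpace ℝ (Fin (n+1)))) (jmap n) (jmap_inj n) (by simp)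
  refine ⟨c * volume (Set.Icc 0 a), fun P => ?_⟩
  rw [prism_eq, hc, Measure.prod_prod]
  ring

lemma vol_sweep {n : ℕ} (w : EuclideanSpace ℝ (Fin n)) (hw : ‖w‖ = 1) (J : Set ℝ)
    (hJ : IsCompact J) (hJc : Convex ℝ J) (hJ0 : J.Nonempty) :
    ∃ c : ENNReal, ∀ P : Set (EuclideanSpace ℝ (Fin n)), IsCompact P → Convex ℝ P →
      volume ((fun p : EuclideanSpace ℝ (Fin n) × ℝ => p.1 + p.2 • w) '' (P ×ˢ J))
        = volume P + c * μH[(n : ℝ) - 1] (shadow w P) := by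
  have hw0 : w ≠ 0 := by rintro rfl; simp at hw
  have hfr := finrank_perp w hw0
  have hww : inner ℝ w w = (1 : ℝ) := by rw [real_inner_self_eq_norm_sq, hw]; norm_num
  let V : Submodule ℝ (EuclideanSpace ℝ (Fin n)) := (Submodule.span ℝ {w})ᗮ
  let M : (V × ℝ) →ₗ[ℝ] EuclideanSpace ℝ (Fin n) :=
    V.subtype.coprod (LinearMap.toSpanSingleton ℝ _ w)
  have hM : ∀ p : V × ℝ, M p = (p.1 : EuclideanSpace ℝ (Fin n)) + p.2 • w := fun p => by
    simp [M]
  let Φ : EuclideanSpace ℝ (Fin n) →L[ℝ] (V × ℝ) :=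
    (Submodule.orthogonalProjectionOnto V).prod (innerSL ℝ w)
  have hΦ : ∀ x, Φ x = (Submodule.orthogonalProjectionOnto V x, inner ℝ w x) := fun x => rfl
  have hMΦ : ∀ x, M (Φ x) = x := by
    intro x
    rw [hM, hΦ]
    have h1 := Submodule.starProjection_add_starProjection_orthogonal (K := Submodule.span ℝ {w}) x
    rw [Submodule.starProjection_unit_singleton ℝ hw] at h1
    rw [add_comm]
    exact h1
  have hMi : Function.Injective M := by
    have hfr2 : Module.finrank ℝ (V × ℝ) = Module.finrank ℝ (EuclideanSpace ℝ (Fin n)) := by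
      simp only [Module.finrank_prod, Module.finrank_self, finrank_euclideanSpace_fin]
      exact hfr
    rw [LinearMap.injective_iff_surjective_of_finrank_eq_finrank hfr2]
    exact fun x => ⟨Φ x, hMΦ x⟩
  obtain ⟨c, hc⟩ := haar_scale ((μH[(Module.finrank ℝ V : ℝ)] : Measure V).prod (volume : Measure ℝ))
    (volume : Measure (EuclideanSpace ℝ (Fin n))) M hMi (by
      simp only [Module.finrank_prod, Module.finrank_self, finrank_euclideanSpace_fin]
      exact hfr)
  refine ⟨c * volume J, fun P hP hPc => ?_⟩
  have h1 : M '' (Φ '' P) = P := by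
    rw [Set.image_image]; simp [hMΦ]
  have h2 : (fun p : EuclideanSpace ℝ (Fin n) × ℝ => p.1 + p.2 • w) '' (P ×ˢ J) =
      M '' ((fun p : (V × ℝ) × ℝ => (p.1.1, p.1.2 + p.2)) '' ((Φ '' P) ×ˢ J)) := by
    rw [Set.image_image]
    ext y
    constructor
    · rintro ⟨⟨x, s⟩, ⟨hx, hs⟩, rfl⟩
      refine ⟨(Φ x, s), ⟨⟨x, hx, rfl⟩, hs⟩, ?_⟩
      have := hMΦ x
      rw [hM] at this
      simp only [hM]
      simp only [add_smul, ← add_assoc, this]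
    · rintro ⟨⟨_, s⟩, ⟨⟨x, hx, rfl⟩, hs⟩, rfl⟩
      refine ⟨(x, s), ⟨hx, hs⟩, ?_⟩
      have := hMΦ x
      rw [hM] at this
      simp only [hM]
      simp only [add_smul, ← add_assoc, this]
  have h3 : volume P = c * ((μH[(Module.finrank ℝ V : ℝ)] : Measure V).prod
      (volume : Measure ℝ)) (Φ '' P) := by rw [← hc, h1]
  have h4 : Prod.fst '' (Φ '' P) = Submodule.orthogonalProjectionOnto V '' P := by
    rw [Set.image_image]; rfl
  rw [h2, hc, prod_sum _ _ (hP.image Φ.continuous) (hPc.linear_image Φ.toLinearMap) J hJ hJc hJ0,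
    h3, h4]
  have h5 : ((n : ℝ) - 1) = ((Module.finrank ℝ V : ℕ) : ℝ) := by
    have h6 : ((Module.finrank ℝ V : ℕ) : ℝ) + 1 = n := by exact_mod_cast hfr
    linarith
  rw [h5, shadow_measure w rfl P]
  ring

lemma shadow_tilt {n : ℕ} (v : EuclideanSpace ℝ (Fin n)) (t : ℝ) (ht : t ≠ 0) (a : ℝ) :
    ∃ c : ENNReal, ∀ P : Set (EuclideanSpace ℝ (Fin n)),
      μH[(n : ℝ)] (shadow (jmap n (v, t)) (prism P a)) = c * volume
        ((fun p : EuclideanSpace ℝ (Fin n) × ℝ => p.1 + (-p.2 / t) • v) '' (P ×ˢ Set.Icc 0 a)) := by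
  set u := jmap n (v, t) with hu
  have hu0 : u ≠ 0 := by
    intro h
    apply ht
    have h2 := jmap_last n (v, t)
    rw [← hu, h] at h2
    exact h2.symm
  have hfr : Module.finrank ℝ ((Submodule.span ℝ {u})ᗮ : Submodule ℝ _) = n := by
    have := finrank_perp u hu0; omega
  let G : EuclideanSpace ℝ (Fin n) →ₗ[ℝ] ((Submodule.span ℝ {u})ᗮ : Submodule ℝ _) :=
    (Submodule.orthogonalProjectionOnto ((Submodule.span ℝ {u})ᗮ)).toLinearMap ∘ₗ
      (jmap n ∘ₗ LinearMap.inl ℝ _ ℝ)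
  have hG : ∀ x, G x = Submodule.orthogonalProjectionOnto ((Submodule.span ℝ {u})ᗮ)
    (jmap n (x, 0)) := fun x => rfl
  have hGi : Function.Injective G := by
    rw [injective_iff_map_eq_zero]
    intro x hx
    rw [hG] at hx
    obtain ⟨c, hc⟩ := ker_proj u (jmap n (x, 0)) hx
    have hc' : jmap n (x, 0) = jmap n (c • (v, t)) := by rw [map_smul]; exact hc
    have := jmap_inj n hc'
    simp only [Prod.smul_mk, Prod.mk.injEq, smul_eq_mul] at this
    have hc0 : c = 0 := by
      rcases mul_eq_zero.1 this.2.symm with h | h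
      · exact h
      · exact absurd h ht
    rw [this.1, hc0, zero_smul]
  obtain ⟨c, hc⟩ := haar_scale (volume : Measure (EuclideanSpace ℝ (Fin n)))
    (μH[(Module.finrank ℝ ((Submodule.span ℝ {u})ᗮ : Submodule ℝ _) : ℝ)] :
      Measure ((Submodule.span ℝ {u})ᗮ : Submodule ℝ _)) G hGi (by
        rw [hfr, finrank_euclideanSpace_fin])
  refine ⟨c, fun P => ?_⟩
  rw [shadow_measure u hfr, ← hc, prism_eq, Set.image_image, Set.image_image]
  congr 1
  refine Set.image_congr fun p _ => ?_
  have h1 : jmap n p = jmap n (p.1 + (-p.2 / t) • v, 0) + (p.2 / t) • u := by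
    rw [hu, ← map_smul, ← map_add]
    congr 1
    ext1
    · simp [neg_div]
    · simp [ht]
  rw [h1, map_add, map_smul,
    Submodule.orthogonalProjectionOnto_orthogonalComplement_singleton_eq_zero, smul_zero, add_zero,
    hG]

lemma shadow_vert {n : ℕ} (w : EuclideanSpace ℝ (Fin n)) (hw : w ≠ 0) (a : ℝ) :
    ∃ c : ENNReal, ∀ P : Set (EuclideanSpace ℝ (Fin n)),
      μH[(n : ℝ)] (shadow (jmap n (w, 0)) (prism P a)) = c * μH[(n : ℝ) - 1] (shadow w P) := by
  set u := jmap n (w, 0) with hu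
  have hu0 : u ≠ 0 := by
    intro h
    have h1 : jmap n (w, 0) = jmap n 0 := by rw [map_zero, ← h]
    exact hw (congrArg Prod.fst (jmap_inj n h1))
  have hfr : Module.finrank ℝ ((Submodule.span ℝ {u})ᗮ : Submodule ℝ _) = n := by
    have := finrank_perp u hu0; omega
  have hfw := finrank_perp w hw
  let V : Submodule ℝ (EuclideanSpace ℝ (Fin n)) := (Submodule.span ℝ {w})ᗮ
  let N : (V × ℝ) →ₗ[ℝ] ((Submodule.span ℝ {u})ᗮ : Submodule ℝ _) :=
    (Submodule.orthogonalProjectionOnto ((Submodule.span ℝ {u})ᗮ)).toLinearMap ∘ₗ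
      (jmap n ∘ₗ (LinearMap.prodMap V.subtype LinearMap.id))
  have hN : ∀ p, N p = Submodule.orthogonalProjectionOnto ((Submodule.span ℝ {u})ᗮ)
    (jmap n ((p.1 : EuclideanSpace ℝ (Fin n)), p.2)) := fun x => rfl
  have hNi : Function.Injective N := by
    rw [injective_iff_map_eq_zero]
    rintro ⟨x, s⟩ hx
    rw [hN] at hx
    obtain ⟨c, hc⟩ := ker_proj u (jmap n ((x : EuclideanSpace ℝ (Fin n)), s)) hx
    have hc' : jmap n ((x : EuclideanSpace ℝ (Fin n)), s) = jmap n (c • (w, 0)) := by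
      rw [map_smul]; exact hc
    have := jmap_inj n hc'
    simp only [Prod.smul_mk, Prod.mk.injEq, smul_zero] at this
    have h0 : inner ℝ w (x : EuclideanSpace ℝ (Fin n)) = (0 : ℝ) :=
      Submodule.mem_orthogonal_singleton_iff_inner_right.1 x.2
    have hx0 : (x : EuclideanSpace ℝ (Fin n)) = 0 := by
      rw [this.1, inner_smul_right] at h0
      rcases mul_eq_zero.1 h0 with h | h
      · rw [this.1, h, zero_smul]
      · exact absurd (inner_self_eq_zero.1 h) hw
    ext1
    · exact Subtype.ext hx0
    · exact this.2
  obtain ⟨c, hc⟩ := haar_scale ((μH[(Module.finrank ℝ V : ℝ)] : Measure V).prod (volume : Measure ℝ))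
    (μH[(Module.finrank ℝ ((Submodule.span ℝ {u})ᗮ : Submodule ℝ _) : ℝ)] :
      Measure ((Submodule.span ℝ {u})ᗮ : Submodule ℝ _)) N hNi (by
        rw [hfr, Module.finrank_prod, Module.finrank_self]; exact hfw)
  refine ⟨c * volume (Set.Icc 0 a), fun P => ?_⟩
  have h5 : ((n : ℝ) - 1) = ((Module.finrank ℝ V : ℕ) : ℝ) := by
    have h6 : ((Module.finrank ℝ V : ℕ) : ℝ) + 1 = n := by exact_mod_cast hfw
    linarith
  have key : ∀ x s, Submodule.orthogonalProjectionOnto ((Submodule.span ℝ {u})ᗮ) (jmap n (x, s)) =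
      N (Submodule.orthogonalProjectionOnto V x, s) := by
    intro x s
    have h0 : Submodule.orthogonalProjectionOnto V
        (x - (Submodule.orthogonalProjectionOnto V x : EuclideanSpace ℝ (Fin n))) = 0 := by
      rw [map_sub, Submodule.orthogonalProjectionOnto_mem_subspace_eq_self, sub_self]
    obtain ⟨d, hd⟩ := ker_proj w _ h0
    have h1 : jmap n (x, s) = jmap n
        ((Submodule.orthogonalProjectionOnto V x : EuclideanSpace ℝ (Fin n)), s) + d • u := by
      rw [hu, ← map_smul, ← map_add]
      congr 1
      ext1
      · simp [← hd]
      · simp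
    rw [h1, map_add, map_smul,
      Submodule.orthogonalProjectionOnto_orthogonalComplement_singleton_eq_zero, smul_zero,
      add_zero, hN]
  have himg : Submodule.orthogonalProjectionOnto ((Submodule.span ℝ {u})ᗮ) '' (prism P a) =
      N '' ((Submodule.orthogonalProjectionOnto V '' P) ×ˢ Set.Icc 0 a) := by
    rw [prism_eq, Set.image_image]
    ext y
    constructor
    · rintro ⟨⟨x, s⟩, ⟨hx, hs⟩, rfl⟩
      exact ⟨(_, s), ⟨⟨x, hx, rfl⟩, hs⟩, (key x s).symm⟩
    · rintro ⟨⟨_, s⟩, ⟨⟨x, hx, rfl⟩, hs⟩, rfl⟩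
      exact ⟨(x, s), ⟨hx, hs⟩, key x s⟩
  rw [shadow_measure u hfr, himg, hc, Measure.prod_prod, h5, shadow_measure w rfl P]
  ring

theorem prisms_same_brightness_and_volume {n : ℕ}
    (P Q : Set (EuclideanSpace ℝ (Fin n)))
    (hPcomp : IsCompact P) (hPconv : Convex ℝ P) (hPint : (interior P).Nonempty)
    (hQcomp : IsCompact Q) (hQconv : Convex ℝ Q) (hQint : (interior Q).Nonempty)
    (hvol : volume P = volume Q)
    (hbright : ∀ u : EuclideanSpace ℝ (Fin n), ‖u‖ = 1 →
      μH[(n : ℝ) - 1] (shadow u P) = μH[(n : ℝ) - 1] (shadow u Q))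
    (a : ℝ) (ha : 0 < a) :
    volume (prism P a) = volume (prism Q a) ∧
      ∀ u : EuclideanSpace ℝ (Fin (n + 1)), ‖u‖ = 1 →
        μH[(n : ℝ)] (shadow u (prism P a)) = μH[(n : ℝ)] (shadow u (prism Q a)) := by
  refine ⟨?_, fun u hu => ?_⟩
  · obtain ⟨c, hc⟩ := vol_prism (n := n) a
    rw [hc, hc, hvol]
  obtain ⟨⟨v, t⟩, rfl⟩ := jmap_surj n u
  by_cases ht : t = 0
  · subst ht
    have hv : v ≠ 0 := by
      rintro rfl
      have : jmap n (0, 0) = 0 := map_zero _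
      rw [this] at hu
      simp at hu
    have hv1 : ‖v‖ = 1 := by
      rw [EuclideanSpace.norm_eq, Fin.sum_univ_castSucc] at hu
      simp only [jmap_cast, jmap_last] at hu
      rw [EuclideanSpace.norm_eq]
      simpa using hu
    obtain ⟨c, hc⟩ := shadow_vert v hv a
    rw [hc, hc, hbright v hv1]
  · obtain ⟨c, hc⟩ := shadow_tilt v t ht a
    rw [hc, hc]
    congr 1
    by_cases hv : v = 0
    · subst hv
      have h0 : (Set.Icc 0 a).Nonempty := ⟨0, le_refl _, ha.le⟩
      have : ∀ A : Set (EuclideanSpace ℝ (Fin n)),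
          (fun p : EuclideanSpace ℝ (Fin n) × ℝ => p.1 + (-p.2 / t) • (0 : EuclideanSpace ℝ (Fin n)))
            '' (A ×ˢ Set.Icc 0 a) = A := by
        intro A
        simp only [smul_zero, add_zero]
        exact Set.fst_image_prod A h0
      rw [this, this, hvol]
    · have hr : ‖v‖ ≠ 0 := norm_ne_zero_iff.2 hv
      have hw1 : ‖(‖v‖⁻¹ • v)‖ = 1 := by
        rw [norm_smul, norm_inv, norm_norm, inv_mul_cancel₀ hr]
      let g : ℝ →ₗ[ℝ] ℝ := LinearMap.mulLeft ℝ (-‖v‖ / t)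
      have hg : ∀ s, g s = (-‖v‖ / t) * s := fun s => rfl
      have hgc : Continuous g := by
        have : (g : ℝ → ℝ) = fun s => (-‖v‖ / t) * s := rfl
        rw [this]; fun_prop
      obtain ⟨d, hd⟩ := vol_sweep (‖v‖⁻¹ • v) hw1 (g '' Set.Icc 0 a) (isCompact_Icc.image hgc)
        ((convex_Icc 0 a).linear_image g) ⟨g 0, 0, ⟨le_refl _, ha.le⟩, rfl⟩
      have himg : ∀ A : Set (EuclideanSpace ℝ (Fin n)),
          (fun p : EuclideanSpace ℝ (Fin n) × ℝ => p.1 + (-p.2 / t) • v) '' (A ×ˢ Set.Icc 0 a) =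
          (fun p : EuclideanSpace ℝ (Fin n) × ℝ => p.1 + p.2 • (‖v‖⁻¹ • v)) ''
            (A ×ˢ (g '' Set.Icc 0 a)) := by
        intro A
        have hs : ∀ s : ℝ, (-s / t) • v = (g s) • (‖v‖⁻¹ • v) := by
          intro s
          rw [smul_smul, hg]
          congr 1
          field_simp
        ext y
        constructor
        · rintro ⟨⟨x, s⟩, ⟨hx, hs'⟩, rfl⟩
          exact ⟨(x, g s), ⟨hx, ⟨s, hs', rfl⟩⟩, by simp only [hs]⟩
        · rintro ⟨⟨x, _⟩, ⟨hx, ⟨s, hs', rfl⟩⟩, rfl⟩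
          exact ⟨(x, s), ⟨hx, hs'⟩, by simp only [hs]⟩
      rw [himg, himg, hd P hPcomp hPconv, hd Q hQcomp hQconv, hvol, hbright _ hw1]
end

section
/- Let K ⊂ ℝ^k and L ⊂ ℝ^m be convex bodies. Then K × L and K × (−L) have equal covariograms: g_{K×L} = g_{K×(−L)}. Moreover, if neither K nor L is centrally symmetric, then K × L is neither a translate of K × (−L) nor a translate of −(K × (−L)). -/
open MeasureTheory Pointwise

/-- A set `A` is centrally symmetric if it is its own reflection in some point `c`,
i.e. `A = 2c − A`. -/
def IsCentrallySymmetric {E : Type*} [AddCommGroup E] [Module ℝ E] (A : Set E) : Prop :=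
  ∃ c : E, A = (fun x => (2 : ℝ) • c - x) '' A

theorem aux_vol {m : ℕ} (L : Set (EuclideanSpace ℝ (Fin m))) (t : EuclideanSpace ℝ (Fin m)) :
    volume (L ∩ ((fun p => p + t) '' L)) = volume ((-L) ∩ ((fun p => p + t) '' (-L))) := by
  have h : (-L) ∩ ((fun p => p + t) '' (-L)) =
      -((fun x => x + t) ⁻¹' (L ∩ ((fun p => p + t) '' L))) := by
    ext x
    simp only [Set.mem_inter_iff, Set.mem_neg, Set.mem_image, Set.mem_preimage]
    constructor
    · rintro ⟨h1, y, hy, rfl⟩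
      refine ⟨?_, -(y + t), h1, rfl⟩
      have : -(y + t) + t = -y := by abel
      rw [this]; exact hy
    · rintro ⟨h1, y, hy, h2⟩
      have h3 : y = -x := add_right_cancel h2
      subst h3
      refine ⟨hy, x - t, ?_, by abel⟩
      have : -(x - t) = -x + t := by abel
      rw [this]; exact h1
  rw [h, Measure.measure_neg, measure_preimage_add_right]

theorem aux_prod {E F : Type*} [AddCommGroup E] [AddCommGroup F] (K : Set E) (L : Set F)
    (s : E) (t : F) : (fun p => p + (s, t)) '' (K ×ˢ L) =
      ((fun p => p + s) '' K) ×ˢ ((fun p => p + t) '' L) := by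
  ext ⟨a, b⟩
  simp only [Set.mem_image, Set.mem_prod, Prod.exists, Prod.mk_add_mk, Prod.mk.injEq]
  constructor
  · rintro ⟨x, y, ⟨hx, hy⟩, rfl, rfl⟩
    exact ⟨⟨x, hx, rfl⟩, ⟨y, hy, rfl⟩⟩
  · rintro ⟨⟨x, hx, rfl⟩, ⟨y, hy, rfl⟩⟩
    exact ⟨x, y, ⟨hx, hy⟩, rfl, rfl⟩

theorem aux_symm {E : Type*} [AddCommGroup E] [Module ℝ E] (A : Set E) (v : E)
    (h : A = (fun p => p + v) '' (-A)) : IsCentrallySymmetric A := by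
  refine ⟨(2 : ℝ)⁻¹ • v, ?_⟩
  rw [smul_smul, mul_inv_cancel₀ two_ne_zero, one_smul]
  refine h.trans ?_
  rw [← Set.image_neg_eq_neg, Set.image_image]
  refine Set.image_congr fun x _ => ?_
  abel

theorem prod_neg_covariogram_counterexample {k m : ℕ}
    (K : Set (EuclideanSpace ℝ (Fin k))) (L : Set (EuclideanSpace ℝ (Fin m)))
    (hKcomp : IsCompact K) (hKconv : Convex ℝ K) (hKint : (interior K).Nonempty)
    (hLcomp : IsCompact L) (hLconv : Convex ℝ L) (hLint : (interior L).Nonempty) :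
    (∀ (s : EuclideanSpace ℝ (Fin k)) (t : EuclideanSpace ℝ (Fin m)),
      volume ((K ×ˢ L) ∩ ((fun p => p + (s, t)) '' (K ×ˢ L))) =
        volume ((K ×ˢ (-L)) ∩ ((fun p => p + (s, t)) '' (K ×ˢ (-L))))) ∧
    (¬ IsCentrallySymmetric K → ¬ IsCentrallySymmetric L →
      (¬ ∃ v : EuclideanSpace ℝ (Fin k) × EuclideanSpace ℝ (Fin m),
        K ×ˢ L = (fun p => p + v) '' (K ×ˢ (-L))) ∧
      (¬ ∃ v : EuclideanSpace ℝ (Fin k) × EuclideanSpace ℝ (Fin m),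
        K ×ˢ L = (fun p => p + v) '' (-(K ×ˢ (-L))))) := by
  have hK : K.Nonempty := hKint.mono interior_subset
  have hL : L.Nonempty := hLint.mono interior_subset
  refine ⟨fun s t => ?_, fun nK nL => ⟨?_, ?_⟩⟩
  · rw [aux_prod, aux_prod, Set.prod_inter_prod, Set.prod_inter_prod, Measure.volume_eq_prod,
      Measure.prod_prod, Measure.prod_prod, aux_vol L]
  · rintro ⟨⟨s, t⟩, h⟩
    rw [aux_prod, Set.prod_eq_prod_iff_of_nonempty (hK.prod hL)] at h
    exact nL (aux_symm L t h.2)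
  · rintro ⟨⟨s, t⟩, h⟩
    have h0 : -(K ×ˢ (-L)) = (-K) ×ˢ L := by
      ext ⟨a, b⟩
      simp
    rw [h0, aux_prod, Set.prod_eq_prod_iff_of_nonempty (hK.prod hL)] at h
    exact nK (aux_symm K s h.1)
end

section
/- There exist convex bodies K and L in ℝ⁴ (which may be taken to be convex polytopes) with equal covariograms, g_K = g_L, such that L is neither a translate of K nor a translate of −K. -/
open MeasureTheory Pointwise

/-- product of two triangles -/
def covK : Set (EuclideanSpace ℝ (Fin 4)) :=
  {x | 0 ≤ x 0 ∧ 0 ≤ x 1 ∧ x 0 + x 1 ≤ 1 ∧ 0 ≤ x 2 ∧ 0 ≤ x 3 ∧ x 2 + x 3 ≤ 1}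

/-- product of a triangle and a reflected triangle -/
def covL : Set (EuclideanSpace ℝ (Fin 4)) :=
  {x | 0 ≤ x 0 ∧ 0 ≤ x 1 ∧ x 0 + x 1 ≤ 1 ∧ x 2 ≤ 0 ∧ x 3 ≤ 0 ∧ -1 ≤ x 2 + x 3}

/-- reflection in the last two coordinates -/
noncomputable def covR : EuclideanSpace ℝ (Fin 4) ≃ₗᵢ[ℝ] EuclideanSpace ℝ (Fin 4) :=
  LinearIsometryEquiv.piLpCongrRight 2
    (fun i : Fin 4 => if i < 2 then LinearIsometryEquiv.refl ℝ ℝ else LinearIsometryEquiv.neg ℝ)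

lemma covR0 (x : EuclideanSpace ℝ (Fin 4)) : covR x 0 = x 0 := by simp [covR]
lemma covR1 (x : EuclideanSpace ℝ (Fin 4)) : covR x 1 = x 1 := by simp [covR]
lemma covR2 (x : EuclideanSpace ℝ (Fin 4)) : covR x 2 = - x 2 := by simp [covR]
lemma covR3 (x : EuclideanSpace ℝ (Fin 4)) : covR x 3 = - x 3 := by
  have h : ¬ ((3 : Fin 4) < 2) := by decide
  simp [covR, h]

lemma covR_invol (x : EuclideanSpace ℝ (Fin 4)) : covR (covR x) = x := by
  ext i; fin_cases i <;> simp [covR0, covR1, covR2, covR3]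

lemma covL_eq : covL = covR '' covK := by
  ext x
  constructor
  · rintro ⟨h0, h1, h2, h3, h4, h5⟩
    refine ⟨covR x, ?_, covR_invol x⟩
    simp only [covK, Set.mem_setOf_eq, covR0, covR1, covR2, covR3]
    refine ⟨h0, h1, h2, ?_, ?_, ?_⟩ <;> linarith
  · rintro ⟨y, ⟨h0, h1, h2, h3, h4, h5⟩, rfl⟩
    simp only [covL, Set.mem_setOf_eq, covR0, covR1, covR2, covR3]
    refine ⟨h0, h1, h2, ?_, ?_, ?_⟩ <;> linarith

lemma covK_convex : Convex ℝ covK := by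
  rintro x ⟨h0, h1, h2, h3, h4, h5⟩ y ⟨k0, k1, k2, k3, k4, k5⟩ a b ha hb hab
  simp only [covK, Set.mem_setOf_eq, PiLp.add_apply, PiLp.smul_apply, smul_eq_mul]
  refine ⟨by positivity, by positivity, ?_, by positivity, by positivity, ?_⟩ <;> nlinarith

/-- vertices of a triangle in the first two coordinates -/
noncomputable def covS1 : Set (EuclideanSpace ℝ (Fin 4)) := {0, !₂[1,0,0,0], !₂[0,1,0,0]}
/-- vertices of a triangle in the last two coordinates -/
noncomputable def covS2 : Set (EuclideanSpace ℝ (Fin 4)) := {0, !₂[0,0,1,0], !₂[0,0,0,1]}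

lemma tri_mem {E : Type*} [AddCommGroup E] [Module ℝ E] (u v : E) (a b : ℝ)
    (ha : 0 ≤ a) (hb : 0 ≤ b) (h : a + b ≤ 1) :
    a • u + b • v ∈ convexHull ℝ ({0, u, v} : Set E) := by
  have hc := convex_convexHull ℝ ({0, u, v} : Set E)
  have h0 : (0 : E) ∈ convexHull ℝ ({0, u, v} : Set E) := subset_convexHull _ _ (by simp)
  have hu : u ∈ convexHull ℝ ({0, u, v} : Set E) := subset_convexHull _ _ (by simp)
  have hv : v ∈ convexHull ℝ ({0, u, v} : Set E) := subset_convexHull _ _ (by simp)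
  have := hc.sum_mem (t := Finset.univ) (w := ![1 - a - b, a, b]) (z := ![0, u, v])
    (by intro i _; fin_cases i <;> simp <;> linarith)
    (by simp [Fin.sum_univ_three]; ring)
    (by intro i _; fin_cases i <;> simp [h0, hu, hv])
  simpa [Fin.sum_univ_three] using this

lemma covK_hull : covK = convexHull ℝ (covS1 + covS2) := by
  apply Set.Subset.antisymm
  · rintro x ⟨h0, h1, h2, h3, h4, h5⟩
    rw [convexHull_add]
    refine ⟨_, tri_mem _ _ (x 0) (x 1) h0 h1 h2, _, tri_mem _ _ (x 2) (x 3) h3 h4 h5, ?_⟩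
    ext i; fin_cases i <;> simp
  · apply convexHull_min _ covK_convex
    rintro _ ⟨a, ha, b, hb, rfl⟩
    simp only [covS1, covS2, Set.mem_insert_iff, Set.mem_singleton_iff] at ha hb
    rcases ha with rfl | rfl | rfl <;> rcases hb with rfl | rfl | rfl <;> simp [covK]

lemma covS_fin : (covS1 + covS2).Finite :=
  Set.Finite.add (by simp [covS1]) (by simp [covS2])

lemma covL_hull : covL = convexHull ℝ (covR '' (covS1 + covS2)) := by
  rw [covL_eq, covK_hull]
  exact (covR.toLinearEquiv.toLinearMap.image_convexHull _)

lemma covK_int : (interior covK).Nonempty := by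
  refine ⟨!₂[1/4,1/4,1/4,1/4], ?_⟩
  rw [mem_interior]
  refine ⟨{x | 0 < x 0 ∧ 0 < x 1 ∧ x 0 + x 1 < 1 ∧ 0 < x 2 ∧ 0 < x 3 ∧ x 2 + x 3 < 1}, ?_, ?_, ?_⟩
  · rintro x ⟨h0, h1, h2, h3, h4, h5⟩
    exact ⟨h0.le, h1.le, h2.le, h3.le, h4.le, h5.le⟩
  · refine IsOpen.and ?_ (IsOpen.and ?_ (IsOpen.and ?_ (IsOpen.and ?_ (IsOpen.and ?_ ?_)))) <;>
      exact isOpen_lt (by fun_prop) (by fun_prop)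
  · simp; norm_num

lemma covL_int : (interior covL).Nonempty := by
  have h := covR.toHomeomorph.image_interior covK
  rw [covL_eq]
  change covR '' interior covK = interior (covR '' covK) at h
  rw [← h]
  exact covK_int.image _

lemma cov_mem_add (K : Set (EuclideanSpace ℝ (Fin 4))) (t x : EuclideanSpace ℝ (Fin 4)) :
    x ∈ (fun x => x + t) '' K ↔ x - t ∈ K := by
  constructor
  · rintro ⟨y, hy, rfl⟩; simpa using hy
  · intro h; exact ⟨x - t, h, by simp⟩

lemma cov_eq (t : EuclideanSpace ℝ (Fin 4)) :
    volume (covK ∩ ((fun x => x + t) '' covK)) = volume (covL ∩ ((fun x => x + t) '' covL)) := by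
  have hmp : MeasurePreserving (fun x => covR x + !₂[0, 0, t 2, t 3])
      (volume : Measure (EuclideanSpace ℝ (Fin 4))) volume :=
    (measurePreserving_add_right volume _).comp covR.measurePreserving
  have hcl : IsCompact covL := by
    rw [covL_hull]; exact (covS_fin.image _).isCompact_convexHull (𝕜 := ℝ)
  have hm : MeasurableSet (covL ∩ ((fun x => x + t) '' covL)) :=
    hcl.measurableSet.inter (hcl.image (by fun_prop)).measurableSet
  rw [← hmp.measure_preimage hm.nullMeasurableSet]
  congr 1
  ext x
  simp only [Set.mem_inter_iff, Set.mem_preimage, cov_mem_add]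
  simp [covK, covL, covR0, covR1, covR2, covR3]
  constructor
  · rintro ⟨⟨h0, h1, h2, h3, h4, h5⟩, k0, k1, k2, k3, k4, k5⟩
    refine ⟨⟨?_, ?_, ?_, ?_, ?_, ?_⟩, ?_, ?_, ?_, ?_, ?_, ?_⟩ <;> linarith
  · rintro ⟨⟨h0, h1, h2, h3, h4, h5⟩, k0, k1, k2, k3, k4, k5⟩
    refine ⟨⟨?_, ?_, ?_, ?_, ?_, ?_⟩, ?_, ?_, ?_, ?_, ?_, ?_⟩ <;> linarith

theorem covariogram_counterexample_dim_four :
    ∃ K L : Set (EuclideanSpace ℝ (Fin 4)),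
      IsCompact K ∧ Convex ℝ K ∧ (interior K).Nonempty ∧
      (∃ S : Set (EuclideanSpace ℝ (Fin 4)), S.Finite ∧ K = convexHull ℝ S) ∧
      IsCompact L ∧ Convex ℝ L ∧ (interior L).Nonempty ∧
      (∃ S : Set (EuclideanSpace ℝ (Fin 4)), S.Finite ∧ L = convexHull ℝ S) ∧
      (∀ t : EuclideanSpace ℝ (Fin 4),
        volume (K ∩ ((fun x => x + t) '' K)) = volume (L ∩ ((fun x => x + t) '' L))) ∧
      (¬ ∃ v : EuclideanSpace ℝ (Fin 4), L = (fun x => x + v) '' K) ∧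
      (¬ ∃ v : EuclideanSpace ℝ (Fin 4), L = (fun x => x + v) '' (-K)) := by
  refine ⟨covK, covL, ?_, covK_convex, covK_int, ⟨_, covS_fin, covK_hull⟩, ?_, ?_, covL_int,
    ⟨_, covS_fin.image _, covL_hull⟩, cov_eq, ?_, ?_⟩
  · rw [covK_hull]; exact covS_fin.isCompact_convexHull (𝕜 := ℝ)
  · rw [covL_hull]; exact (covS_fin.image _).isCompact_convexHull (𝕜 := ℝ)
  · rw [covL_hull]; exact convex_convexHull _ _
  · rintro ⟨v, hv⟩
    have h0 : (0 : EuclideanSpace ℝ (Fin 4)) + v ∈ covL := by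
      rw [hv]; exact ⟨0, by simp [covK], rfl⟩
    have h2 : (!₂[0,0,1,0] : EuclideanSpace ℝ (Fin 4)) + v ∈ covL := by
      rw [hv]; exact ⟨_, by simp [covK], rfl⟩
    have h3 : (!₂[0,0,0,1] : EuclideanSpace ℝ (Fin 4)) + v ∈ covL := by
      rw [hv]; exact ⟨_, by simp [covK], rfl⟩
    simp [covL] at h0 h2 h3
    linarith [h0.2.2.2.2.2, h2.2.2.2.1, h3.2.2.2.2.1]
  · rintro ⟨v, hv⟩
    have h0 : -(0 : EuclideanSpace ℝ (Fin 4)) + v ∈ covL := by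
      rw [hv]; exact ⟨_, by simp [covK], rfl⟩
    have h2 : -(!₂[1,0,0,0] : EuclideanSpace ℝ (Fin 4)) + v ∈ covL := by
      rw [hv]; exact ⟨_, by rw [Set.neg_mem_neg]; simp [covK], rfl⟩
    have h3 : -(!₂[0,1,0,0] : EuclideanSpace ℝ (Fin 4)) + v ∈ covL := by
      rw [hv]; exact ⟨_, by rw [Set.neg_mem_neg]; simp [covK], rfl⟩
    simp [covL] at h0 h2 h3
    linarith [h0.2.2.1, h2.1, h3.2.1]
end

section
/- There exist convex bodies P and Q in the plane ℝ² with equal areas and equal width functions (w_P(u) = w_Q(u) for every unit vector u) such that Q is not the image of P under any isometry of the plane; in particular P and Q are non-congruent convex bodies with the same brightness function and the same volume. -/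
open MeasureTheory

/-- The support function of a set `K`: `h_K(u) = sup {⟨u, y⟩ : y ∈ K}`. -/
noncomputable def suppFn {n : ℕ} (K : Set (EuclideanSpace ℝ (Fin n)))
    (u : EuclideanSpace ℝ (Fin n)) : ℝ :=
  sSup ((fun y => (inner ℝ u y : ℝ)) '' K)

abbrev E2 := EuclideanSpace ℝ (Fin 2)

/-- Rectangle with the corner (2,1) cut off. -/
def bodyS : Set E2 := {p | -2 ≤ p 0 ∧ p 0 ≤ 2 ∧ -1 ≤ p 1 ∧ p 1 ≤ 1 ∧ p 0 + p 1 ≤ 2}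
/-- Half plane cutting off the corner (-2,1). -/
def halfA : Set E2 := {p | -p 0 + p 1 ≤ 2}
/-- Half plane cutting off the corner (2,-1). -/
def halfB : Set E2 := {p | p 0 - p 1 ≤ 2}

lemma memS (p : E2) : p ∈ bodyS ↔
    -2 ≤ p 0 ∧ p 0 ≤ 2 ∧ -1 ≤ p 1 ∧ p 1 ≤ 1 ∧ p 0 + p 1 ≤ 2 := Iff.rfl
lemma memA (p : E2) : p ∈ halfA ↔ -p 0 + p 1 ≤ 2 := Iff.rfl
lemma memB (p : E2) : p ∈ halfB ↔ p 0 - p 1 ≤ 2 := Iff.rfl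

lemma closed_S : IsClosed bodyS := by
  have e : bodyS = {p : E2 | -2 ≤ p 0} ∩ ({p : E2 | p 0 ≤ 2} ∩ ({p : E2 | -1 ≤ p 1} ∩
      ({p : E2 | p 1 ≤ 1} ∩ {p : E2 | p 0 + p 1 ≤ 2}))) := by
    ext p
    rfl
  rw [e]
  exact (isClosed_le (by fun_prop) (by fun_prop)).inter <|
    (isClosed_le (by fun_prop) (by fun_prop)).inter <|
    (isClosed_le (by fun_prop) (by fun_prop)).inter <|
    (isClosed_le (by fun_prop) (by fun_prop)).inter <|
    (isClosed_le (by fun_prop) (by fun_prop))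

lemma closed_A : IsClosed halfA := isClosed_le (by fun_prop) (by fun_prop)
lemma closed_B : IsClosed halfB := isClosed_le (by fun_prop) (by fun_prop)

lemma bounded_S : Bornology.IsBounded bodyS := by
  refine (Metric.isBounded_closedBall (x := (0 : E2)) (r := 3)).subset ?_
  rintro p ⟨h1, h2, h3, h4, h5⟩
  rw [mem_closedBall_zero_iff, EuclideanSpace.norm_eq]
  apply Real.sqrt_le_iff.2
  simp only [Fin.sum_univ_two, Real.norm_eq_abs, sq_abs]
  constructor
  · norm_num
  · nlinarith

lemma compact_S : IsCompact bodyS := Metric.isCompact_of_isClosed_isBounded closed_S bounded_S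

lemma convex_S : Convex ℝ bodyS := by
  rintro p ⟨h1, h2, h3, h4, h5⟩ q ⟨g1, g2, g3, g4, g5⟩ a b ha hb hab
  obtain rfl : b = 1 - a := by linarith
  simp only [bodyS, Set.mem_ofPred_eq, PiLp.add_apply, PiLp.smul_apply, smul_eq_mul]
  refine ⟨?_, ?_, ?_, ?_, ?_⟩ <;> nlinarith

lemma convex_A : Convex ℝ halfA := by
  intro p h q g a b ha hb hab
  obtain rfl : b = 1 - a := by linarith
  simp only [halfA, Set.mem_ofPred_eq, PiLp.add_apply, PiLp.smul_apply, smul_eq_mul] at *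
  nlinarith

lemma convex_B : Convex ℝ halfB := by
  intro p h q g a b ha hb hab
  obtain rfl : b = 1 - a := by linarith
  simp only [halfB, Set.mem_ofPred_eq, PiLp.add_apply, PiLp.smul_apply, smul_eq_mul] at *
  nlinarith

lemma int_aux (K : Set E2) (h : ∀ p : E2, |p 0| < 1 → |p 1| < 1 → p ∈ K) :
    (interior K).Nonempty := by
  refine ⟨0, mem_interior.2 ⟨{p : E2 | |p 0| < 1} ∩ {p : E2 | |p 1| < 1}, ?_, ?_, ?_⟩⟩
  · rintro p ⟨h1, h2⟩
    exact h p h1 h2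
  · exact (isOpen_lt (by fun_prop) (by fun_prop)).inter (isOpen_lt (by fun_prop) (by fun_prop))
  · simp

lemma vol_eq : volume (bodyS ∩ halfA) = volume (bodyS ∩ halfB) := by
  have h1 := measure_inter_add_sdiff (μ := (volume : Measure E2)) bodyS closed_A.measurableSet
  have h2 := measure_inter_add_sdiff (μ := (volume : Measure E2)) bodyS closed_B.measurableSet
  have h3 : bodyS \ halfA = - (bodyS \ halfB) := by
    ext p
    simp only [bodyS, halfA, halfB, Set.mem_sdiff, Set.mem_neg, Set.mem_ofPred_eq, PiLp.neg_apply]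
    constructor
    · rintro ⟨⟨_, _, _, _, _⟩, h⟩
      refine ⟨⟨?_, ?_, ?_, ?_, ?_⟩, ?_⟩ <;> linarith
    · rintro ⟨⟨_, _, _, _, _⟩, h⟩
      refine ⟨⟨?_, ?_, ?_, ?_, ?_⟩, ?_⟩ <;> linarith
  have h4 : volume (bodyS \ halfA) = volume (bodyS \ halfB) := by
    rw [h3, Measure.measure_neg]
  have h5 : volume (bodyS \ halfB) ≠ ⊤ :=
    ne_top_of_le_ne_top compact_S.measure_ne_top (measure_mono Set.sdiff_subset)
  rw [h4, ← h2] at h1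
  exact (ENNReal.add_left_inj h5).1 h1

lemma inner2 (u y : E2) : (inner ℝ u y : ℝ) = u 0 * y 0 + u 1 * y 1 := by
  simp [PiLp.inner_apply, Fin.sum_univ_two, mul_comm]

lemma supp_le {K L : Set E2} (u v : E2) (hK : K.Nonempty) (hL : IsCompact L)
    (h : ∀ y ∈ K, ∃ z ∈ L, (inner ℝ u y : ℝ) ≤ inner ℝ v z) : suppFn K u ≤ suppFn L v := by
  apply csSup_le (hK.image _)
  rintro _ ⟨y, hy, rfl⟩
  obtain ⟨z, hz, hyz⟩ := h y hy
  refine hyz.trans (le_csSup ?_ ⟨z, hz, rfl⟩)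
  exact (hL.image (by fun_prop)).bddAbove

lemma compact_P : IsCompact (bodyS ∩ halfA) := compact_S.inter_right closed_A
lemma compact_Q : IsCompact (bodyS ∩ halfB) := compact_S.inter_right closed_B
lemma int_P : (interior (bodyS ∩ halfA)).Nonempty := by
  apply int_aux
  intro p h1 h2
  rw [abs_lt] at h1 h2
  refine ⟨⟨?_, ?_, ?_, ?_, ?_⟩, ?_⟩ <;> try rw [memA]
  all_goals linarith
lemma int_Q : (interior (bodyS ∩ halfB)).Nonempty := by
  apply int_aux
  intro p h1 h2
  rw [abs_lt] at h1 h2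
  refine ⟨⟨?_, ?_, ?_, ?_, ?_⟩, ?_⟩ <;> try rw [memB]
  all_goals linarith
lemma ne_P : (bodyS ∩ halfA).Nonempty := int_P.mono interior_subset
lemma ne_Q : (bodyS ∩ halfB).Nonempty := int_Q.mono interior_subset

lemma mem_P (x y : ℝ) : !₂[x, y] ∈ bodyS ∩ halfA ↔
    (-2 ≤ x ∧ x ≤ 2 ∧ -1 ≤ y ∧ y ≤ 1 ∧ x + y ≤ 2) ∧ -x + y ≤ 2 := by
  simp [bodyS, halfA]
lemma mem_Q (x y : ℝ) : !₂[x, y] ∈ bodyS ∩ halfB ↔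
    (-2 ≤ x ∧ x ≤ 2 ∧ -1 ≤ y ∧ y ≤ 1 ∧ x + y ≤ 2) ∧ x - y ≤ 2 := by
  simp [bodyS, halfB]

lemma mulmax (a x : ℝ) (ha : 0 ≤ a) : a * x ≤ a * max x 0 :=
  mul_le_mul_of_nonneg_left (le_max_left _ _) ha
lemma mulmin (a x : ℝ) (ha : a ≤ 0) : a * x ≤ a * min x 0 :=
  mul_le_mul_of_nonpos_left (min_le_left _ _) ha

lemma pp (u : E2) (h0 : 0 ≤ u 0) (h1 : 0 ≤ u 1) :
    suppFn (bodyS ∩ halfA) u = suppFn (bodyS ∩ halfB) u := by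
  apply le_antisymm
  · refine supp_le u u ne_P compact_Q ?_
    rintro y ⟨⟨_, _, _, _, _⟩, h⟩
    first | rw [memA] at h | rw [memB] at h
    refine ⟨!₂[max (y 0) 0, max (y 1) 0], (mem_Q _ _).2 ?_, ?_⟩
    · rcases le_total (y 0) 0 with c0 | c0 <;> rcases le_total (y 1) 0 with c1 | c1 <;>
        simp only [max_eq_left, max_eq_right, min_eq_left, min_eq_right, c0, c1] <;>
        refine ⟨⟨?_, ?_, ?_, ?_, ?_⟩, ?_⟩ <;> linarith
    · rw [inner2, inner2]
      exact add_le_add (mulmax _ _ h0) (mulmax _ _ h1)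
  · refine supp_le u u ne_Q compact_P ?_
    rintro y ⟨⟨_, _, _, _, _⟩, h⟩
    first | rw [memA] at h | rw [memB] at h
    refine ⟨!₂[max (y 0) 0, max (y 1) 0], (mem_P _ _).2 ?_, ?_⟩
    · rcases le_total (y 0) 0 with c0 | c0 <;> rcases le_total (y 1) 0 with c1 | c1 <;>
        simp only [max_eq_left, max_eq_right, min_eq_left, min_eq_right, c0, c1] <;>
        refine ⟨⟨?_, ?_, ?_, ?_, ?_⟩, ?_⟩ <;> linarith
    · rw [inner2, inner2]
      exact add_le_add (mulmax _ _ h0) (mulmax _ _ h1)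

lemma mm (u : E2) (h0 : u 0 ≤ 0) (h1 : u 1 ≤ 0) :
    suppFn (bodyS ∩ halfA) u = suppFn (bodyS ∩ halfB) u := by
  apply le_antisymm
  · refine supp_le u u ne_P compact_Q ?_
    rintro y ⟨⟨_, _, _, _, _⟩, h⟩
    first | rw [memA] at h | rw [memB] at h
    refine ⟨!₂[min (y 0) 0, min (y 1) 0], (mem_Q _ _).2 ?_, ?_⟩
    · rcases le_total (y 0) 0 with c0 | c0 <;> rcases le_total (y 1) 0 with c1 | c1 <;>
        simp only [max_eq_left, max_eq_right, min_eq_left, min_eq_right, c0, c1] <;>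
        refine ⟨⟨?_, ?_, ?_, ?_, ?_⟩, ?_⟩ <;> linarith
    · rw [inner2, inner2]
      exact add_le_add (mulmin _ _ h0) (mulmin _ _ h1)
  · refine supp_le u u ne_Q compact_P ?_
    rintro y ⟨⟨_, _, _, _, _⟩, h⟩
    first | rw [memA] at h | rw [memB] at h
    refine ⟨!₂[min (y 0) 0, min (y 1) 0], (mem_P _ _).2 ?_, ?_⟩
    · rcases le_total (y 0) 0 with c0 | c0 <;> rcases le_total (y 1) 0 with c1 | c1 <;>
        simp only [max_eq_left, max_eq_right, min_eq_left, min_eq_right, c0, c1] <;>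
        refine ⟨⟨?_, ?_, ?_, ?_, ?_⟩, ?_⟩ <;> linarith
    · rw [inner2, inner2]
      exact add_le_add (mulmin _ _ h0) (mulmin _ _ h1)

lemma mp (u v : E2) (hv : v = -u) (h0 : u 0 ≤ 0) (h1 : 0 ≤ u 1) :
    suppFn (bodyS ∩ halfA) u = suppFn (bodyS ∩ halfB) v := by
  have e0 : v 0 = - u 0 := by simp [hv]
  have e1 : v 1 = - u 1 := by simp [hv]
  apply le_antisymm
  · refine supp_le u v ne_P compact_Q ?_
    rintro y ⟨⟨_, _, _, _, _⟩, h⟩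
    first | rw [memA] at h | rw [memB] at h
    refine ⟨!₂[-min (y 0) 0, -max (y 1) 0], (mem_Q _ _).2 ?_, ?_⟩
    · rcases le_total (y 0) 0 with c0 | c0 <;> rcases le_total (y 1) 0 with c1 | c1 <;>
        simp only [max_eq_left, max_eq_right, min_eq_left, min_eq_right, c0, c1] <;>
        refine ⟨⟨?_, ?_, ?_, ?_, ?_⟩, ?_⟩ <;> linarith
    · rw [inner2, inner2, e0, e1]
      have := add_le_add (mulmin _ (y 0) h0) (mulmax _ (y 1) h1)
      simpa using this
  · refine supp_le v u ne_Q compact_P ?_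
    rintro y ⟨⟨_, _, _, _, _⟩, h⟩
    first | rw [memA] at h | rw [memB] at h
    refine ⟨!₂[min (-y 0) 0, max (-y 1) 0], (mem_P _ _).2 ?_, ?_⟩
    · rcases le_total (-y 0) 0 with c0 | c0 <;> rcases le_total (-y 1) 0 with c1 | c1 <;>
        simp only [max_eq_left, max_eq_right, min_eq_left, min_eq_right, c0, c1] <;>
        refine ⟨⟨?_, ?_, ?_, ?_, ?_⟩, ?_⟩ <;> linarith
    · rw [inner2, inner2, e0, e1]
      have := add_le_add (mulmin _ (-y 0) h0) (mulmax _ (-y 1) h1)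
      simpa using this

lemma pm (u v : E2) (hv : v = -u) (h0 : 0 ≤ u 0) (h1 : u 1 ≤ 0) :
    suppFn (bodyS ∩ halfA) u = suppFn (bodyS ∩ halfB) v := by
  have e0 : v 0 = - u 0 := by simp [hv]
  have e1 : v 1 = - u 1 := by simp [hv]
  apply le_antisymm
  · refine supp_le u v ne_P compact_Q ?_
    rintro y ⟨⟨_, _, _, _, _⟩, h⟩
    first | rw [memA] at h | rw [memB] at h
    refine ⟨!₂[-max (y 0) 0, -min (y 1) 0], (mem_Q _ _).2 ?_, ?_⟩
    · rcases le_total (y 0) 0 with c0 | c0 <;> rcases le_total (y 1) 0 with c1 | c1 <;>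
        simp only [max_eq_left, max_eq_right, min_eq_left, min_eq_right, c0, c1] <;>
        refine ⟨⟨?_, ?_, ?_, ?_, ?_⟩, ?_⟩ <;> linarith
    · rw [inner2, inner2, e0, e1]
      have := add_le_add (mulmax _ (y 0) h0) (mulmin _ (y 1) h1)
      simpa using this
  · refine supp_le v u ne_Q compact_P ?_
    rintro y ⟨⟨_, _, _, _, _⟩, h⟩
    first | rw [memA] at h | rw [memB] at h
    refine ⟨!₂[max (-y 0) 0, min (-y 1) 0], (mem_P _ _).2 ?_, ?_⟩
    · rcases le_total (-y 0) 0 with c0 | c0 <;> rcases le_total (-y 1) 0 with c1 | c1 <;>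
        simp only [max_eq_left, max_eq_right, min_eq_left, min_eq_right, c0, c1] <;>
        refine ⟨⟨?_, ?_, ?_, ?_, ?_⟩, ?_⟩ <;> linarith
    · rw [inner2, inner2, e0, e1]
      have := add_le_add (mulmax _ (-y 0) h0) (mulmin _ (-y 1) h1)
      simpa using this

lemma width_eq (u : E2) :
    suppFn (bodyS ∩ halfA) u + suppFn (bodyS ∩ halfA) (-u)
      = suppFn (bodyS ∩ halfB) u + suppFn (bodyS ∩ halfB) (-u) := by
  rcases le_total 0 (u 0) with h0 | h0 <;> rcases le_total 0 (u 1) with h1 | h1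
  · rw [pp u h0 h1, mm (-u) (by simpa using h0) (by simpa using h1)]
  · rw [pm u (-u) rfl h0 h1, mp (-u) u (by simp) (by simpa using h0) (by simpa using h1), add_comm]
  · rw [mp u (-u) rfl h0 h1, pm (-u) u (by simp) (by simpa using h0) (by simpa using h1), add_comm]
  · rw [mm u h0 h1, pp (-u) (by simpa using h0) (by simpa using h1)]

lemma dist2 (p q : E2) : dist p q ^ 2 = (p 0 - q 0) ^ 2 + (p 1 - q 1) ^ 2 := by
  rw [EuclideanSpace.dist_eq, Real.sq_sqrt (by positivity)]
  simp [Fin.sum_univ_two, Real.dist_eq, sq_abs]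

lemma key {p q : E2} (hp : p ∈ bodyS ∩ halfA) (hq : q ∈ bodyS ∩ halfA)
    (h : dist p q ^ 2 = 17) : q 0 = - p 0 ∧ q 1 = -1 - p 1 := by
  rw [dist2] at h
  obtain ⟨⟨a1, a2, a3, a4, a5⟩, a6⟩ := hp
  rw [memA] at a6
  obtain ⟨⟨b1, b2, b3, b4, b5⟩, b6⟩ := hq
  rw [memA] at b6
  generalize p 0 = x at *
  generalize p 1 = y at *
  generalize q 0 = z at *
  generalize q 1 = w at *
  have c1 : y - w ≤ 1 := by
    by_contra! hc
    have : (x - z) ^ 2 ≤ (5 - (y - w)) ^ 2 := sq_le_sq' (by linarith) (by linarith)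
    nlinarith
  have c2 : w - y ≤ 1 := by
    by_contra! hc
    have : (x - z) ^ 2 ≤ (5 - (w - y)) ^ 2 := sq_le_sq' (by linarith) (by linarith)
    nlinarith
  have c3 : (x - z) ^ 2 = 4 ^ 2 := by
    have : (x - z) ^ 2 ≤ 4 ^ 2 := sq_le_sq' (by linarith) (by linarith)
    nlinarith
  have c4 : (y - w) ^ 2 = 1 ^ 2 := by linarith
  rcases sq_eq_sq_iff_eq_or_eq_neg.1 c3 with h | h <;>
    rcases sq_eq_sq_iff_eq_or_eq_neg.1 c4 with h' | h' <;>
    constructor <;> linarith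

theorem noncongruent_planar_bodies_same_width_same_area :
    ∃ P Q : Set (EuclideanSpace ℝ (Fin 2)),
      IsCompact P ∧ Convex ℝ P ∧ (interior P).Nonempty ∧
      IsCompact Q ∧ Convex ℝ Q ∧ (interior Q).Nonempty ∧
      volume P = volume Q ∧
      (∀ u : EuclideanSpace ℝ (Fin 2), ‖u‖ = 1 →
        suppFn P u + suppFn P (-u) = suppFn Q u + suppFn Q (-u)) ∧
      ¬ ∃ f : EuclideanSpace ℝ (Fin 2) ≃ᵢ EuclideanSpace ℝ (Fin 2), f '' P = Q := by
  refine ⟨bodyS ∩ halfA, bodyS ∩ halfB, compact_P, convex_S.inter convex_A, int_P,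
    compact_Q, convex_S.inter convex_B, int_Q, vol_eq, fun u _ => width_eq u, ?_⟩
  rintro ⟨f, hf⟩
  have m1 : !₂[(2 : ℝ), 0] ∈ bodyS ∩ halfB := (mem_Q _ _).2 (by norm_num)
  have m2 : !₂[(-2 : ℝ), 1] ∈ bodyS ∩ halfB := (mem_Q _ _).2 (by norm_num)
  have m3 : !₂[(-2 : ℝ), -1] ∈ bodyS ∩ halfB := (mem_Q _ _).2 (by norm_num)
  rw [← hf] at m1 m2 m3
  obtain ⟨p, hp, ep⟩ := m1
  obtain ⟨q, hq, eq⟩ := m2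
  obtain ⟨r, hr, er⟩ := m3
  have k1 := key hp hq (by rw [← f.dist_eq, ep, eq, dist2]; norm_num)
  have k2 := key hp hr (by rw [← f.dist_eq, ep, er, dist2]; norm_num)
  have : q = r := by
    ext i
    fin_cases i
    · exact k1.1.trans k2.1.symm
    · exact k1.2.trans k2.2.symm
  rw [this, er] at eq
  have := congrArg (fun v : E2 => v 1) eq
  norm_num at this
end

section
/- Let K be a convex body in ℝ³ of constant width (h_K(u) + h_K(−u) is the same for all unit vectors u) and of constant brightness (vol₂(K | u^⊥) is the same for all unit vectors u). Then K is a closed Euclidean ball. -/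
open MeasureTheory

open MeasureTheory Set Filter Topology
open scoped NNReal ENNReal

abbrev E3 := EuclideanSpace ℝ (Fin 3)

structure Body (K : Set E3) (w : ℝ) (F : E3 → E3) : Prop where
  comp : IsCompact K
  conv : Convex ℝ K
  int : (interior K).Nonempty
  w0 : 0 ≤ w
  mem : ∀ v, F v ∈ K
  max : ∀ v, ∀ z ∈ K, inner ℝ v z ≤ inner ℝ v (F v)
  str : ∀ v, ∀ z ∈ K, ‖v‖ * ‖z - F v‖ ^ 2 ≤ 2 * w * inner ℝ v (F v - z)
  opp : ∀ v, ‖v‖ • (F v - F (-v)) = w • v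

noncomputable def cc (x : ℝ × ℝ) : E3 := !₂[x.1, x.2, 1]

noncomputable def TT : E3 →L[ℝ] ℝ × ℝ :=
  (EuclideanSpace.proj (𝕜 := ℝ) (0 : Fin 3)).prod (EuclideanSpace.proj (𝕜 := ℝ) (1 : Fin 3))

lemma TT_apply (v : E3) : TT v = (v 0, v 1) := rfl

lemma inner3 (v z : E3) : inner ℝ v z = v 0 * z 0 + v 1 * z 1 + v 2 * z 2 := by
  simp [PiLp.inner_apply, Fin.sum_univ_three]; ring

lemma norm3 (v : E3) : ‖v‖ ^ 2 = v 0 ^ 2 + v 1 ^ 2 + v 2 ^ 2 := by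
  rw [EuclideanSpace.norm_sq_eq]; simp [Fin.sum_univ_three]

@[simp] lemma cc0 (x : ℝ × ℝ) : cc x 0 = x.1 := rfl
@[simp] lemma cc1 (x : ℝ × ℝ) : cc x 1 = x.2 := rfl
@[simp] lemma cc2 (x : ℝ × ℝ) : cc x 2 = 1 := rfl

lemma cc_norm (x : ℝ × ℝ) : 1 ≤ ‖cc x‖ := by
  have := norm3 (cc x)
  simp at this
  nlinarith [norm_nonneg (cc x), sq_nonneg x.1, sq_nonneg x.2]

lemma ext3 {v z : E3} (h0 : v 0 = z 0) (h1 : v 1 = z 1) (h2 : v 2 = z 2) : v = z := by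
  ext i; fin_cases i <;> assumption

namespace Body
variable {K : Set E3} {w : ℝ} {F : E3 → E3}

lemma uniq (h : Body K w F) {v z : E3} (hv : v ≠ 0) (hz : z ∈ K)
    (hm : inner ℝ v (F v) ≤ inner ℝ v z) : z = F v := by
  have h1 := h.str v z hz
  rw [inner_sub_right] at h1
  have hw := h.w0
  have hv' : 0 < ‖v‖ := norm_pos_iff.2 hv
  have h3 : 2 * w * (inner ℝ v (F v) - inner ℝ v z) ≤ 0 :=
    mul_nonpos_of_nonneg_of_nonpos (by positivity) (by linarith)
  have h4 : ‖z - F v‖ ^ 2 ≤ 0 := by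
    by_contra hc
    push Not at hc
    nlinarith [mul_pos hv' hc]
  have h5 : ‖z - F v‖ = 0 := by
    have := sq_nonneg ‖z - F v‖
    exact pow_eq_zero_iff (two_ne_zero) |>.1 (le_antisymm h4 this)
  exact sub_eq_zero.1 (norm_eq_zero.1 h5)

lemma smul (h : Body K w F) {v : E3} (hv : v ≠ 0) {t : ℝ} (ht : 0 < t) : F (t • v) = F v := by
  refine h.uniq hv (h.mem _) ?_
  have := h.max (t • v) (F v) (h.mem _)
  rw [inner_smul_left, inner_smul_left] at this
  exact le_of_mul_le_mul_left this (by simpa using ht)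

lemma lip (h : Body K w F) {ρ : ℝ} (hρ : 0 < ρ) {v v' : E3} (hv : ρ ≤ ‖v‖) (hv' : ρ ≤ ‖v'‖) :
    ‖F v - F v'‖ ≤ w / ρ * ‖v - v'‖ := by
  have h1 := h.str v (F v') (h.mem _)
  have h2 := h.str v' (F v) (h.mem _)
  have hw := h.w0
  rw [norm_sub_rev] at h1
  set a := F v - F v' with ha
  have ha' : F v' - F v = -a := by rw [ha]; abel
  rw [ha'] at h2
  have h3 : ρ * ‖a‖ ^ 2 ≤ w * inner ℝ (v - v') a := by
    have e1 : ρ * ‖a‖ ^ 2 ≤ ‖v‖ * ‖a‖ ^ 2 := by gcongr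
    have e2 : ρ * ‖a‖ ^ 2 ≤ ‖v'‖ * ‖a‖ ^ 2 := by gcongr
    rw [inner_neg_right] at h2
    rw [inner_sub_left]; nlinarith
  have h4 := real_inner_le_norm (v - v') a
  have h5 : ρ * ‖a‖ ^ 2 ≤ w * (‖v - v'‖ * ‖a‖) := h3.trans (by gcongr)
  rw [div_mul_eq_mul_div, le_div_iff₀ hρ]
  rcases (norm_nonneg a).eq_or_lt with h0 | h0
  · rw [← h0]; simp; positivity
  · by_contra hc
    push Not at hc
    nlinarith [mul_pos h0 (sub_pos.2 hc)]

lemma mono (h : Body K w F) (v v' : E3) : 0 ≤ inner ℝ (v - v') (F v - F v') := by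
  have h1 := h.max v _ (h.mem v')
  have h2 := h.max v' _ (h.mem v)
  rw [inner_sub_left, inner_sub_right, inner_sub_right]; linarith

lemma face (h : Body K w F) {v v' : E3} (e : F v = F v') {s t : ℝ} (hs : 0 ≤ s) (ht : 0 ≤ t)
    (h0 : s • v + t • v' ≠ 0) : F (s • v + t • v') = F v := by
  symm
  apply h.uniq h0 (h.mem _)
  have h1 := h.max v _ (h.mem (s • v + t • v'))
  have h2 := h.max v' _ (h.mem (s • v + t • v'))
  rw [← e] at h2
  simp only [inner_add_left, inner_smul_left, RCLike.conj_to_real] at *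
  nlinarith [mul_le_mul_of_nonneg_left h1 hs, mul_le_mul_of_nonneg_left h2 ht]

lemma rot (h : Body K w F) (R : E3 ≃ₗᵢ[ℝ] E3) : Body (R '' K) w (fun v => R (F (R.symm v))) where
  comp := h.comp.image R.continuous
  conv := h.conv.linear_image R.toLinearEquiv.toLinearMap
  int := by
    have := h.int.image R
    rwa [show R '' interior K = interior (R '' K) from R.toHomeomorph.image_interior K] at this
  w0 := h.w0
  mem v := mem_image_of_mem _ (h.mem _)
  max v z hz := by
    obtain ⟨y, hy, rfl⟩ := hz
    have := h.max (R.symm v) y hy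
    rwa [← R.inner_map_map, ← R.inner_map_map (R.symm v) (F _), R.apply_symm_apply] at this
  str v z hz := by
    obtain ⟨y, hy, rfl⟩ := hz
    have := h.str (R.symm v) y hy
    rw [← R.inner_map_map, R.apply_symm_apply, ← R.norm_map (y - _), map_sub, map_sub, R.symm.norm_map] at this
    exact this
  opp v := by
    have := congrArg R (h.opp (R.symm v))
    simpa only [map_smul, map_sub, R.apply_symm_apply, R.symm.norm_map, map_neg] using this

end Body

/-- unit ball -/
lemma body_ball : Body (Metric.closedBall (0 : E3) 1) 2 (fun v => ‖v‖⁻¹ • v) where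
  comp := isCompact_closedBall _ _
  conv := convex_closedBall _ _
  int := ⟨0, by rw [interior_closedBall _ one_ne_zero]; simp⟩
  w0 := by norm_num
  mem v := by
    rw [mem_closedBall_zero_iff, norm_smul, norm_inv, norm_norm]
    exact inv_mul_le_one
  max v z hz := by
    rw [mem_closedBall_zero_iff] at hz
    rw [inner_smul_right, real_inner_self_eq_norm_sq]
    rcases eq_or_ne v 0 with rfl | hv
    · simp
    have := norm_pos_iff.2 hv
    calc inner ℝ v z ≤ ‖v‖ * ‖z‖ := real_inner_le_norm _ _
      _ ≤ ‖v‖ * 1 := by gcongr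
      _ = _ := by field_simp
  str v z hz := by
    rw [mem_closedBall_zero_iff] at hz
    rcases eq_or_ne v 0 with rfl | hv
    · simp
    have hp := norm_pos_iff.2 hv
    rw [norm_sub_sq_real, inner_smul_right, inner_sub_right, inner_smul_right,
      real_inner_self_eq_norm_sq, norm_smul, norm_inv, norm_norm, real_inner_comm]
    have e : ‖v‖⁻¹ * ‖v‖ = 1 := inv_mul_cancel₀ hp.ne'
    have : ‖z‖ ^ 2 ≤ 1 := pow_le_one₀ (norm_nonneg _) hz
    rw [e]
    have : ‖v‖ * (‖z‖ ^ 2 - 2 * (‖v‖⁻¹ * inner ℝ v z) + 1 ^ 2) =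
      ‖v‖ * (‖z‖ ^ 2 + 1) - 2 * inner ℝ v z := by field_simp; ring
    rw [this]
    have : ‖v‖⁻¹ * ‖v‖ ^ 2 = ‖v‖ := by field_simp
    rw [this]
    have h7 := real_inner_le_norm v z
    nlinarith [mul_nonneg hp.le (mul_nonneg (sub_nonneg.2 hz) (show (0:ℝ) ≤ 3 + ‖z‖ by positivity))]
  opp v := by
    rcases eq_or_ne v 0 with rfl | hv
    · simp
    have hp := norm_pos_iff.2 hv
    rw [norm_neg, smul_neg, sub_neg_eq_add, ← two_smul ℝ, smul_comm, smul_smul ‖v‖, mul_inv_cancel₀ hp.ne', one_smul]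

lemma suppFn_eq {K : Set E3} (hK : IsCompact K) {v y : E3} (hy : y ∈ K)
    (hm : ∀ z ∈ K, inner ℝ v z ≤ inner ℝ v y) : suppFn K v = inner ℝ v y := by
  apply IsGreatest.csSup_eq
  refine ⟨⟨y, hy, rfl⟩, ?_⟩
  rintro _ ⟨z, hz, rfl⟩
  exact hm z hz

lemma exists_body {K : Set E3} (hKcomp : IsCompact K) (hKconv : Convex ℝ K)
    (hKint : (interior K).Nonempty) {w : ℝ}
    (hw : ∀ u : E3, ‖u‖ = 1 → suppFn K u + suppFn K (-u) = w) : ∃ F, Body K w F := by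
  have hne : K.Nonempty := hKint.mono interior_subset
  have : ∀ v : E3, ∃ y ∈ K, ∀ z ∈ K, inner ℝ v z ≤ inner ℝ v y := fun v => by
    obtain ⟨y, hy, hm⟩ := hKcomp.exists_isMaxOn hne (f := fun z => inner ℝ v z) (by fun_prop)
    exact ⟨y, hy, hm⟩
  choose F hF hmax using this
  have hs : ∀ v, suppFn K v = inner ℝ v (F v) := fun v => suppFn_eq hKcomp (hF v) (hmax v)
  have hw' : ∀ u : E3, ‖u‖ = 1 → inner ℝ u (F u - F (-u)) = w := fun u hu => by
    have := hw u hu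
    rw [hs, hs, inner_neg_left] at this
    rw [inner_sub_right]; linarith
  have hw0 : 0 ≤ w := by
    have e : ‖EuclideanSpace.single (0 : Fin 3) (1:ℝ)‖ = 1 := by simp
    rw [← hw' _ e, inner_sub_right]
    have := hmax (EuclideanSpace.single (0 : Fin 3) (1:ℝ)) _ (hF (-(EuclideanSpace.single (0 : Fin 3) (1:ℝ))))
    linarith
  have hdist : ∀ y ∈ K, ∀ z ∈ K, ‖z - y‖ ≤ w := fun y hy z hz => by
    rcases eq_or_ne (z - y) 0 with h0 | h0
    · rw [h0, norm_zero]; exact hw0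
    have hp := norm_pos_iff.2 h0
    have hu : ‖‖z - y‖⁻¹ • (z - y)‖ = 1 := by
      rw [norm_smul, norm_inv, norm_norm, inv_mul_cancel₀ hp.ne']
    have h1 := hmax (‖z - y‖⁻¹ • (z - y)) z hz
    have h2 := hmax (-(‖z - y‖⁻¹ • (z - y))) y hy
    have h3 := hw' _ hu
    have h4 : inner ℝ (‖z - y‖⁻¹ • (z - y)) (z - y) = ‖z - y‖ := by
      rw [inner_smul_left, real_inner_self_eq_norm_sq]; simp; field_simp
    rw [inner_sub_right] at h3 h4
    rw [inner_neg_left, inner_neg_left] at h2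
    linarith
  have hopp : ∀ u : E3, ‖u‖ = 1 → F u - F (-u) = w • u := fun u hu => by
    have h1 := hw' u hu
    have h2 := hdist _ (hF (-u)) _ (hF u)
    have : ‖(F u - F (-u)) - w • u‖ ^ 2 ≤ 0 := by
      rw [norm_sub_sq_real, inner_smul_right, real_inner_comm, h1, norm_smul, hu, mul_one]
      have : ‖F u - F (-u)‖ ^ 2 ≤ w ^ 2 := by gcongr
      simp
      nlinarith
    have := pow_eq_zero_iff (two_ne_zero) |>.1 (le_antisymm this (sq_nonneg _))
    exact sub_eq_zero.1 (norm_eq_zero.1 this)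
  have hstr : ∀ u : E3, ‖u‖ = 1 → ∀ y ∈ K, (∀ z ∈ K, inner ℝ u z ≤ inner ℝ u y) → ∀ z ∈ K,
      ‖z - y‖ ^ 2 ≤ 2 * w * inner ℝ u (y - z) := by
    intro u hu y hy hm z hz
    have hy' : y - F (-u) = w • u := by
      have h1 := hw' u hu
      have e : inner ℝ u y = inner ℝ u (F u) := le_antisymm (hmax u y hy) (hm _ (hF u))
      rw [inner_sub_right, ← e, ← inner_sub_right] at h1
      have h2 := hdist _ (hF (-u)) _ hy
      have : ‖(y - F (-u)) - w • u‖ ^ 2 ≤ 0 := by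
        rw [norm_sub_sq_real, inner_smul_right, real_inner_comm, h1, norm_smul, hu, mul_one]
        have : ‖y - F (-u)‖ ^ 2 ≤ w ^ 2 := by gcongr
        simp
        nlinarith
      have := pow_eq_zero_iff (two_ne_zero) |>.1 (le_antisymm this (sq_nonneg _))
      exact sub_eq_zero.1 (norm_eq_zero.1 this)
    have h3 := hdist _ (hF (-u)) z hz
    have e : z - F (-u) = (z - y) + w • u := by rw [← hy']; abel
    have h4 : ‖(z - y) + w • u‖ ^ 2 ≤ w ^ 2 := by rw [← e]; gcongr
    rw [norm_add_sq_real, inner_smul_right, norm_smul, hu, mul_one, real_inner_comm] at h4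
    have e2 : inner ℝ u (y - z) = - inner ℝ u (z - y) := by rw [← inner_neg_right, neg_sub]
    rw [e2]
    simp at h4
    nlinarith
  have huq : ∀ u : E3, ‖u‖ = 1 → ∀ y ∈ K, (∀ z ∈ K, inner ℝ u z ≤ inner ℝ u y) → y = F u := by
    intro u hu y hy hm
    have h1 := hstr u hu y hy hm _ (hF u)
    have h2 := hmax u y hy
    have : ‖F u - y‖ ^ 2 ≤ 0 := h1.trans (mul_nonpos_of_nonneg_of_nonpos (by positivity) (by
      rw [inner_sub_right]; linarith))
    have := pow_eq_zero_iff (two_ne_zero) |>.1 (le_antisymm this (sq_nonneg _))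
    exact (sub_eq_zero.1 (norm_eq_zero.1 this)).symm
  have hnorm : ∀ v : E3, v ≠ 0 → F v = F (‖v‖⁻¹ • v) := by
    intro v hv
    have hp := norm_pos_iff.2 hv
    apply huq _ (by rw [norm_smul, norm_inv, norm_norm, inv_mul_cancel₀ hp.ne']) _ (hF v)
    intro z hz
    have := hmax v z hz
    simp only [inner_smul_left, RCLike.conj_to_real]
    gcongr
  refine ⟨F, hKcomp, hKconv, hKint, hw0, hF, hmax, ?_, ?_⟩
  · intro v z hz
    rcases eq_or_ne v 0 with rfl | hv
    · simp
    have hp := norm_pos_iff.2 hv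
    have hu : ‖‖v‖⁻¹ • v‖ = 1 := by rw [norm_smul, norm_inv, norm_norm, inv_mul_cancel₀ hp.ne']
    have := hstr _ hu _ (hF _) (hmax (‖v‖⁻¹ • v)) z hz
    rw [← hnorm v hv, inner_smul_left] at this
    calc _ ≤ ‖v‖ * _ := mul_le_mul_of_nonneg_left this hp.le
      _ = _ := by simp; field_simp
  · intro v
    rcases eq_or_ne v 0 with rfl | hv
    · simp
    have hp := norm_pos_iff.2 hv
    have hu : ‖‖v‖⁻¹ • v‖ = 1 := by rw [norm_smul, norm_inv, norm_norm, inv_mul_cancel₀ hp.ne']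
    have := hopp _ hu
    rw [hnorm v hv, hnorm (-v) (neg_ne_zero.2 hv), norm_neg, smul_neg, this, smul_comm, smul_smul ‖v‖, mul_inv_cancel₀ hp.ne', one_smul]

open MeasureTheory Set Filter Topology
open scoped NNReal ENNReal

lemma null_curve {C : ℝ≥0} {γ : ℝ → ℝ × ℝ} (h : LipschitzWith C γ) : volume (range γ) = 0 := by
  rw [← hausdorffMeasure_prod_real]
  have h1 := h.dimH_range_le
  rw [Real.dimH_univ] at h1
  have : dimH (range γ) < ((2 : ℝ≥0) : ℝ≥0∞) := lt_of_le_of_lt h1 (by norm_num)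
  simpa using hausdorffMeasure_of_dimH_lt this

lemma null_image {C : ℝ≥0} {g : ℝ × ℝ → ℝ × ℝ} (h : LipschitzWith C g) {s : Set (ℝ × ℝ)}
    (hs : volume s = 0) : volume (g '' s) = 0 := by
  rw [← hausdorffMeasure_prod_real] at *
  have := h.hausdorffMeasure_image_le (d := 2) (by norm_num) s
  rw [hs, mul_zero] at this
  exact le_antisymm this (zero_le)

lemma area_lemma {C : ℝ≥0} {g : ℝ × ℝ → ℝ × ℝ} (h : LipschitzWith C g) {s : Set (ℝ × ℝ)}
    (hs : MeasurableSet s)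
    (hinj : ∀ x ∈ s, ∀ y ∈ s, g x = g y → x ≠ y → DifferentiableAt ℝ g x →
      (fderiv ℝ g x).det = 0) :
    volume (g '' s) = ∫⁻ x in s, ENNReal.ofReal |(fderiv ℝ g x).det| := by
  have hD : MeasurableSet {x | DifferentiableAt ℝ g x} := measurableSet_of_differentiableAt ℝ g
  have hdet : Measurable fun x => (fderiv ℝ g x).det :=
    ContinuousLinearMap.continuous_det.measurable.comp (measurable_fderiv ℝ g)
  have hN : volume {x | DifferentiableAt ℝ g x}ᶜ = 0 := h.ae_differentiableAt
  set s1 := s ∩ {x | DifferentiableAt ℝ g x} ∩ {x | (fderiv ℝ g x).det ≠ 0} with hs1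
  set s2 := s ∩ {x | DifferentiableAt ℝ g x} ∩ {x | (fderiv ℝ g x).det = 0} with hs2
  set s3 := s ∩ {x | DifferentiableAt ℝ g x}ᶜ with hs3
  have hm0 : MeasurableSet {x | (fderiv ℝ g x).det = 0} := hdet (measurableSet_singleton 0)
  have m1 : MeasurableSet s1 := (hs.inter hD).inter hm0.compl
  have hu : s = s1 ∪ (s2 ∪ s3) := by
    ext x; simp only [hs1, hs2, hs3, mem_union, mem_inter_iff, mem_compl_iff, mem_setOf_eq]; tauto
  have n2 : volume (g '' s2) = 0 :=
    addHaar_image_eq_zero_of_det_fderivWithin_eq_zero (f' := fderiv ℝ g) volume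
      (fun x hx => hx.1.2.hasFDerivAt.hasFDerivWithinAt) (fun x hx => hx.2)
  have n3 : volume (g '' s3) = 0 := null_image h (measure_mono_null inter_subset_right hN)
  have e1 : volume (g '' s) = volume (g '' s1) := by
    apply le_antisymm
    · conv_lhs => rw [hu, image_union]
      refine (measure_union_le _ _).trans ?_
      rw [image_union]
      have : volume (g '' s2 ∪ g '' s3) = 0 := measure_union_null n2 n3
      rw [this, add_zero]
    · exact measure_mono (image_mono (fun x hx => hx.1.1))
  have hi : InjOn g s1 := by
    intro x hx y hy hxy
    by_contra hne
    exact hx.2 (hinj x hx.1.1 y hy.1.1 hxy hne hx.1.2)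
  rw [e1, ← lintegral_abs_det_fderiv_eq_addHaar_image volume m1
    (fun x hx => hx.1.2.hasFDerivAt.hasFDerivWithinAt) hi]
  rw [← lintegral_indicator m1, ← lintegral_indicator hs]
  apply lintegral_congr_ae
  filter_upwards [h.ae_differentiableAt] with x hx
  by_cases hxs : x ∈ s
  · rw [indicator_of_mem hxs]
    by_cases h0 : (fderiv ℝ g x).det = 0
    · rw [indicator_of_notMem (fun hh => hh.2 h0), h0]; simp
    · rw [indicator_of_mem (show x ∈ s1 from ⟨⟨hxs, hx⟩, h0⟩)]
  · rw [indicator_of_notMem hxs, indicator_of_notMem (fun hh => hxs hh.1.1)]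

lemma tendsto_slope {f : ℝ × ℝ → ℝ} {x : ℝ × ℝ} (hf : DifferentiableAt ℝ f x) (v : ℝ × ℝ)
    {h : ℕ → ℝ} (h0 : ∀ n, h n ≠ 0) (hl : Tendsto h atTop (𝓝 0)) :
    Tendsto (fun n => (h n)⁻¹ * (f (x + h n • v) - f x)) atTop (𝓝 (fderiv ℝ f x v)) := by
  have := hf.hasFDerivAt.hasLineDerivAt v
  have h2 := this.tendsto_slope_zero
  exact h2.comp (tendsto_nhdsWithin_iff.2 ⟨hl, Eventually.of_forall h0⟩)

lemma null_lagrangian {CA CB : ℝ≥0} {A B : ℝ × ℝ → ℝ} (hA : LipschitzWith CA A)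
    (hB : LipschitzWith CB B) (hc : HasCompactSupport A) :
    ∫ x, (fderiv ℝ A x (1, 0) * fderiv ℝ B x (0, 1) - fderiv ℝ A x (0, 1) * fderiv ℝ B x (1, 0))
      = 0 := by
  set h : ℕ → ℝ := fun n => 1 / ((n : ℝ) + 1) with hh
  have hpos : ∀ n, 0 < h n := fun n => by simp only [hh]; positivity
  have hle : ∀ n, h n ≤ 1 := fun n => by
    simp only [hh]; rw [div_le_one (by positivity)]; linarith [(Nat.cast_nonneg n : (0:ℝ) ≤ n)]
  have hl : Tendsto h atTop (𝓝 0) := tendsto_one_div_add_atTop_nhds_zero_nat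
  have hAc := hA.continuous
  have hBc := hB.continuous
  have key : ∀ e f : ℝ × ℝ, ∫ x, (A (x + e) - A x) * (B x - B (x - f)) =
      ∫ x, A x * (B (x - e) - B (x - e - f) - B x + B (x - f)) := by
    intro e f
    have i1 : Integrable (fun x => A x * (B (x - e) - B (x - e - f))) :=
      (by fun_prop : Continuous _).integrable_of_hasCompactSupport hc.mul_right
    have i2 : Integrable (fun x => A x * (B x - B (x - f))) :=
      (by fun_prop : Continuous _).integrable_of_hasCompactSupport hc.mul_right
    have t := integral_add_right_eq_self (μ := volume) (fun x => A x * (B (x - e) - B (x - e - f))) e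
    have i1' := i1.comp_add_right e
    simp only [add_sub_cancel_right] at t i1'
    calc _ = ∫ x, (A (x + e) * (B x - B (x - f)) - A x * (B x - B (x - f))) := by
          congr 1; ext x; ring
      _ = (∫ x, A (x + e) * (B x - B (x - f))) - ∫ x, A x * (B x - B (x - f)) :=
          integral_sub i1' i2
      _ = (∫ x, A x * (B (x - e) - B (x - e - f))) - ∫ x, A x * (B x - B (x - f)) := by rw [t]
      _ = _ := by rw [← integral_sub i1 i2]; congr 1; ext x; ring
  set D : ℕ → ℝ × ℝ → ℝ := fun n x =>
    ((h n)⁻¹ * (A (x + h n • (1, 0)) - A x)) * ((-h n)⁻¹ * (B (x + (-h n) • (0, 1)) - B x)) -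
    ((h n)⁻¹ * (A (x + h n • (0, 1)) - A x)) * ((-h n)⁻¹ * (B (x + (-h n) • (1, 0)) - B x)) with hD
  set S := Metric.cthickening 1 (tsupport A) with hS
  have hScomp : IsCompact S := hc.isCompact.cthickening
  have hAz : ∀ x ∉ S, ∀ e : ℝ × ℝ, ‖e‖ ≤ 1 → A (x + e) = 0 := by
    intro x hx e he
    by_contra h0
    apply hx
    refine Metric.mem_cthickening_of_dist_le x (x + e) 1 _ (subset_tsupport _ h0) ?_
    simpa [dist_eq_norm] using he
  have hn1 : ∀ n, ‖h n • ((1:ℝ), (0:ℝ))‖ = h n := fun n => by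
    rw [norm_smul, Real.norm_of_nonneg (hpos n).le]; simp
  have hn2 : ∀ n, ‖h n • ((0:ℝ), (1:ℝ))‖ = h n := fun n => by
    rw [norm_smul, Real.norm_of_nonneg (hpos n).le]; simp
  have ints : ∀ (e f : ℝ × ℝ) , Integrable fun x => (A (x + e) - A x) * (B x - B (x - f)) := by
    intro e f
    apply Continuous.integrable_of_hasCompactSupport (by fun_prop)
    apply HasCompactSupport.mul_right
    exact (hc.comp_homeomorph (Homeomorph.addRight e)).sub hc
  have h0 : ∀ n, ∫ x, D n x = 0 := by
    intro n
    have e : D n = fun x => (h n)⁻¹ * (h n)⁻¹ * (((A (x + h n • (1, 0)) - A x) * (B x - B (x - h n • (0,1))))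
      - (A (x + h n • (0, 1)) - A x) * (B x - B (x - h n • (1,0)))) := by
      ext x; simp only [hD, neg_smul, ← sub_eq_add_neg, inv_neg]; ring
    rw [e, integral_const_mul, integral_sub (ints _ _) (ints _ _), key, key]
    have : (fun x => A x * (B (x - h n • (1, 0)) - B (x - h n • (1, 0) - h n • (0, 1)) - B x + B (x - h n • (0, 1))))
       = fun x => A x * (B (x - h n • (0, 1)) - B (x - h n • (0, 1) - h n • (1, 0)) - B x + B (x - h n • (1, 0))) := by
      ext x; rw [sub_right_comm x]; ring
    rw [this, sub_self, mul_zero]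
  have hlim : Tendsto (fun n => ∫ x, D n x) atTop (𝓝 (∫ x, (fderiv ℝ A x (1, 0) * fderiv ℝ B x (0, 1) - fderiv ℝ A x (0, 1) * fderiv ℝ B x (1, 0)))) := by
    apply tendsto_integral_of_dominated_convergence (S.indicator fun _ => (CA * CB + CA * CB : ℝ))
    · intro n
      apply Continuous.aestronglyMeasurable
      simp only [hD]; fun_prop
    · rw [integrable_indicator_iff hScomp.measurableSet]
      exact integrableOn_const (hScomp.measure_lt_top).ne
    · intro n
      apply Eventually.of_forall
      intro x
      by_cases hx : x ∈ S
      · rw [indicator_of_mem hx]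
        have bA : ∀ e : ℝ × ℝ, ‖h n • e‖ = h n → |(h n)⁻¹ * (A (x + h n • e) - A x)| ≤ CA := by
          intro e he
          have := hA.dist_le_mul (x + h n • e) x
          rw [Real.dist_eq, dist_eq_norm, add_sub_cancel_left, he] at this
          rw [abs_mul, abs_inv, abs_of_pos (hpos n), inv_mul_le_iff₀ (hpos n)]; linarith
        have bB : ∀ e : ℝ × ℝ, ‖h n • e‖ = h n → |(-h n)⁻¹ * (B (x + (-h n) • e) - B x)| ≤ CB := by
          intro e he
          have := hB.dist_le_mul (x + (-h n) • e) x
          rw [Real.dist_eq, dist_eq_norm, add_sub_cancel_left, neg_smul, norm_neg, he] at this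
          rw [abs_mul, abs_inv, abs_neg, abs_of_pos (hpos n), inv_mul_le_iff₀ (hpos n), neg_smul]; linarith
        refine (norm_sub_le _ _).trans (add_le_add ?_ ?_) <;> rw [norm_mul]
        · exact mul_le_mul (bA _ (hn1 n)) (bB _ (hn2 n)) (abs_nonneg _) (by positivity)
        · exact mul_le_mul (bA _ (hn2 n)) (bB _ (hn1 n)) (abs_nonneg _) (by positivity)
      · rw [indicator_of_notMem hx]
        have a0 := hAz x hx 0 (by simp)
        rw [add_zero] at a0
        have a1 := hAz x hx _ ((hn1 n).trans_le (hle n))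
        have a2 := hAz x hx _ ((hn2 n).trans_le (hle n))
        simp only [hD, a0, a1, a2]; simp
    · filter_upwards [hA.ae_differentiableAt, hB.ae_differentiableAt] with x xA xB
      have hne : ∀ n, h n ≠ 0 := fun n => (hpos n).ne'
      have hne' : ∀ n, -h n ≠ 0 := fun n => neg_ne_zero.2 (hne n)
      have hl' : Tendsto (fun n => -h n) atTop (𝓝 0) := by simpa using hl.neg
      exact ((tendsto_slope xA _ hne hl).mul (tendsto_slope xB _ hne' hl')).sub
        ((tendsto_slope xA _ hne hl).mul (tendsto_slope xB _ hne' hl'))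
  simp only [h0] at hlim
  exact tendsto_nhds_unique hlim tendsto_const_nhds

open MeasureTheory Set Filter Topology
open scoped NNReal ENNReal

noncomputable def LL : EuclideanSpace ℝ (Fin 2) ≃L[ℝ] ℝ × ℝ :=
  (EuclideanSpace.equiv (Fin 2) ℝ).trans (ContinuousLinearEquiv.finTwoArrow ℝ ℝ)

lemma LL_apply (v) : LL v = (v 0, v 1) := rfl

lemma bright_const {K : Set E3}
    (hbright : ∃ b : ENNReal, ∀ u : E3, ‖u‖ = 1 → μH[(2 : ℝ)] (shadow u K) = b) :
    ∃ β : ℝ≥0∞, ∀ R : E3 ≃ₗᵢ[ℝ] E3, volume (TT '' (R '' K)) = β := by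
  obtain ⟨b, hb⟩ := hbright
  have hH : Measure.IsAddHaarMeasure (μH[(2:ℝ)] : Measure (EuclideanSpace ℝ (Fin 2))) := by
    have := isAddHaarMeasure_hausdorffMeasure (E := EuclideanSpace ℝ (Fin 2))
    simpa using this
  have hM : Measure.IsAddHaarMeasure
      (Measure.map LL (μH[(2:ℝ)] : Measure (EuclideanSpace ℝ (Fin 2)))) :=
    ContinuousLinearEquiv.isAddHaarMeasure_map LL _
  have hv := Measure.isAddLeftInvariant_eq_smul (volume : Measure (ℝ × ℝ))
    (Measure.map LL (μH[(2:ℝ)] : Measure (EuclideanSpace ℝ (Fin 2))))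
  set c := (volume : Measure (ℝ × ℝ)).addHaarScalarFactor
    (Measure.map LL (μH[(2:ℝ)] : Measure (EuclideanSpace ℝ (Fin 2)))) with hc
  refine ⟨c • b, fun R => ?_⟩
  rw [hv, Measure.smul_apply]
  congr 1
  have hmap : (Measure.map LL (μH[(2:ℝ)] : Measure (EuclideanSpace ℝ (Fin 2)))) (TT '' (R '' K))
      = μH[(2:ℝ)] (LL ⁻¹' (TT '' (R '' K))) :=
    MeasurableEquiv.map_apply (LL.toHomeomorph.toMeasurableEquiv) _
  rw [hmap]
  set u : E3 := R.symm (EuclideanSpace.single 2 1) with hu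
  have hun : ‖u‖ = 1 := by simp [hu]
  rw [← hb u hun]
  set J : EuclideanSpace ℝ (Fin 2) → E3 := fun y => R.symm !₂[y 0, y 1, 0] with hJ
  have hiso : Isometry J := by
    refine R.symm.isometry.comp (Isometry.of_dist_eq fun x y => ?_)
    rw [EuclideanSpace.dist_eq, EuclideanSpace.dist_eq]
    simp [Fin.sum_univ_three, Fin.sum_univ_two]
  rw [← hiso.hausdorffMeasure_image (Or.inl (by norm_num))]
  congr 1
  have key : ∀ x : E3, (Submodule.orthogonalProjectionOnto ((Submodule.span ℝ {u})ᗮ) x : E3)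
      = J (LL.symm (TT (R x))) := by
    intro x
    have h1 : (Submodule.orthogonalProjectionOnto ((Submodule.span ℝ {u})ᗮ) x : E3)
      = x - (inner ℝ u x : ℝ) • u := by
      have := Submodule.starProjection_orthogonal_val (K := Submodule.span ℝ {u}) x
      rw [Submodule.starProjection_unit_singleton ℝ hun] at this
      exact this
    rw [h1]
    apply R.injective
    have hux : (inner ℝ u x : ℝ) = R x 2 := by
      rw [← R.inner_map_map, hu, R.apply_symm_apply]
      simp [inner3]
    rw [hux]
    simp only [hJ, R.apply_symm_apply, map_sub, map_smul, hu]
    have hL : ∀ p : ℝ × ℝ, LL.symm p 0 = p.1 ∧ LL.symm p 1 = p.2 := by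
      intro p
      have := LL.apply_symm_apply p
      rw [LL_apply] at this
      exact ⟨congrArg Prod.fst this, congrArg Prod.snd this⟩
    apply ext3 <;> simp [hL, TT_apply]
  ext z
  simp only [shadow, mem_image, key]
  constructor
  · rintro ⟨y, hy, rfl⟩
    obtain ⟨_, ⟨x, hx, rfl⟩, h2⟩ := hy
    refine ⟨x, hx, ?_⟩
    congr 1
    rw [h2]; exact LL.symm_apply_apply y
  · rintro ⟨x, hx, rfl⟩
    exact ⟨_, ⟨_, ⟨x, hx, rfl⟩, (LL.apply_symm_apply _).symm⟩, rfl⟩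

open MeasureTheory Set Filter Topology
open scoped NNReal ENNReal

lemma det2 (A : ℝ × ℝ →L[ℝ] ℝ × ℝ) :
    A.det = (A (1,0)).1 * (A (0,1)).2 - (A (0,1)).1 * (A (1,0)).2 := by
  have : A.det = LinearMap.det (A : ℝ × ℝ →ₗ[ℝ] ℝ × ℝ) := rfl
  rw [this, ← LinearMap.det_toMatrix (Module.Basis.finTwoProd ℝ), Matrix.det_fin_two]
  simp [LinearMap.toMatrix_apply]

lemma det_zero {A : ℝ × ℝ →L[ℝ] ℝ × ℝ} {v : ℝ × ℝ} (hv : v ≠ 0) (h : A v = 0) : A.det = 0 := by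
  have : A.det = LinearMap.det (A : ℝ × ℝ →ₗ[ℝ] ℝ × ℝ) := rfl
  rw [this, LinearMap.det_eq_zero_iff_ker_ne_bot]
  intro hb
  apply hv
  have : v ∈ LinearMap.ker (A : ℝ × ℝ →ₗ[ℝ] ℝ × ℝ) := h
  rw [hb] at this
  simpa using this

lemma cc_sub_norm (x y : ℝ × ℝ) : ‖cc x - cc y‖ ≤ 2 * ‖x - y‖ := by
  have h := norm3 (cc x - cc y)
  simp at h
  have h1 : |x.1 - y.1| ≤ ‖x - y‖ := norm_fst_le (x - y)
  have h2 : |x.2 - y.2| ≤ ‖x - y‖ := norm_snd_le (x - y)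
  have h0 := norm_nonneg (x - y)
  have h3 : (x.1 - y.1)^2 ≤ ‖x - y‖^2 := sq_le_sq' (by linarith [abs_le.1 h1]) (by linarith [abs_le.1 h1])
  have h4 : (x.2 - y.2)^2 ≤ ‖x - y‖^2 := sq_le_sq' (by linarith [abs_le.1 h2]) (by linarith [abs_le.1 h2])
  nlinarith [norm_nonneg (cc x - cc y)]

/-- the data of a projection direction -/
structure Proj (T : E3 →L[ℝ] ℝ × ℝ) (u p q : E3) : Prop where
  pn : ‖p‖ = 1
  qn : ‖q‖ = 1
  un : ‖u‖ = 1
  pq : inner ℝ p q = 0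
  perp : ∀ v, inner ℝ u v = 0 → ∃ a b : ℝ, v = a • p + b • q
  Tu : T u = 0
  ker : ∀ v, T v = 0 → v = (inner ℝ u v : ℝ) • u
  det : ∀ v a c : E3, inner ℝ v a = 0 → inner ℝ v c = 0 → v 2 ^ 2 = 1 →
    |(T a).1 * (T c).2 - (T c).1 * (T a).2| = |inner ℝ u v| * |a 0 * c 1 - c 0 * a 1|

lemma Proj.neg {T : E3 →L[ℝ] ℝ × ℝ} {u p q : E3} (h : Proj T u p q) : Proj T (-u) p q where
  pn := h.pn
  qn := h.qn
  un := by simpa using h.un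
  pq := h.pq
  perp v hv := h.perp v (by simpa using hv)
  Tu := by simpa using h.Tu
  ker v hv := by simpa using h.ker v hv
  det v a c h1 h2 h3 := by simpa using h.det v a c h1 h2 h3

lemma proj_of (R : E3 ≃ₗᵢ[ℝ] E3) :
    Proj (TT.comp (R.toContinuousLinearEquiv : E3 →L[ℝ] E3)) (R.symm (EuclideanSpace.single 2 1))
      (R.symm (EuclideanSpace.single 0 1)) (R.symm (EuclideanSpace.single 1 1)) := by
  have hi : ∀ i (v : E3), inner ℝ (R.symm (EuclideanSpace.single i (1:ℝ))) v = R v i := by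
    intro i v
    rw [← R.inner_map_map, R.apply_symm_apply, EuclideanSpace.inner_single_left]
    simp
  refine ⟨by simp, by simp, by simp, ?_, ?_, ?_, ?_, ?_⟩
  · rw [hi]; simp
  · intro v hv
    rw [hi] at hv
    refine ⟨R v 0, R v 1, R.injective ?_⟩
    apply ext3 <;> simp [hv]
  · simp [TT_apply]
  · intro v hv
    rw [hi]
    simp [TT_apply] at hv
    apply R.injective
    apply ext3 <;> simp [hv]
  · intro v a c hva hvc hv2
    have hT : ∀ a, (TT.comp (R.toContinuousLinearEquiv : E3 →L[ℝ] E3)) a =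
      (inner ℝ (R.symm (EuclideanSpace.single 0 (1:ℝ))) a, inner ℝ (R.symm (EuclideanSpace.single 1 (1:ℝ))) a) := by
      intro a; rw [hi, hi]; rfl
    rw [hT, hT]
    set b0 := R.symm (EuclideanSpace.single 0 (1:ℝ)) with hb0
    set b1 := R.symm (EuclideanSpace.single 1 (1:ℝ)) with hb1
    set b2 := R.symm (EuclideanSpace.single 2 (1:ℝ)) with hb2
    have hN : ‖v‖ ^ 2 = (inner ℝ b0 v) ^ 2 + (inner ℝ b1 v) ^ 2 + (inner ℝ b2 v) ^ 2 := by
      rw [hi, hi, hi, ← R.norm_map v, norm3]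
    have h00 : inner ℝ b0 b0 = (1:ℝ) := by rw [hi, hb0]; simp
    have h11 : inner ℝ b1 b1 = (1:ℝ) := by rw [hi, hb1]; simp
    have h01 : inner ℝ b0 b1 = (0:ℝ) := by rw [hi, hb1]; simp
    rw [← sq_eq_sq₀ (abs_nonneg _) (by positivity), mul_pow, sq_abs, sq_abs, sq_abs]
    simp only [norm3, inner3] at *
    have e : (b2 0 * v 0 + b2 1 * v 1 + b2 2 * v 2)^2 =
      ((b0 1 * b1 2 - b0 2 * b1 1) * v 0 + (b0 2 * b1 0 - b0 0 * b1 2) * v 1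
        + (b0 0 * b1 1 - b0 1 * b1 0) * v 2)^2 := by
      have g : ((b0 1 * b1 2 - b0 2 * b1 1) * v 0 + (b0 2 * b1 0 - b0 0 * b1 2) * v 1
        + (b0 0 * b1 1 - b0 1 * b1 0) * v 2)^2 =
        (b0 0 * b0 0 + b0 1 * b0 1 + b0 2 * b0 2) * ((b1 0 * b1 0 + b1 1 * b1 1 + b1 2 * b1 2)
          * (v 0 ^2 + v 1 ^2 + v 2 ^2) - (b1 0 * v 0 + b1 1 * v 1 + b1 2 * v 2)^2)
        - (b0 0 * b1 0 + b0 1 * b1 1 + b0 2 * b1 2) * ((b0 0 * b1 0 + b0 1 * b1 1 + b0 2 * b1 2)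
          * (v 0 ^2 + v 1 ^2 + v 2 ^2) - (b1 0 * v 0 + b1 1 * v 1 + b1 2 * v 2) * (b0 0 * v 0 + b0 1 * v 1 + b0 2 * v 2))
        + (b0 0 * v 0 + b0 1 * v 1 + b0 2 * v 2) * ((b0 0 * b1 0 + b0 1 * b1 1 + b0 2 * b1 2) * (b1 0 * v 0 + b1 1 * v 1 + b1 2 * v 2) - (b1 0 * b1 0 + b1 1 * b1 1 + b1 2 * b1 2) * (b0 0 * v 0 + b0 1 * v 1 + b0 2 * v 2)) := by ring
      rw [g, h00, h11, h01]
      linarith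
    rw [e, ← mul_pow]
    -- a × c = D v₂ v
    set D := a 0 * c 1 - c 0 * a 1 with hD
    have ha2 : a 2 = - (v 0 * a 0 + v 1 * a 1) * v 2 := by
      linear_combination v 2 * hva - a 2 * hv2
    have hc2 : c 2 = - (v 0 * c 0 + v 1 * c 1) * v 2 := by
      linear_combination v 2 * hvc - c 2 * hv2
    have : ((b0 0 * a 0 + b0 1 * a 1 + b0 2 * a 2) * (b1 0 * c 0 + b1 1 * c 1 + b1 2 * c 2)
      - (b0 0 * c 0 + b0 1 * c 1 + b0 2 * c 2) * (b1 0 * a 0 + b1 1 * a 1 + b1 2 * a 2)) =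
      v 2 * (((b0 1 * b1 2 - b0 2 * b1 1) * v 0 + (b0 2 * b1 0 - b0 0 * b1 2) * v 1
        + (b0 0 * b1 1 - b0 1 * b1 0) * v 2) * D) := by
      rw [ha2, hc2, hD]
      linear_combination (-(b0 0 * b1 1 - b0 1 * b1 0) * (a 0 * c 1 - c 0 * a 1)) * hv2
    rw [this, mul_pow (v 2), hv2, one_mul]

lemma measurable_image_open {g : ℝ × ℝ → ℝ × ℝ} (hg : Continuous g) {s : Set (ℝ × ℝ)}
    (hs : IsOpen s) : MeasurableSet (g '' s) := by
  have : LocallyCompactSpace s := hs.locallyCompactSpace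
  have h1 : IsSigmaCompact s := isSigmaCompact_iff_sigmaCompactSpace.2 inferInstance
  obtain ⟨k, hk, rfl⟩ := h1
  rw [image_iUnion]
  exact MeasurableSet.iUnion fun i => ((hk i).image hg).isClosed.measurableSet

open MeasureTheory Set Filter Topology
open scoped NNReal ENNReal

namespace Body
variable {K : Set E3} {w : ℝ} {F : E3 → E3}

lemma cc_lip (h : Body K w F) {σ : ℝ} (hσ : σ ^ 2 = 1) :
    LipschitzWith (Real.toNNReal (2 * w)) (fun x => F (σ • cc x)) := by
  have hs : ‖σ‖ = 1 := by
    rw [← sq_eq_sq₀ (norm_nonneg _) (by norm_num), Real.norm_eq_abs, sq_abs, hσ]; norm_num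
  refine LipschitzWith.of_dist_le_mul fun x y => ?_
  rw [dist_eq_norm, dist_eq_norm]
  have hn : ∀ x, 1 ≤ ‖σ • cc x‖ := fun x => by rw [norm_smul, hs, one_mul]; exact cc_norm x
  have := h.lip one_pos (hn x) (hn y)
  rw [← smul_sub, norm_smul, hs, one_mul, div_one] at this
  rw [Real.coe_toNNReal _ (by linarith [h.w0])]
  calc _ ≤ _ := this
    _ ≤ w * (2 * ‖x - y‖) := mul_le_mul_of_nonneg_left (cc_sub_norm x y) h.w0
    _ = _ := by ring

lemma top_uniq (h : Body K w F) {T u p q} (P : Proj T u p q) {v v' : E3}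
    (hv : 0 < (inner ℝ u v : ℝ)) (hv' : 0 < (inner ℝ u v' : ℝ)) (e : T (F v) = T (F v')) :
    F v = F v' := by
  have h1 : T (F v - F v') = 0 := by rw [map_sub, e, sub_self]
  have h2 := P.ker _ h1
  set τ : ℝ := inner ℝ u (F v - F v') with hτ
  have h3 := h.max v (F v') (h.mem v')
  have h4 := h.max v' (F v) (h.mem v)
  have h5 : F v = F v' + τ • u := by rw [← h2]; abel
  rw [h5, inner_add_right, inner_smul_right, real_inner_comm] at h3 h4
  rw [real_inner_comm] at hv hv'
  rw [real_inner_comm v' (F v')] at h4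
  have h6 : 0 ≤ τ := by
    by_contra hc; push Not at hc
    nlinarith [real_inner_comm v (F v')]
  have h7 : τ ≤ 0 := by
    by_contra hc; push Not at hc
    nlinarith [real_inner_comm v' (F v')]
  have : τ = 0 := le_antisymm h7 h6
  rw [h5, this]; simp

lemma deriv_perp (h : Body K w F) {σ : ℝ} {x : ℝ × ℝ}
    (hd : DifferentiableAt ℝ (fun x => F (σ • cc x)) x) (ξ : ℝ × ℝ) :
    inner ℝ (σ • cc x) (fderiv ℝ (fun x => F (σ • cc x)) x ξ) = (0:ℝ) := by
  have hm : IsLocalMax (fun y => (inner ℝ (σ • cc x) (F (σ • cc y)) : ℝ)) x :=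
    Eventually.of_forall fun y => h.max _ _ (h.mem _)
  have h1 : HasFDerivAt (fun y => (inner ℝ (σ • cc x) (F (σ • cc y)) : ℝ))
      ((innerSL ℝ (σ • cc x)).comp (fderiv ℝ (fun x => F (σ • cc x)) x)) x :=
    (innerSL ℝ (σ • cc x)).hasFDerivAt.comp x hd.hasFDerivAt
  have := hm.hasFDerivAt_eq_zero h1
  exact congrArg (fun L => L ξ) this

lemma half_area (h : Body K w F) {T u p q} (P : Proj T u p q) {σ : ℝ} (hσ : σ ^ 2 = 1) :
    volume ((fun x => T (F (σ • cc x))) '' {x | 0 < (inner ℝ u (σ • cc x) : ℝ)}) =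
    ∫⁻ x in {x | 0 < (inner ℝ u (σ • cc x) : ℝ)}, ENNReal.ofReal (|(inner ℝ u (cc x) : ℝ)| *
      |(fderiv ℝ (fun x => TT (F (σ • cc x))) x).det|) := by
  have hcc : Continuous cc := by
    unfold cc; fun_prop
  have hL := T.lipschitz.comp (h.cc_lip hσ)
  have hopen : IsOpen {x | 0 < (inner ℝ u (σ • cc x) : ℝ)} :=
    isOpen_lt continuous_const (by fun_prop)
  have hpc : ∀ (x y : ℝ × ℝ) (t : ℝ), cc (x + t • (y - x)) = (1 - t) • cc x + t • cc y := by
    intro x y t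
    apply ext3 <;> simp <;> ring
  rw [show (fun x => T (F (σ • cc x))) = T ∘ (fun x => F (σ • cc x)) from rfl]
  rw [area_lemma hL hopen.measurableSet]
  · refine lintegral_congr_ae (ae_restrict_of_ae ?_)
    filter_upwards [(h.cc_lip hσ).ae_differentiableAt] with x hx
    congr 1
    have e1 : fderiv ℝ (T ∘ (fun x => F (σ • cc x))) x = T.comp (fderiv ℝ (fun x => F (σ • cc x)) x) :=
      (T.hasFDerivAt.comp x hx.hasFDerivAt).fderiv
    have e2 : fderiv ℝ (fun x => TT (F (σ • cc x))) x = TT.comp (fderiv ℝ (fun x => F (σ • cc x)) x) :=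
      (TT.hasFDerivAt.comp x hx.hasFDerivAt).fderiv
    rw [e1, e2, det2, det2]
    have := P.det (σ • cc x) _ _ (h.deriv_perp hx (1,0)) (h.deriv_perp hx (0,1)) (by simp [hσ])
    simp only [ContinuousLinearMap.comp_apply, TT_apply]
    rw [this, inner_smul_right, abs_mul]
    have : |σ| = 1 := by
      rw [← sq_eq_sq₀ (abs_nonneg _) (by norm_num), sq_abs, hσ]; norm_num
    rw [this, one_mul]
  · intro x hx y hy hxy hne hd
    apply det_zero (v := y - x) (sub_ne_zero.2 hne.symm)
    have hF : F (σ • cc x) = F (σ • cc y) := h.top_uniq P hx hy hxy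
    have hconst : ∀ t ∈ Icc (0:ℝ) 1, F (σ • cc (x + t • (y - x))) = F (σ • cc x) := by
      intro t ht
      rw [hpc, smul_add, smul_comm σ, smul_comm σ]
      refine h.face hF (by linarith [ht.2]) ht.1 ?_
      intro h0
      have := congrArg (fun v : E3 => v 2) h0
      simp at this
      have : σ = 0 := by linarith
      rw [this] at hσ; norm_num at hσ
    have hl := hd.hasFDerivAt.hasLineDerivAt (y - x)
    have h2 := hl.tendsto_slope_zero_right
    have h3 : Tendsto (fun t : ℝ => t⁻¹ • ((T ∘ (fun x => F (σ • cc x))) (x + t • (y - x)) -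
        (T ∘ (fun x => F (σ • cc x))) x)) (𝓝[>] 0) (𝓝 0) := by
      refine tendsto_const_nhds.congr' ?_
      filter_upwards [Ioc_mem_nhdsGT (zero_lt_one (α := ℝ))] with t ht
      simp [hconst t ⟨ht.1.le, ht.2⟩]
    exact tendsto_nhds_unique h2 h3

lemma null_circle (h : Body K w F) (T : E3 →L[ℝ] ℝ × ℝ) {p q : E3} (hp : ‖p‖ = 1) (hq : ‖q‖ = 1)
    (hpq : inner ℝ p q = (0:ℝ)) :
    volume {y | ∃ a b : ℝ, a • p + b • q ≠ 0 ∧ T (F (a • p + b • q)) = y} = 0 := by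
  have hpart : ∀ σ : ℝ, σ ^ 2 = 1 → volume (range fun s : ℝ => T (F (σ • (p + s • q)))) = 0 := by
    intro σ hσ
    have hs : ‖σ‖ = 1 := by
      rw [← sq_eq_sq₀ (norm_nonneg _) (by norm_num), Real.norm_eq_abs, sq_abs, hσ]; norm_num
    have hn : ∀ s : ℝ, 1 ≤ ‖σ • (p + s • q)‖ := by
      intro s
      rw [norm_smul, hs, one_mul]
      have := norm_add_sq_real p (s • q)
      rw [inner_smul_right, hpq, hp] at this
      nlinarith [norm_nonneg (p + s • q), sq_nonneg ‖s • q‖]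
    have hl : LipschitzWith (Real.toNNReal w) (fun s : ℝ => F (σ • (p + s • q))) := by
      refine LipschitzWith.of_dist_le_mul fun s t => ?_
      have := h.lip one_pos (hn s) (hn t)
      rw [dist_eq_norm, Real.coe_toNNReal _ h.w0]
      refine this.trans (le_of_eq ?_)
      rw [← smul_sub, norm_smul, hs, one_mul, div_one, add_sub_add_left_eq_sub, ← sub_smul, norm_smul,
        hq, mul_one, Real.dist_eq, Real.norm_eq_abs]
    exact null_curve (T.lipschitz.comp hl)
  refine measure_mono_null (t := ((range fun s : ℝ => T (F ((1:ℝ) • (p + s • q)))) ∪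
    (range fun s : ℝ => T (F ((-1:ℝ) • (p + s • q))))) ∪ ({T (F q)} ∪ {T (F (-q))})) ?_ ?_
  · rintro y ⟨a, b, hne, rfl⟩
    rcases lt_trichotomy a 0 with ha | ha | ha
    · left; right
      refine ⟨b / a, ?_⟩
      have ha0 : a ≠ 0 := ha.ne
      have : a • p + b • q = (-a) • ((-1:ℝ) • (p + (b / a) • q)) := by
        rw [smul_smul, smul_add, smul_smul]; congr 2 <;> field_simp
      dsimp only
      have e := h.smul (v := (-1:ℝ) • (p + (b / a) • q)) (t := -a)
        (by intro h0; rw [this, h0, smul_zero] at hne; exact hne rfl) (by linarith)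
      rw [this, e]
    · subst ha
      right
      rw [zero_smul, zero_add] at *
      rcases lt_trichotomy b 0 with hb | hb | hb
      · right
        have : b • q = (-b) • (-q) := by simp
        rw [mem_singleton_iff, this, h.smul _ (by linarith)]
        intro h0; rw [this, h0, smul_zero] at hne; exact hne rfl
      · simp [hb] at hne
      · left
        rw [mem_singleton_iff, h.smul _ hb]
        intro h0; rw [h0, smul_zero] at hne; exact hne rfl
    · left; left
      refine ⟨b / a, ?_⟩
      have : a • p + b • q = a • ((1:ℝ) • (p + (b / a) • q)) := by
        rw [smul_smul, smul_add, smul_smul]; congr 2 <;> field_simp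
      dsimp only
      rw [this, h.smul _ ha]
      intro h0; rw [this, h0, smul_zero] at hne; exact hne rfl
  · refine measure_union_null (measure_union_null (hpart _ (by norm_num)) (hpart _ (by norm_num)))
      (measure_union_null (by simp) (by simp))

lemma exists_normal (h : Body K w F) {T u p q} (P : Proj T u p q) {y : ℝ × ℝ} (hy : y ∈ T '' K) :
    ∃ v : E3, v ≠ 0 ∧ 0 ≤ (inner ℝ u v : ℝ) ∧ T (F v) = y := by
  have hc : IsCompact (K ∩ T ⁻¹' {y}) := h.comp.inter_right (isClosed_singleton.preimage T.continuous)
  obtain ⟨z0, hz0, hz0y⟩ := hy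
  obtain ⟨z, ⟨hzK, hzy⟩, hz⟩ := hc.exists_isMaxOn ⟨z0, hz0, hz0y⟩
    (f := fun z => (inner ℝ u z : ℝ)) (by fun_prop)
  rw [mem_preimage, mem_singleton_iff] at hzy
  have uu : inner ℝ u u = (1:ℝ) := by rw [real_inner_self_eq_norm_sq, P.un]; norm_num
  obtain ⟨f, c, hf, h1, h2⟩ := geometric_hahn_banach_of_nonempty_interior h.conv
    (t := (fun τ : ℝ => z + τ • u) '' Ioi 0) (by
      rintro _ ⟨s, hs, rfl⟩ _ ⟨t, ht, rfl⟩ a b ha hb hab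
      refine ⟨a * s + b * t, ?_, ?_⟩
      · rw [mem_Ioi] at *
        rcases ha.eq_or_lt with rfl | ha
        · have : b = 1 := by linarith
          subst this; simpa using ht
        · have := mul_pos ha hs
          have := mul_nonneg hb ht.le
          linarith
      · have : z = (a + b) • z := by rw [hab, one_smul]
        dsimp only
        nth_rw 1 [this]
        module)
    (by
      rw [Set.disjoint_left]
      rintro _ hi ⟨t, ht, rfl⟩
      have hK := interior_subset hi
      have := hz ⟨hK, by simp [P.Tu, hzy]⟩
      simp only [Set.mem_ofPred_eq, inner_add_right, inner_smul_right, uu] at this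
      rw [mem_Ioi] at ht
      linarith) h.int ((nonempty_Ioi (a := (0:ℝ))).image _)
  set v := (InnerProductSpace.toDual ℝ E3).symm f with hv
  have hfv : ∀ x, f x = inner ℝ v x := fun x => by rw [hv, InnerProductSpace.toDual_symm_apply]
  have hv0 : v ≠ 0 := by simpa [hv] using hf
  have hz1 := h1 z hzK
  have h3 : ∀ τ : ℝ, 0 < τ → c ≤ f z + τ * f u := by
    intro τ hτ
    have := h2 _ ⟨τ, hτ, rfl⟩
    simpa using this
  have h4 : c ≤ f z := by
    have ht : Tendsto (fun τ : ℝ => f z + τ * f u) (𝓝[>] 0) (𝓝 (f z + 0 * f u)) := by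
      refine Tendsto.mono_left (Continuous.tendsto (by fun_prop) _) nhdsWithin_le_nhds
    rw [zero_mul, add_zero] at ht
    refine ge_of_tendsto ht ?_
    filter_upwards [self_mem_nhdsWithin] with τ hτ using h3 τ hτ
  have hFz : z = F v := by
    apply h.uniq hv0 hzK
    rw [← hfv, ← hfv]
    exact (h1 _ (h.mem v)).trans h4
  refine ⟨v, hv0, ?_, by rw [← hFz, hzy]⟩
  have := h3 1 one_pos
  rw [real_inner_comm, ← hfv]
  linarith

end Body

open MeasureTheory Set Filter Topology
open scoped NNReal ENNReal

noncomputable def dd (F : E3 → E3) (σ : ℝ) (x : ℝ × ℝ) : ℝ :=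
  (fderiv ℝ (fun x => TT (F (σ • cc x))) x).det

lemma measurable_dd (F : E3 → E3) (σ : ℝ) : Measurable (dd F σ) :=
  ContinuousLinearMap.continuous_det.measurable.comp (measurable_fderiv ℝ _)

lemma continuous_cc : Continuous cc := by unfold cc; fun_prop

namespace Body
variable {K : Set E3} {w : ℝ} {F : E3 → E3}

lemma area (h : Body K w F) {T u p q} (P : Proj T u p q) :
    volume (T '' K) = (∫⁻ x in {x | 0 < (inner ℝ u (cc x) : ℝ)},
      ENNReal.ofReal (|(inner ℝ u (cc x) : ℝ)| * |dd F 1 x|)) +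
      ∫⁻ x in {x | (inner ℝ u (cc x) : ℝ) < 0},
      ENNReal.ofReal (|(inner ℝ u (cc x) : ℝ)| * |dd F (-1) x|) := by
  have hm : (-1 : ℝ) ^ 2 = 1 := by norm_num
  have h1 : (1 : ℝ) ^ 2 = 1 := by norm_num
  have a1 := h.half_area P h1
  have a2 := h.half_area P hm
  set A := (fun x => T (F ((1:ℝ) • cc x))) '' {x | 0 < (inner ℝ u ((1:ℝ) • cc x) : ℝ)} with hA
  set B := (fun x => T (F ((-1:ℝ) • cc x))) '' {x | 0 < (inner ℝ u ((-1:ℝ) • cc x) : ℝ)} with hB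
  have e1 : {x | 0 < (inner ℝ u ((1:ℝ) • cc x) : ℝ)} = {x | 0 < (inner ℝ u (cc x) : ℝ)} := by
    simp
  have e2 : {x | 0 < (inner ℝ u ((-1:ℝ) • cc x) : ℝ)} = {x | (inner ℝ u (cc x) : ℝ) < 0} := by
    simp
  rw [e1] at a1
  rw [e2] at a2
  change _ = (∫⁻ x in {x | 0 < (inner ℝ u (cc x) : ℝ)},
      ENNReal.ofReal (|(inner ℝ u (cc x) : ℝ)| * |dd F 1 x|)) at a1
  change _ = ∫⁻ x in {x | (inner ℝ u (cc x) : ℝ) < 0},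
      ENNReal.ofReal (|(inner ℝ u (cc x) : ℝ)| * |dd F (-1) x|) at a2
  rw [← a1, ← a2]
  set e0 : E3 := EuclideanSpace.single 0 1 with he0
  set e1 : E3 := EuclideanSpace.single 1 1 with he1
  have n1 := h.null_circle T P.pn P.qn P.pq
  have n2 := h.null_circle T (p := e0) (q := e1) (by simp [he0]) (by simp [he1])
    (by simp [he0, he1, inner3])
  have circ : ∀ v : E3, v ≠ 0 → v 2 = 0 → T (F v) ∈ {y | ∃ a b : ℝ, a • e0 + b • e1 ≠ 0 ∧ T (F (a • e0 + b • e1)) = y} := by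
    intro v hv hv2
    have : v 0 • e0 + v 1 • e1 = v := by
      apply ext3 <;> simp [he0, he1, hv2]
    refine ⟨v 0, v 1, ?_, ?_⟩ <;> rw [this]
    exact hv
  have hdisj : AEDisjoint volume A B := by
    refine measure_mono_null ?_ n2
    rintro y ⟨⟨x, hx, rfl⟩, ⟨x', hx', e⟩⟩
    dsimp only at e ⊢
    have hF := h.top_uniq P hx hx' e.symm
    have hp : 0 < (inner ℝ u ((1:ℝ) • cc x + (-1:ℝ) • cc x') : ℝ) := by
      rw [inner_add_right]; exact add_pos hx hx'
    have hne : (1:ℝ) • cc x + (-1:ℝ) • cc x' ≠ 0 := by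
      intro h0; rw [h0, inner_zero_right] at hp; exact lt_irrefl _ hp
    have h3 := h.face hF zero_le_one zero_le_one (by simpa using hne)
    rw [← h3]
    refine circ _ (by simpa using hne) (by simp)
  have hBm : MeasurableSet B := by
    refine measurable_image_open ?_ ?_
    · exact T.continuous.comp (h.cc_lip hm).continuous
    · exact isOpen_lt continuous_const (by have := continuous_cc; fun_prop)
  have hun := measure_union₀ hBm.nullMeasurableSet hdisj
  have goal1 : volume (T '' K) = volume (A ∪ B) := by
    apply le_antisymm
    · calc volume (T '' K) ≤ volume ((A ∪ B) ∪ (_ ∪ _)) := ?_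
        _ ≤ volume (A ∪ B) + volume _ := measure_union_le _ _
        _ = volume (A ∪ B) := by rw [measure_union_null n1 n2, add_zero]
      apply measure_mono
      intro y hy
      obtain ⟨v, hv0, hvu, rfl⟩ := h.exists_normal P hy
      rcases hvu.eq_or_lt with hz | hpos
      · right; left
        obtain ⟨a, b, hab⟩ := P.perp v hz.symm
        refine ⟨a, b, ?_, ?_⟩ <;> rw [← hab]
        exact hv0
      have hsc : v 2 ≠ 0 → v = (v 2) • cc (v 0 / v 2, v 1 / v 2) := by
        intro h2
        apply ext3 <;> simp <;> field_simp
      rcases lt_trichotomy (v 2) 0 with h2 | h2 | h2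
      · left; right
        refine ⟨(v 0 / v 2, v 1 / v 2), ?_, ?_⟩
        · rw [hsc h2.ne, inner_smul_right] at hpos
          rw [Set.mem_ofPred_eq, inner_smul_right]
          nlinarith
        · dsimp only
          have e := h.smul (v := (-1:ℝ) • cc (v 0 / v 2, v 1 / v 2)) (t := - v 2) (by
            intro h0
            have := congrArg (fun v : E3 => v 2) h0
            simp at this) (by linarith)
          rw [← e, smul_smul]
          conv_rhs => rw [hsc h2.ne]
          congr 3
          ring
      · right; right
        exact circ v hv0 h2
      · left; left
        refine ⟨(v 0 / v 2, v 1 / v 2), ?_, ?_⟩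
        · rw [hsc h2.ne', inner_smul_right] at hpos
          rw [Set.mem_ofPred_eq, inner_smul_right, one_mul]
          exact pos_of_mul_pos_right hpos h2.le
        · dsimp only
          have e := h.smul (v := (1:ℝ) • cc (v 0 / v 2, v 1 / v 2)) (t := v 2) (by
            intro h0
            have := congrArg (fun v : E3 => v 2) h0
            simp at this) (by linarith)
          rw [← e, smul_smul]
          conv_rhs => rw [hsc h2.ne']
          congr 3
          ring
    · apply measure_mono
      rintro y (⟨x, _, rfl⟩ | ⟨x, _, rfl⟩) <;> exact ⟨_, h.mem _, rfl⟩
  rw [goal1, hun]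

lemma area2 (h : Body K w F) {T u p q} (P : Proj T u p q) :
    2 * volume (T '' K) = ∫⁻ x, ENNReal.ofReal (|(inner ℝ u (cc x) : ℝ)|) *
      ENNReal.ofReal (|dd F 1 x| + |dd F (-1) x|) := by
  have hA := h.area P
  have hB := h.area P.neg
  simp only [inner_neg_left, abs_neg, Left.neg_pos_iff, Left.neg_neg_iff] at hB
  have hme := continuous_cc
  have hml : Measurable fun x => (inner ℝ u (cc x) : ℝ) :=
    Continuous.measurable (by fun_prop)
  have hsplit : ∀ σ, ∫⁻ x, ENNReal.ofReal (|(inner ℝ u (cc x) : ℝ)| * |dd F σ x|) =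
     (∫⁻ x in {x | 0 < (inner ℝ u (cc x) : ℝ)},
      ENNReal.ofReal (|(inner ℝ u (cc x) : ℝ)| * |dd F σ x|)) +
      ∫⁻ x in {x | (inner ℝ u (cc x) : ℝ) < 0},
      ENNReal.ofReal (|(inner ℝ u (cc x) : ℝ)| * |dd F σ x|) := by
    intro σ
    have hs1 : MeasurableSet {x | 0 < (inner ℝ u (cc x) : ℝ)} := measurableSet_lt measurable_const hml
    have hs2 : MeasurableSet {x | (inner ℝ u (cc x) : ℝ) < 0} := measurableSet_lt hml measurable_const
    rw [← lintegral_union hs2 (by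
      rw [Set.disjoint_left]; intro x hx hx'
      rw [Set.mem_ofPred_eq] at hx hx'
      linarith)]
    rw [← lintegral_indicator (hs1.union hs2)]
    congr 1
    ext x
    by_cases hx : (inner ℝ u (cc x) : ℝ) = 0
    · simp [hx]
    · rw [indicator_of_mem]
      rcases lt_or_gt_of_ne hx with h | h
      · right; exact h
      · left; exact h
  have hmd : ∀ σ, Measurable fun x => ENNReal.ofReal (|(inner ℝ u (cc x) : ℝ)| * |dd F σ x|) := by
    intro σ
    have := measurable_dd F σ
    fun_prop
  have : ∀ x, ENNReal.ofReal (|(inner ℝ u (cc x) : ℝ)|) *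
      ENNReal.ofReal (|dd F 1 x| + |dd F (-1) x|) =
      ENNReal.ofReal (|(inner ℝ u (cc x) : ℝ)| * |dd F 1 x|) + ENNReal.ofReal (|(inner ℝ u (cc x) : ℝ)| * |dd F (-1) x|) := by
    intro x
    rw [← ENNReal.ofReal_mul (abs_nonneg _), mul_add, ENNReal.ofReal_add (by positivity) (by positivity)]
  simp_rw [this]
  rw [lintegral_add_left (hmd 1), hsplit 1, hsplit (-1), two_mul]
  nth_rw 1 [hA]
  rw [hB]
  ring

end Body

open MeasureTheory Set Filter Topology
open scoped NNReal ENNReal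

lemma abs_det_1d {ν : Measure ℝ} [IsFiniteMeasure ν] (hi : ∀ t : ℝ, Integrable (fun s => |s + t|) ν)
    (t : ℝ) : Tendsto (fun n : ℕ => ((n:ℝ) + 1) * ((∫ s, |s + (t + 1 / ((n:ℝ) + 1))| ∂ν) - ∫ s, |s + t| ∂ν))
      atTop (𝓝 (2 * ν.real (Ici (-t)) - ν.real univ)) := by
  have hlim : 2 * ν.real (Ici (-t)) - ν.real univ = ∫ s, (2 * (Ici (-t)).indicator (fun _ => (1:ℝ)) s - 1) ∂ν := by
    rw [integral_sub _ (integrable_const _), integral_const_mul, integral_indicator measurableSet_Ici]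
    · simp
    · exact (((integrable_const (1:ℝ)).indicator measurableSet_Ici).const_mul 2)
  rw [hlim]
  have e : ∀ n : ℕ, ((n:ℝ) + 1) * ((∫ s, |s + (t + 1 / ((n:ℝ) + 1))| ∂ν) - ∫ s, |s + t| ∂ν) =
      ∫ s, ((n:ℝ) + 1) * (|s + (t + 1 / ((n:ℝ) + 1))| - |s + t|) ∂ν := by
    intro n
    rw [integral_const_mul, integral_sub (hi _) (hi _)]
  simp_rw [e]
  refine tendsto_integral_of_dominated_convergence (fun _ => 1) ?_ (integrable_const _) ?_ ?_
  · intro n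
    exact (((hi _).sub (hi _)).const_mul _).aestronglyMeasurable
  · intro n
    refine Eventually.of_forall fun s => ?_
    have hn : (0:ℝ) < (n:ℝ) + 1 := by positivity
    rw [Real.norm_eq_abs, abs_mul, abs_of_pos hn]
    have := abs_abs_sub_abs_le_abs_sub (s + (t + 1 / ((n:ℝ) + 1))) (s + t)
    have h2 : |s + (t + 1 / ((n:ℝ) + 1)) - (s + t)| = 1 / ((n:ℝ) + 1) := by
      rw [show s + (t + 1 / ((n:ℝ) + 1)) - (s + t) = 1 / ((n:ℝ) + 1) by ring, abs_of_pos (by positivity)]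
    rw [h2] at this
    calc _ ≤ ((n:ℝ) + 1) * (1 / ((n:ℝ) + 1)) := mul_le_mul_of_nonneg_left this hn.le
      _ = 1 := by field_simp
  · refine Eventually.of_forall fun s => ?_
    by_cases hs : s ∈ Ici (-t)
    · rw [indicator_of_mem hs]
      rw [mem_Ici] at hs
      refine tendsto_const_nhds.congr fun n => ?_
      have hn : (0:ℝ) < 1 / ((n:ℝ) + 1) := by positivity
      rw [abs_of_nonneg (by linarith : 0 ≤ s + t), abs_of_nonneg (by linarith)]
      field_simp; ring
    · rw [indicator_of_notMem hs]
      rw [mem_Ici, not_le] at hs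
      refine tendsto_const_nhds.congr' ?_
      have ht : Tendsto (fun n : ℕ => 1 / ((n:ℝ) + 1)) atTop (𝓝 0) := tendsto_one_div_add_atTop_nhds_zero_nat
      filter_upwards [ht.eventually (gt_mem_nhds (show (0:ℝ) < - (s + t) by linarith))] with n hn
      rw [abs_of_neg (by linarith : s + t < 0), abs_of_neg (by linarith)]
      have : ((n:ℝ) + 1) ≠ 0 := by positivity
      field_simp; ring

lemma eq_1d {ν₁ ν₂ : Measure ℝ} [IsFiniteMeasure ν₁] [IsFiniteMeasure ν₂]
    (hu : ν₁ univ = ν₂ univ)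
    (hfin : ∀ t : ℝ, ∫⁻ s, ENNReal.ofReal |s + t| ∂ν₁ ≠ ∞)
    (he : ∀ t : ℝ, ∫⁻ s, ENNReal.ofReal |s + t| ∂ν₁ = ∫⁻ s, ENNReal.ofReal |s + t| ∂ν₂) : ν₁ = ν₂ := by
  have hint : ∀ (ν : Measure ℝ), (∀ t : ℝ, ∫⁻ s, ENNReal.ofReal |s + t| ∂ν ≠ ∞) → ∀ t : ℝ,
      Integrable (fun s => |s + t|) ν := by
    intro ν h t
    refine ⟨(Continuous.aestronglyMeasurable (by fun_prop)), ?_⟩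
    rw [hasFiniteIntegral_iff_ofReal (Eventually.of_forall fun s => abs_nonneg _)]
    exact lt_top_iff_ne_top.2 (h t)
  have i1 := hint ν₁ hfin
  have i2 := hint ν₂ (fun t => by rw [← he]; exact hfin t)
  have hI : ∀ t : ℝ, ∫ s, |s + t| ∂ν₁ = ∫ s, |s + t| ∂ν₂ := by
    intro t
    rw [integral_eq_lintegral_of_nonneg_ae (Eventually.of_forall fun s => abs_nonneg _) (i1 t).aestronglyMeasurable,
      integral_eq_lintegral_of_nonneg_ae (Eventually.of_forall fun s => abs_nonneg _) (i2 t).aestronglyMeasurable, he]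
  refine Measure.ext_of_Ici _ _ fun a => ?_
  have l1 := abs_det_1d i1 (-a)
  have l2 := abs_det_1d i2 (-a)
  simp_rw [hI] at l1
  have := tendsto_nhds_unique l1 l2
  rw [neg_neg] at this
  have h2 : ν₁.real univ = ν₂.real univ := by simp [Measure.real, hu]
  have h3 : ν₁.real (Ici a) = ν₂.real (Ici a) := by linarith
  exact (measureReal_eq_measureReal_iff).1 h3

lemma eq_2d {μ₁ μ₂ : Measure (ℝ × ℝ)} [IsFiniteMeasure μ₁] [IsFiniteMeasure μ₂]
    (hfin : ∀ u : E3, ∫⁻ x, ENNReal.ofReal |inner ℝ u (cc x)| ∂μ₁ ≠ ∞)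
    (he : ∀ u : E3, ∫⁻ x, ENNReal.ofReal |inner ℝ u (cc x)| ∂μ₁ = ∫⁻ x, ENNReal.ofReal |inner ℝ u (cc x)| ∂μ₂) :
    μ₁ = μ₂ := by
  refine Measure.ext_of_charFunDual ?_
  ext L
  rw [charFunDual_eq_charFun_map_one, charFunDual_eq_charFun_map_one]
  have hL : Measurable (L : ℝ × ℝ → ℝ) := L.continuous.measurable
  have key : ∀ (t : ℝ) (x : ℝ × ℝ), L x + t = inner ℝ (!₂[L (1,0), L (0,1), t] : E3) (cc x) := by
    intro t x
    rw [inner3]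
    simp
    have : x = x.1 • ((1:ℝ),(0:ℝ)) + x.2 • ((0:ℝ),(1:ℝ)) := by ext <;> simp
    conv_lhs => rw [this]
    rw [map_add, map_smul, map_smul]
    simp; ring
  have hm : ∀ (μ : Measure (ℝ × ℝ)) (t : ℝ), ∫⁻ s, ENNReal.ofReal |s + t| ∂(μ.map L) =
      ∫⁻ x, ENNReal.ofReal |inner ℝ (!₂[L (1,0), L (0,1), t] : E3) (cc x)| ∂μ := by
    intro μ t
    rw [lintegral_map (by fun_prop) hL]
    simp_rw [key]
  have : IsFiniteMeasure (μ₁.map L) := Measure.isFiniteMeasure_map _ _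
  have : IsFiniteMeasure (μ₂.map L) := Measure.isFiniteMeasure_map _ _
  rw [eq_1d (ν₁ := μ₁.map L) (ν₂ := μ₂.map L)]
  · rw [Measure.map_apply hL MeasurableSet.univ, Measure.map_apply hL MeasurableSet.univ]
    have := he (EuclideanSpace.single 2 1)
    simpa [inner3] using this
  · intro t; rw [hm]; exact hfin _
  · intro t; rw [hm, hm]; exact he _

lemma exists_rot_one (i : Fin 3) {u : E3} (hu : ‖u‖ = 1) :
    ∃ R : E3 ≃ₗᵢ[ℝ] E3, R.symm (EuclideanSpace.single i 1) = u := by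
  obtain ⟨b, hb⟩ := Orthonormal.exists_orthonormalBasis_extension_of_card_eq (𝕜 := ℝ) (E := E3) (ι := Fin 3)
    (by simp) (v := fun _ => u) (s := {i}) (by
      constructor
      · rintro ⟨j, hj⟩; simpa using hu
      · rintro ⟨j, hj⟩ ⟨k, hk⟩ h
        exact absurd (Subtype.ext (hj.trans hk.symm)) h)
  refine ⟨b.repr, ?_⟩
  rw [b.repr_symm_single]
  exact hb i rfl

lemma exists_rot_two {i j : Fin 3} (hij : i ≠ j) {u v : E3} (hu : ‖u‖ = 1) (hv : ‖v‖ = 1)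
    (huv : inner ℝ u v = (0:ℝ)) :
    ∃ R : E3 ≃ₗᵢ[ℝ] E3, R.symm (EuclideanSpace.single i 1) = u ∧ R.symm (EuclideanSpace.single j 1) = v := by
  obtain ⟨b, hb⟩ := Orthonormal.exists_orthonormalBasis_extension_of_card_eq (𝕜 := ℝ) (E := E3) (ι := Fin 3)
    (by simp) (v := fun k => if k = i then u else v) (s := {i, j}) (by
      constructor
      · rintro ⟨k, hk⟩
        change ‖if k = i then u else v‖ = 1
        split_ifs <;> assumption
      · rintro ⟨k, hk⟩ ⟨l, hl⟩ h
        change inner ℝ (if k = i then u else v) (if l = i then u else v) = (0:ℝ)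
        rcases hk with rfl | hk <;> rcases hl with rfl | hl
        · exact absurd rfl h
        · rw [mem_singleton_iff] at hl; subst hl; simp [hij.symm, huv]
        · rw [mem_singleton_iff] at hk; subst hk
          simp [hij.symm, real_inner_comm, huv]
        · exact absurd (Subtype.ext (hk.trans hl.symm)) h)
  refine ⟨b.repr, ?_, ?_⟩
  · rw [b.repr_symm_single, hb i (by simp)]; simp
  · rw [b.repr_symm_single, hb j (by simp)]; simp [hij.symm]

open MeasureTheory Set Filter Topology
open scoped NNReal ENNReal

noncomputable def F0 : E3 → E3 := fun v => ‖v‖⁻¹ • v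
noncomputable def ss (x : ℝ × ℝ) : ℝ × ℝ := TT (F0 (cc x))
noncomputable def NN (x : ℝ × ℝ) : ℝ := 1 + x.1 ^ 2 + x.2 ^ 2

lemma NN_pos (x) : 0 < NN x := by unfold NN; positivity

lemma cc_norm_eq (x) : ‖cc x‖ = Real.sqrt (NN x) := by
  rw [← Real.sqrt_sq (norm_nonneg (cc x)), norm3]
  congr 1
  simp [NN]; ring

lemma ss_eq (x) : ss x = (Real.sqrt (NN x))⁻¹ • x := by
  unfold ss F0
  rw [map_smul, cc_norm_eq, TT_apply]; simp

lemma ss_deriv (x) : ∃ A : ℝ × ℝ →L[ℝ] ℝ × ℝ, HasFDerivAt ss A x ∧ A.det = (NN x ^ 2)⁻¹ := by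
  have hN : HasFDerivAt NN ((2 * x.1) • ContinuousLinearMap.fst ℝ ℝ ℝ + (2 * x.2) • ContinuousLinearMap.snd ℝ ℝ ℝ) x := by
    have h1 := (hasFDerivAt_fst (𝕜 := ℝ) (p := x)).pow 2
    have h2 := (hasFDerivAt_snd (𝕜 := ℝ) (p := x)).pow 2
    have := (h1.const_add 1).add h2
    convert this using 1 <;> ext <;> simp [NN]
  have hpos := NN_pos x
  have hs : 0 < Real.sqrt (NN x) := Real.sqrt_pos.2 hpos
  have hq : HasDerivAt (fun z : ℝ => (Real.sqrt z)⁻¹) (-(1 / (2 * Real.sqrt (NN x))) / (Real.sqrt (NN x)) ^ 2) (NN x) :=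
    (Real.hasDerivAt_sqrt hpos.ne').inv hs.ne'
  have h3 := hq.comp_hasFDerivAt x hN
  have h4 := h3.smul (hasFDerivAt_id (𝕜 := ℝ) x)
  refine ⟨_, h4.congr_of_eventuallyEq (Eventually.of_forall fun y => ss_eq y), ?_⟩
  rw [det2]
  simp only [Function.comp_apply, _root_.add_apply, _root_.smul_apply, ContinuousLinearMap.smulRight_apply,
    ContinuousLinearMap.coe_id', id_eq, ContinuousLinearMap.coe_fst', ContinuousLinearMap.coe_snd', smul_eq_mul, Prod.fst_add, Prod.snd_add,
    Prod.smul_fst, Prod.smul_snd]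
  have hsq : Real.sqrt (NN x) ^ 2 = NN x := Real.sq_sqrt hpos.le
  set r := Real.sqrt (NN x) with hr
  have e : x.1 ^ 2 + x.2 ^ 2 = r ^ 2 - 1 := by rw [hsq]; unfold NN; ring
  rw [← hsq]
  field_simp
  have e2 : x.1 ^ 2 = r ^ 2 - 1 - x.2 ^ 2 := by linarith
  ring_nf
  rw [e2]
  ring

lemma ss_diff (x) : DifferentiableAt ℝ ss x := (ss_deriv x).choose_spec.1.differentiableAt
lemma ss_det (x) : (fderiv ℝ ss x).det = (NN x ^ 2)⁻¹ := by
  obtain ⟨A, h1, h2⟩ := ss_deriv x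
  rw [h1.fderiv, h2]

noncomputable def phi (F : E3 → E3) (w : ℝ) (x : ℝ × ℝ) : ℝ × ℝ := TT (F (cc x)) - (w / 2) • ss x

lemma det_nonneg_of {A : ℝ × ℝ →L[ℝ] ℝ × ℝ} (h : ∀ v, 0 ≤ v.1 * (A v).1 + v.2 * (A v).2) : 0 ≤ A.det := by
  rw [det2]
  set a := (A (1,0)).1
  set b := (A (0,1)).1
  set c := (A (1,0)).2
  set d := (A (0,1)).2
  have hA : ∀ v : ℝ × ℝ, A v = v.1 • A (1,0) + v.2 • A (0,1) := by
    intro v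
    rw [← map_smul, ← map_smul, ← map_add]; congr 1; ext <;> simp
  have hq : ∀ s t : ℝ, 0 ≤ a * s ^ 2 + (b + c) * s * t + d * t ^ 2 := by
    intro s t
    have := h (s, t)
    rw [hA] at this
    simp only [Prod.fst_add, Prod.snd_add, Prod.smul_fst, Prod.smul_snd, smul_eq_mul] at this
    nlinarith
  have ha : 0 ≤ a := by simpa using hq 1 0
  have hd : 0 ≤ d := by simpa using hq 0 1
  rcases ha.eq_or_lt with h0 | h0
  · have e1 := hq (d + 1) (-(b + c))
    have e2 := hq 1 0
    have : (b + c) ^ 2 ≤ 0 := by rw [← h0] at e1; nlinarith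
    rw [← h0]; nlinarith [sq_nonneg (b - c)]
  · have e1 := hq (b + c) (-2 * a)
    have : 0 ≤ 4 * a * d - (b + c) ^ 2 := by
      by_contra hc; push Not at hc
      nlinarith
    nlinarith [sq_nonneg (b - c)]

lemma det_nonneg_mono {f : ℝ × ℝ → ℝ × ℝ} {x : ℝ × ℝ} (hf : DifferentiableAt ℝ f x)
    (h : ∀ y, 0 ≤ (y.1 - x.1) * ((f y).1 - (f x).1) + (y.2 - x.2) * ((f y).2 - (f x).2)) :
    0 ≤ (fderiv ℝ f x).det := by
  apply det_nonneg_of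
  intro v
  have hl := (hf.hasFDerivAt.hasLineDerivAt v).tendsto_slope_zero_right
  have h1 : Tendsto (fun t : ℝ => v.1 * (t⁻¹ • (f (x + t • v) - f x)).1 + v.2 * (t⁻¹ • (f (x + t • v) - f x)).2)
      (𝓝[>] 0) (𝓝 (v.1 * (fderiv ℝ f x v).1 + v.2 * (fderiv ℝ f x v).2)) :=
    Tendsto.add (((continuous_fst.tendsto _).comp hl).const_mul _) (((continuous_snd.tendsto _).comp hl).const_mul _)
  refine ge_of_tendsto h1 ?_
  filter_upwards [self_mem_nhdsWithin] with t ht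
  rw [mem_Ioi] at ht
  have := h (x + t • v)
  simp only [Prod.fst_add, Prod.snd_add, Prod.smul_fst, Prod.smul_snd, smul_eq_mul, add_sub_cancel_left, Prod.fst_sub, Prod.snd_sub] at this ⊢
  have h2 : v.1 * (t⁻¹ * ((f (x + t • v)).1 - (f x).1)) + v.2 * (t⁻¹ * ((f (x + t • v)).2 - (f x).2))
    = t⁻¹ ^ 2 * (t * v.1 * ((f (x + t • v)).1 - (f x).1) + t * v.2 * ((f (x + t • v)).2 - (f x).2)) := by
    field_simp
  rw [h2]
  exact mul_nonneg (by positivity) this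

namespace Body
variable {K : Set E3} {w : ℝ} {F : E3 → E3}

lemma dd_nonneg (h : Body K w F) : ∀ᵐ x, 0 ≤ dd F 1 x ∧ 0 ≤ dd F (-1) x := by
  filter_upwards [(TT.lipschitz.comp (h.cc_lip (σ := 1) (by norm_num))).ae_differentiableAt,
    (TT.lipschitz.comp (h.cc_lip (σ := -1) (by norm_num))).ae_differentiableAt] with x h1 h2
  constructor
  · refine det_nonneg_mono h1 fun y => ?_
    have := h.mono ((1:ℝ) • cc y) ((1:ℝ) • cc x)
    rw [inner3] at this
    simpa [TT_apply] using this
  · have h3 : 0 ≤ (fderiv ℝ (fun x => -(TT (F ((-1:ℝ) • cc x)))) x).det := by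
      refine det_nonneg_mono (DifferentiableAt.neg h2) fun y => ?_
      have := h.mono ((-1:ℝ) • cc y) ((-1:ℝ) • cc x)
      rw [inner3] at this
      simp [TT_apply] at this ⊢
      linarith
    rw [fderiv_fun_neg] at h3
    unfold dd
    rw [det2] at h3 ⊢
    simpa using h3

lemma opp_cc (h : Body K w F) (x) : F (cc x) - F ((-1:ℝ) • cc x) = w • F0 (cc x) := by
  have h1 := h.opp (cc x)
  have hn : ‖cc x‖ ≠ 0 := by linarith [cc_norm x]
  unfold F0
  rw [smul_comm, ← h1, smul_smul, inv_mul_cancel₀ hn, one_smul, neg_one_smul]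

lemma sum_dd (h : Body K w F) : ∀ᵐ x, dd F 1 x + dd F (-1) x = 2 * (fderiv ℝ (phi F w) x).det +
    w ^ 2 / 2 * (NN x ^ 2)⁻¹ := by
  filter_upwards [(TT.lipschitz.comp (h.cc_lip (σ := 1) (by norm_num))).ae_differentiableAt] with x h1
  have e1 : (fun x => TT (F ((1:ℝ) • cc x))) = fun x => phi F w x + (w / 2) • ss x := by
    ext1 x; unfold phi; simp
  have e2 : (fun x => TT (F ((-1:ℝ) • cc x))) = fun x => phi F w x - (w / 2) • ss x := by
    ext1 x
    have := h.opp_cc x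
    have h3 : F ((-1:ℝ) • cc x) = F (cc x) - w • F0 (cc x) := by rw [← this]; abel
    rw [h3, map_sub, map_smul]
    unfold phi
    rw [show TT (F0 (cc x)) = ss x from rfl]
    module
  have hs : DifferentiableAt ℝ (fun x => (w / 2) • ss x) x :=
    DifferentiableAt.fun_const_smul (ss_diff x) _
  have hp : DifferentiableAt ℝ (phi F w) x := by
    have : phi F w = (fun x => TT (F ((1:ℝ) • cc x))) - fun x => (w / 2) • ss x := by
      ext1 x; rw [e1]; simp
    rw [this]; exact h1.sub hs
  unfold dd
  rw [e1, e2, fderiv_fun_add hp hs, fderiv_fun_sub hp hs, fderiv_fun_const_smul (ss_diff x), ← ss_det x, det2, det2, det2, det2]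
  simp
  ring

lemma ball_dd : ∀ᵐ x, dd F0 1 x + dd F0 (-1) x = 2 * (NN x ^ 2)⁻¹ := by
  have h := body_ball.sum_dd
  filter_upwards [h] with x hx
  have : phi (fun v => ‖v‖⁻¹ • v) 2 = fun _ => 0 := by
    ext1 x
    unfold phi
    rw [show (2:ℝ)/2 = 1 by norm_num, one_smul]
    exact sub_self _
  rw [this] at hx
  change dd F0 1 x + dd F0 (-1) x = _ at hx
  rw [hx, det2]
  simp
  left; norm_num

end Body

lemma ball_vol : ∃ b0 : ℝ, 0 < b0 ∧ ∀ R : E3 ≃ₗᵢ[ℝ] E3,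
    volume (TT '' (R '' Metric.closedBall (0:E3) 1)) = ENNReal.ofReal b0 := by
  have hc : IsCompact (TT '' Metric.closedBall (0:E3) 1) := (isCompact_closedBall _ _).image TT.continuous
  refine ⟨(volume (TT '' Metric.closedBall (0:E3) 1)).toReal, ?_, ?_⟩
  · apply ENNReal.toReal_pos _ hc.measure_lt_top.ne
    have : 0 < volume (Metric.ball (0:ℝ × ℝ) (1/2)) := Metric.measure_ball_pos _ _ (by norm_num)
    refine (this.trans_le (measure_mono ?_)).ne'
    intro x hx
    rw [mem_ball_zero_iff] at hx
    refine ⟨!₂[x.1, x.2, 0], ?_, by simp [TT_apply]⟩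
    rw [mem_closedBall_zero_iff]
    have h := norm3 (!₂[x.1, x.2, 0] : E3)
    simp at h
    have h1 : |x.1| ≤ ‖x‖ := norm_fst_le x
    have h2 : |x.2| ≤ ‖x‖ := norm_snd_le x
    have h3 : x.1 ^ 2 ≤ (1/2)^2 := by rw [← sq_abs]; gcongr; linarith
    have h4 : x.2 ^ 2 ≤ (1/2)^2 := by rw [← sq_abs]; gcongr; linarith
    nlinarith [norm_nonneg (!₂[x.1, x.2, 0] : E3)]
  · intro R
    rw [R.image_closedBall, map_zero, ENNReal.ofReal_toReal hc.measure_lt_top.ne]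

namespace Body
variable {K : Set E3} {w : ℝ} {F : E3 → E3}

lemma lint_unit (h : Body K w F) {b : ℝ} 
    (hb : ∀ R : E3 ≃ₗᵢ[ℝ] E3, volume (TT '' (R '' K)) = ENNReal.ofReal b) (u : E3) :
    ∫⁻ x, ENNReal.ofReal (|(inner ℝ u (cc x) : ℝ)|) *
      ENNReal.ofReal (|dd F 1 x| + |dd F (-1) x|) = ENNReal.ofReal (‖u‖) * (2 * ENNReal.ofReal b) := by
  by_cases hu : u = 0
  · simp [hu]
  have hn : 0 < ‖u‖ := norm_pos_iff.2 hu
  obtain ⟨R, hR⟩ := exists_rot_one 2 (u := ‖u‖⁻¹ • u) (by rw [norm_smul, norm_inv, norm_norm, inv_mul_cancel₀ hn.ne'])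
  have h1 := h.area2 (proj_of R)
  rw [hR, ContinuousLinearMap.coe_comp, image_comp] at h1
  have h2 := hb R
  change 2 * volume (TT '' (R '' K)) = _ at h1
  rw [h2] at h1
  rw [h1, ← lintegral_const_mul']
  · refine lintegral_congr fun x => ?_
    rw [← mul_assoc, ← ENNReal.ofReal_mul hn.le, inner_smul_left]
    congr 2
    simp only [conj_trivial]
    rw [abs_mul, abs_of_pos (inv_pos.2 hn), ← mul_assoc, mul_inv_cancel₀ hn.ne', one_mul]
  · simp

lemma det_phi (h : Body K w F) {b b0 : ℝ} (hb0 : 0 < b0) (hb' : 0 ≤ b)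
    (hball : ∀ R : E3 ≃ₗᵢ[ℝ] E3, volume (TT '' (R '' Metric.closedBall (0:E3) 1)) = ENNReal.ofReal b0)
    (hb : ∀ R : E3 ≃ₗᵢ[ℝ] E3, volume (TT '' (R '' K)) = ENNReal.ofReal b) :
    ∀ᵐ x, (fderiv ℝ (phi F w) x).det = (b / b0 - w ^ 2 / 4) * (NN x ^ 2)⁻¹ := by
  have hm : ∀ (F : E3 → E3) (c : ℝ), Measurable fun x => ENNReal.ofReal (c * (|dd F 1 x| + |dd F (-1) x|)) := by
    intro F c
    have := measurable_dd F 1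
    have := measurable_dd F (-1)
    fun_prop
  set μ₁ := (volume : Measure (ℝ × ℝ)).withDensity fun x => ENNReal.ofReal (b0 * (|dd F 1 x| + |dd F (-1) x|)) with hμ₁
  set μ₂ := (volume : Measure (ℝ × ℝ)).withDensity fun x => ENNReal.ofReal (b * (|dd F0 1 x| + |dd F0 (-1) x|)) with hμ₂
  have hcc := continuous_cc
  have key : ∀ {K : Set E3} {w : ℝ} {F : E3 → E3} {b c : ℝ}, Body K w F → 0 ≤ c →
      (∀ R : E3 ≃ₗᵢ[ℝ] E3, volume (TT '' (R '' K)) = ENNReal.ofReal b) → ∀ u : E3,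
      ∫⁻ x, ENNReal.ofReal |inner ℝ u (cc x)| ∂((volume : Measure (ℝ × ℝ)).withDensity fun x => ENNReal.ofReal (c * (|dd F 1 x| + |dd F (-1) x|))) =
      ENNReal.ofReal c * (ENNReal.ofReal (‖u‖) * (2 * ENNReal.ofReal b)) := by
    intro K w F b c h hc hb u
    rw [lintegral_withDensity_eq_lintegral_mul _ (hm F c) (by fun_prop), ← h.lint_unit hb u,
      ← lintegral_const_mul' _ _ (by simp)]
    refine lintegral_congr fun x => ?_
    rw [Pi.mul_apply, ENNReal.ofReal_mul hc]
    ring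
  have k1 := key h hb0.le hb
  have k2 := key body_ball hb' hball
  have huniv : ∀ μ : Measure (ℝ × ℝ), (∫⁻ x, ENNReal.ofReal |inner ℝ (EuclideanSpace.single 2 1 : E3) (cc x)| ∂μ) = μ univ := by
    intro μ; simp [inner3]
  have : IsFiniteMeasure μ₁ := ⟨by rw [← huniv, k1]; simp [ENNReal.mul_lt_top]⟩
  have : IsFiniteMeasure μ₂ := ⟨by rw [← huniv]; exact (k2 _).trans_lt (by simp [ENNReal.mul_lt_top])⟩
  have hE : μ₁ = μ₂ := by
    refine eq_2d ?_ ?_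
    · intro u; rw [k1]; simp [ENNReal.mul_eq_top]
    · intro u; rw [k1]; refine Eq.trans ?_ (k2 u).symm
      ring
  have hae := (withDensity_eq_iff (hm F b0).aemeasurable (hm F0 b).aemeasurable (by
    have : ∫⁻ x, ENNReal.ofReal (b0 * (|dd F 1 x| + |dd F (-1) x|)) = μ₁ univ := by
      rw [hμ₁, withDensity_apply _ MeasurableSet.univ, Measure.restrict_univ]
    rw [this]; exact measure_ne_top _ _)).1 hE
  filter_upwards [hae, h.dd_nonneg, body_ball.dd_nonneg, h.sum_dd, ball_dd] with x h1 h2 h3 h4 h5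
  change 0 ≤ dd F0 1 x ∧ 0 ≤ dd F0 (-1) x at h3
  rw [abs_of_nonneg h2.1, abs_of_nonneg h2.2, abs_of_nonneg h3.1, abs_of_nonneg h3.2, h4, h5] at h1
  have h6 := (ENNReal.ofReal_eq_ofReal_iff (by rw [← h4]; exact mul_nonneg hb0.le (add_nonneg h2.1 h2.2))
    (by rw [← h5]; exact mul_nonneg hb' (add_nonneg h3.1 h3.2))).1 h1
  have e : (b / b0 - w ^ 2 / 4) * (NN x ^ 2)⁻¹ = (b * (2 * (NN x ^ 2)⁻¹)) / (2 * b0) - w ^ 2 / 4 * (NN x ^ 2)⁻¹ := by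
    field_simp
  rw [e, ← h6]
  field_simp
  ring

end Body

open MeasureTheory Set Filter Topology
open scoped NNReal ENNReal

lemma fderiv_bd {C : ℝ≥0} {a : ℝ × ℝ → ℝ} (ha : LipschitzWith C a) (x : ℝ × ℝ) :
    |fderiv ℝ a x (1,0)| ≤ C ∧ |fderiv ℝ a x (0,1)| ≤ C := by
  have h := norm_fderiv_le_of_lipschitz ℝ ha (x₀ := x)
  have h1 := (fderiv ℝ a x).le_opNorm (1,0)
  have h2 := (fderiv ℝ a x).le_opNorm (0,1)
  rw [Real.norm_eq_abs] at h1 h2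
  simp at h1 h2
  exact ⟨h1.trans h, h2.trans h⟩

lemma no_max {CA CB : ℝ≥0} {a b : ℝ × ℝ → ℝ} (ha : LipschitzWith CA a) (hb : LipschitzWith CB b)
    {k : ℝ} (hk : 0 < k)
    (hdet : ∀ᵐ x, fderiv ℝ a x (1,0) * fderiv ℝ b x (0,1) - fderiv ℝ a x (0,1) * fderiv ℝ b x (1,0)
      = k * (NN x ^ 2)⁻¹) {x0 : ℝ × ℝ} (hmax : ∀ x, a x ≤ a x0) : False := by
  set Q : ℝ := 1 + (|x0.1| + 1) ^ 2 + (|x0.2| + 1) ^ 2 with hQ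
  have hQpos : 0 < Q := by positivity
  set δ : ℝ := k * (Q ^ 2)⁻¹ / (2 * (CB + 1)) with hδ
  have hCB : (0:ℝ) ≤ CB := CB.2
  have hδpos : 0 < δ := by positivity
  set c : ℝ := k * (Q ^ 2)⁻¹ - 2 * CB * δ with hc
  have hcpos : 0 < c := by
    have : k * (Q ^ 2)⁻¹ = 2 * (CB + 1) * δ := by rw [hδ]; field_simp
    rw [hc, this]; linarith
  set n : ℝ × ℝ → ℝ := fun x => ‖x - x0‖ with hn
  have hnl : LipschitzWith 1 n := by
    refine LipschitzWith.of_dist_le_mul fun x y => ?_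
    rw [Real.dist_eq, dist_eq_norm]
    have := abs_norm_sub_norm_le (x - x0) (y - x0)
    simpa [hn] using this
  set G : ℝ × ℝ → ℝ := fun x => a x - a x0 + δ * (1 - n x) with hG
  have hGl : LipschitzWith (CA + ‖δ‖₊) G := by
    have h1 : LipschitzWith (CA + ‖δ‖₊) (fun x => a x - δ * n x) := by
      have h0 : LipschitzWith (‖δ‖₊ * 1) (fun x => δ • n x) := (lipschitzWith_smul δ).comp hnl
      rw [mul_one] at h0
      exact ha.sub h0
    refine LipschitzWith.of_dist_le_mul fun x y => ?_
    refine le_trans (le_of_eq ?_) (h1.dist_le_mul x y)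
    rw [Real.dist_eq, Real.dist_eq]; congr 1; simp only [hG]; ring
  set A : ℝ × ℝ → ℝ := fun x => max (G x) 0 with hA
  have hAl : LipschitzWith (CA + ‖δ‖₊) A := hGl.max_const 0
  have hGle : ∀ x, 0 < G x → n x < 1 := by
    intro x hx
    have := hmax x
    by_contra h1
    push Not at h1
    simp only [hG] at hx
    nlinarith
  have hsupp : HasCompactSupport A := by
    refine HasCompactSupport.intro (isCompact_closedBall x0 1) fun x hx => ?_
    rw [Metric.mem_closedBall, not_le, dist_eq_norm] at hx
    by_contra h0
    have : 0 < G x := by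
      by_contra h1; push Not at h1
      exact h0 (max_eq_right h1)
    linarith [hGle x this]
  have hint := null_lagrangian hAl hb hsupp
  set I : ℝ × ℝ → ℝ := fun x => fderiv ℝ A x (1,0) * fderiv ℝ b x (0,1) - fderiv ℝ A x (0,1) * fderiv ℝ b x (1,0) with hI
  have hIm : Measurable I := by
    have := measurable_fderiv_apply_const ℝ A
    have := measurable_fderiv_apply_const ℝ b
    fun_prop
  have hI0 : ∀ x, G x ≤ 0 → I x = 0 := by
    intro x hx
    have hm : IsLocalMin A x := Eventually.of_forall fun y => by
      rw [show A x = 0 from max_eq_right hx]; exact le_max_right _ _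
    simp only [hI, hm.fderiv_eq_zero]; simp
  have hIp : ∀ᵐ x, 0 < G x → c ≤ I x := by
    filter_upwards [hdet, ha.ae_differentiableAt, hnl.ae_differentiableAt] with x hx hda hdn hGx
    have hAG : A =ᶠ[𝓝 x] G := by
      filter_upwards [hGl.continuous.continuousAt.eventually (lt_mem_nhds hGx)] with y hy
      exact max_eq_left hy.le
    have hD : HasFDerivAt G (fderiv ℝ a x - δ • fderiv ℝ n x) x := by
      have h1 := (hda.hasFDerivAt.sub_const (a x0)).add ((hdn.hasFDerivAt.const_sub 1).const_smul δ)
      have h2 : fderiv ℝ a x - δ • fderiv ℝ n x = fderiv ℝ a x + δ • -fderiv ℝ n x := by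
        rw [smul_neg, sub_eq_add_neg]
      rw [h2]
      exact h1
    simp only [hI, hAG.fderiv_eq, hD.fderiv]
    obtain ⟨n1, n2⟩ := fderiv_bd hnl x
    obtain ⟨b1, b2⟩ := fderiv_bd hb x
    have hN : k * (Q ^ 2)⁻¹ ≤ k * (NN x ^ 2)⁻¹ := by
      have hnx := hGle x hGx
      have h1 : |x.1 - x0.1| ≤ n x := norm_fst_le (x - x0)
      have h2 : |x.2 - x0.2| ≤ n x := norm_snd_le (x - x0)
      have h3 : |x.1| ≤ |x0.1| + 1 := by have := abs_sub_abs_le_abs_sub x.1 x0.1; linarith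
      have h4 : |x.2| ≤ |x0.2| + 1 := by have := abs_sub_abs_le_abs_sub x.2 x0.2; linarith
      have : NN x ≤ Q := by
        unfold NN; rw [← sq_abs x.1, ← sq_abs x.2, hQ]; gcongr
      have := NN_pos x
      gcongr
    simp only [_root_.sub_apply, _root_.smul_apply, smul_eq_mul]
    have p1 : |fderiv ℝ n x (1,0) * fderiv ℝ b x (0,1)| ≤ CB := by
      rw [abs_mul]
      calc _ ≤ 1 * (CB:ℝ) := mul_le_mul (by simpa using n1) b2 (abs_nonneg _) zero_le_one
        _ = _ := one_mul _
    have p2 : |fderiv ℝ n x (0,1) * fderiv ℝ b x (1,0)| ≤ CB := by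
      rw [abs_mul]
      calc _ ≤ 1 * (CB:ℝ) := mul_le_mul (by simpa using n2) b1 (abs_nonneg _) zero_le_one
        _ = _ := one_mul _
    have q1 := (abs_le.1 p1).2
    have q2 := (abs_le.1 p2).1
    have e : (fderiv ℝ a x (1, 0) - δ * fderiv ℝ n x (1, 0)) * fderiv ℝ b x (0, 1) -
      (fderiv ℝ a x (0, 1) - δ * fderiv ℝ n x (0, 1)) * fderiv ℝ b x (1, 0) =
      k * (NN x ^ 2)⁻¹ - δ * (fderiv ℝ n x (1,0) * fderiv ℝ b x (0,1) - fderiv ℝ n x (0,1) * fderiv ℝ b x (1,0)) := by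
      rw [← hx]; ring
    rw [e]
    have : δ * (fderiv ℝ n x (1,0) * fderiv ℝ b x (0,1) - fderiv ℝ n x (0,1) * fderiv ℝ b x (1,0)) ≤ δ * (2 * CB) :=
      mul_le_mul_of_nonneg_left (by linarith) hδpos.le
    rw [hc]; nlinarith
  have hInn : 0 ≤ᵐ[volume] I := by
    filter_upwards [hIp] with x hx
    rcases le_or_gt (G x) 0 with h | h
    · rw [hI0 x h]; rfl
    · exact hcpos.le.trans (hx h)
  have hIint : Integrable I := by
    have hbd : Integrable ((Metric.closedBall x0 1).indicator fun _ => 2 * ((CA + ‖δ‖₊ : ℝ≥0) : ℝ) * CB) :=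
      (integrable_indicator_iff Metric.isClosed_closedBall.measurableSet).2
        (integrableOn_const (isCompact_closedBall x0 1).measure_lt_top.ne)
    refine hbd.mono' hIm.aestronglyMeasurable (Eventually.of_forall fun x => ?_)
    rcases le_or_gt (G x) 0 with h | h
    · rw [hI0 x h, norm_zero]
      exact indicator_nonneg (fun _ _ => by positivity) _
    · rw [indicator_of_mem (by rw [Metric.mem_closedBall, dist_eq_norm]; exact (hGle x h).le), Real.norm_eq_abs]
      obtain ⟨a1, a2⟩ := fderiv_bd hAl x
      obtain ⟨b1, b2⟩ := fderiv_bd hb x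
      calc |I x| ≤ |fderiv ℝ A x (1,0) * fderiv ℝ b x (0,1)| + |fderiv ℝ A x (0,1) * fderiv ℝ b x (1,0)| := abs_sub _ _
        _ ≤ ((CA + ‖δ‖₊ : ℝ≥0) : ℝ) * CB + ((CA + ‖δ‖₊ : ℝ≥0) : ℝ) * CB := by
          rw [abs_mul, abs_mul]; gcongr
        _ = _ := by ring
  have hz := (integral_eq_zero_iff_of_nonneg_ae hInn hIint).1 hint
  have hopen : IsOpen {x | 0 < G x} := isOpen_lt continuous_const hGl.continuous
  have hne : ({x | 0 < G x}).Nonempty := ⟨x0, by simp [hG, hn, hδpos]⟩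
  have hpos := hopen.measure_pos volume hne
  refine hpos.ne' ?_
  refine measure_mono_null ?_ (ae_iff.1 (hIp.and hz))
  intro x hx
  simp only [Set.mem_ofPred_eq] at hx ⊢
  rintro ⟨h1, h2⟩
  have := h1 hx
  rw [h2] at this
  simp at this
  linarith

noncomputable def Fg (F : E3 → E3) (w : ℝ) (v : E3) : E3 := F v - (w / 2) • F0 v

namespace Body
variable {K : Set E3} {w : ℝ} {F : E3 → E3}

lemma phi_rot (R : E3 ≃ₗᵢ[ℝ] E3) (x) :
    phi (fun v => R (F (R.symm v))) w x = TT (R (Fg F w (R.symm (cc x)))) := by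
  unfold phi Fg ss F0
  simp

lemma F0_lip : ∀ x y, ‖TT (F0 (cc x)) - TT (F0 (cc y))‖ ≤ (‖TT‖₊ * Real.toNNReal (2 * 2) : ℝ≥0) * ‖x - y‖ := by
  intro x y
  have := (TT.lipschitz.comp (body_ball.cc_lip (σ := 1) (by norm_num))).dist_le_mul x y
  rw [dist_eq_norm, dist_eq_norm] at this
  simpa [F0] using this

lemma phi_lip (h : Body K w F) : ∃ C, LipschitzWith C (phi F w) := by
  have h1 := TT.lipschitz.comp (h.cc_lip (σ := 1) (by norm_num))
  have h2 : LipschitzWith (‖TT‖₊ * Real.toNNReal (2 * 2)) ss :=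
    LipschitzWith.of_dist_le_mul fun x y => by
      rw [dist_eq_norm, dist_eq_norm]; exact F0_lip x y
  have h3 : LipschitzWith (‖w/2‖₊ * (‖TT‖₊ * Real.toNNReal (2 * 2))) (fun x => (w/2) • ss x) :=
    (lipschitzWith_smul (w/2)).comp h2
  have h4 := h1.sub h3
  have e : phi F w = fun x => (TT ∘ fun x => F ((1:ℝ) • cc x)) x - (w/2) • ss x := by
    ext1 x; simp [phi]
  rw [e]; exact ⟨_, h4⟩

lemma Fg_even (h : Body K w F) {v : E3} (hv : v ≠ 0) : Fg F w (-v) = Fg F w v := by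
  have h1 := h.opp v
  have hn : ‖v‖ ≠ 0 := norm_ne_zero_iff.2 hv
  have h2 : F v - F (-v) = w • F0 v := by
    unfold F0
    rw [smul_comm, ← h1, smul_smul, inv_mul_cancel₀ hn, one_smul]
  have h3 : F (-v) = F v - w • F0 v := by rw [← h2]; abel
  have h4 : F0 (-v) = - F0 v := by simp [F0]
  unfold Fg
  rw [h3, h4]; module

lemma Fg_smul (h : Body K w F) {v : E3} (hv : v ≠ 0) {t : ℝ} (ht : 0 < t) :
    Fg F w (t • v) = Fg F w v := by
  unfold Fg
  rw [h.smul hv ht]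
  congr 2
  exact body_ball.smul hv ht

lemma Fg_smul' (h : Body K w F) {v : E3} (hv : v ≠ 0) {t : ℝ} (ht : t ≠ 0) :
    Fg F w (t • v) = Fg F w v := by
  rcases lt_or_gt_of_ne ht with h1 | h1
  · have : t • v = -((-t) • v) := by simp
    rw [this, h.Fg_even (smul_ne_zero (by simpa using ht) hv), h.Fg_smul hv (by linarith)]
  · exact h.Fg_smul hv h1

/-- Lipschitz away from the origin -/
lemma Fg_lip (h : Body K w F) {ρ : ℝ} (hρ : 0 < ρ) {v v' : E3} (hv : ρ ≤ ‖v‖) (hv' : ρ ≤ ‖v'‖) :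
    ‖Fg F w v - Fg F w v'‖ ≤ 2 * w / ρ * ‖v - v'‖ := by
  have h1 := h.lip hρ hv hv'
  have h2 := body_ball.lip hρ hv hv'
  change ‖F0 v - F0 v'‖ ≤ _ at h2
  have hw := h.w0
  calc ‖Fg F w v - Fg F w v'‖ = ‖(F v - F v') - (w/2) • (F0 v - F0 v')‖ := by
        unfold Fg; congr 1; module
    _ ≤ ‖F v - F v'‖ + ‖(w/2) • (F0 v - F0 v')‖ := norm_sub_le _ _
    _ ≤ w / ρ * ‖v - v'‖ + (w/2) * (2 / ρ * ‖v - v'‖) := by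
        rw [norm_smul, Real.norm_of_nonneg (by positivity)]; gcongr
    _ = _ := by ring

lemma decomp {e p : E3} (he : ‖e‖ = 1) (hp : ∀ t : ℝ, p ≠ t • e) :
    ∃ (α β : ℝ) (n : E3), 0 < β ∧ ‖n‖ = 1 ∧ inner ℝ e n = (0:ℝ) ∧ p = α • e + β • n := by
  set m := p - (inner ℝ e p : ℝ) • e with hm
  have hm0 : m ≠ 0 := fun h0 => hp _ (sub_eq_zero.1 h0)
  have hmn : 0 < ‖m‖ := norm_pos_iff.2 hm0
  refine ⟨inner ℝ e p, ‖m‖, ‖m‖⁻¹ • m, hmn, ?_, ?_, ?_⟩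
  · rw [norm_smul, norm_inv, norm_norm, inv_mul_cancel₀ hmn.ne']
  · rw [inner_smul_right, hm, inner_sub_right, inner_smul_right, real_inner_self_eq_norm_sq, he]; simp
  · rw [smul_smul, mul_inv_cancel₀ hmn.ne', one_smul, hm]; abel

lemma comp_fderiv {f : ℝ × ℝ → ℝ × ℝ} {x : ℝ × ℝ} (h : DifferentiableAt ℝ f x) (v : ℝ × ℝ) :
    fderiv ℝ (fun x => (f x).1) x v = (fderiv ℝ f x v).1 ∧ fderiv ℝ (fun x => (f x).2) x v = (fderiv ℝ f x v).2 := by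
  constructor
  · rw [(h.hasFDerivAt.fst).fderiv]; rfl
  · rw [(h.hasFDerivAt.snd).fderiv]; rfl

lemma no_ext (h : Body K w F) {k : ℝ} (hk : k ≠ 0)
    (hdet : ∀ᵐ x, (fderiv ℝ (phi F w) x).det = k * (NN x ^ 2)⁻¹) (x0 : ℝ × ℝ) :
    (∃ x, (phi F w x0).1 < (phi F w x).1) ∧ (∃ x, (phi F w x).1 < (phi F w x0).1) := by
  obtain ⟨C, hC⟩ := h.phi_lip
  have ha : LipschitzWith C (fun x => (phi F w x).1) := by
    have := LipschitzWith.prod_fst.comp hC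
    rwa [one_mul] at this
  have hb : LipschitzWith C (fun x => (phi F w x).2) := by
    have := LipschitzWith.prod_snd.comp hC
    rwa [one_mul] at this
  have hna : LipschitzWith C (fun x => -(phi F w x).1) := ha.neg
  have hnb : LipschitzWith C (fun x => -(phi F w x).2) := hb.neg
  have hd : ∀ᵐ x, fderiv ℝ (fun x => (phi F w x).1) x (1,0) * fderiv ℝ (fun x => (phi F w x).2) x (0,1)
      - fderiv ℝ (fun x => (phi F w x).1) x (0,1) * fderiv ℝ (fun x => (phi F w x).2) x (1,0) = k * (NN x ^ 2)⁻¹ := by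
    filter_upwards [hdet, hC.ae_differentiableAt] with x hx hdx
    rw [det2] at hx
    rw [← hx, (comp_fderiv hdx _).1, (comp_fderiv hdx _).1, (comp_fderiv hdx _).2, (comp_fderiv hdx _).2]
  constructor
  · by_contra hc
    push Not at hc
    rcases lt_or_gt_of_ne hk with h1 | h1
    · refine no_max ha hnb (k := -k) (by linarith) ?_ hc
      filter_upwards [hd] with x hx
      rw [fderiv_fun_neg]; simp only [_root_.neg_apply]; linarith
    · exact no_max ha hb h1 hd hc
  · by_contra hc
    push Not at hc
    rcases lt_or_gt_of_ne hk with h1 | h1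
    · refine no_max hna hb (k := -k) (by linarith) ?_ (x0 := x0) fun x => neg_le_neg (hc x)
      filter_upwards [hd] with x hx
      rw [fderiv_fun_neg]; simp only [_root_.neg_apply]; linarith
    · refine no_max hna hnb h1 ?_ (x0 := x0) fun x => neg_le_neg (hc x)
      filter_upwards [hd] with x hx
      rw [fderiv_fun_neg, fderiv_fun_neg]; simp only [_root_.neg_apply]; linarith

lemma const_of_ne (h : Body K w F) {k : ℝ} (hk : k ≠ 0)
    (hdet : ∀ R : E3 ≃ₗᵢ[ℝ] E3, ∀ᵐ x, (fderiv ℝ (phi (fun v => R (F (R.symm v))) w) x).det = k * (NN x ^ 2)⁻¹)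
    {e : E3} (he : ‖e‖ = 1) {v : E3} (hv : v ≠ 0) :
    (inner ℝ e (Fg F w v) : ℝ) = inner ℝ e (Fg F w e) := by
  have he0 : e ≠ 0 := norm_ne_zero_iff.1 (by rw [he]; norm_num)
  set g : E3 → ℝ := fun v => inner ℝ e (Fg F w v) with hg
  have notmult : ∀ p : E3, p ≠ 0 → g p ≠ g e → 
     (∃ q : E3, q ≠ 0 ∧ g p < g q) ∧ (∃ q : E3, q ≠ 0 ∧ g q < g p) := by
    intro p hp0 hpe
    obtain ⟨α, β, n, hβ, hn, hen, hp⟩ := decomp he (p := p) (by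
      rintro t rfl
      apply hpe
      have ht : t ≠ 0 := by rintro rfl; simp at hp0
      simp only [hg]; rw [h.Fg_smul' he0 ht])
    obtain ⟨R, hR0, hR2⟩ := exists_rot_two (i := 0) (j := 2) (by decide) he hn hen
    have hph : ∀ x, (phi (fun v => R (F (R.symm v))) w x).1 = g (R.symm (cc x)) := by
      intro x
      rw [phi_rot, TT_apply]
      simp only [hg]
      rw [← R.inner_map_map, ← hR0, R.apply_symm_apply, EuclideanSpace.inner_single_left]
      simp
    have hcn : ∀ x, R.symm (cc x) ≠ 0 := by
      intro x hx
      have h1 : cc x = 0 := by simpa using hx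
      have := cc_norm x
      rw [h1, norm_zero] at this; norm_num at this
    have hpp : g p = g (R.symm (cc (α / β, 0))) := by
      have : p = β • R.symm (cc (α / β, 0)) := by
        rw [hp, ← hR0, ← hR2, ← map_smul, ← map_smul, ← map_smul, ← map_add]
        congr 1
        apply ext3 <;> simp
        field_simp
      rw [this]
      simp only [hg]; rw [h.Fg_smul (hcn _) hβ]
    obtain ⟨⟨x, hx⟩, ⟨y, hy⟩⟩ := (h.rot R).no_ext hk (hdet R) (α / β, 0)
    rw [hph, hph, ← hpp] at hx hy
    exact ⟨⟨_, hcn x, hx⟩, ⟨_, hcn y, hy⟩⟩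
  -- extrema on the sphere
  have hS : IsCompact (Metric.sphere (0:E3) 1) := isCompact_sphere _ _
  have hSne : (Metric.sphere (0:E3) 1).Nonempty := ⟨e, by simpa using he⟩
  have hcont : ContinuousOn g (Metric.sphere (0:E3) 1) := by
    have : ContinuousOn (Fg F w) (Metric.sphere (0:E3) 1) := by
      refine LipschitzOnWith.continuousOn (K := Real.toNNReal (2 * w / 1)) (LipschitzOnWith.of_dist_le_mul fun x hx y hy => ?_)
      rw [mem_sphere_zero_iff_norm] at hx hy
      rw [dist_eq_norm, dist_eq_norm, Real.coe_toNNReal _ (by have := h.w0; positivity)]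
      exact h.Fg_lip one_pos hx.ge hy.ge
    simp only [hg]; fun_prop
  have hnorm : ∀ q : E3, q ≠ 0 → ∃ q' ∈ Metric.sphere (0:E3) 1, g q' = g q := by
    intro q hq
    have hqn : 0 < ‖q‖ := norm_pos_iff.2 hq
    refine ⟨‖q‖⁻¹ • q, ?_, ?_⟩
    · rw [mem_sphere_zero_iff_norm, norm_smul, norm_inv, norm_norm, inv_mul_cancel₀ hqn.ne']
    · simp only [hg]; rw [h.Fg_smul hq (inv_pos.2 hqn)]
  have hne0 : ∀ p ∈ Metric.sphere (0:E3) 1, p ≠ 0 := by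
    intro p hp h0; rw [mem_sphere_zero_iff_norm, h0, norm_zero] at hp; norm_num at hp
  obtain ⟨p, hpS, hpm⟩ := hS.exists_isMaxOn hSne hcont
  obtain ⟨q, hqS, hqm⟩ := hS.exists_isMinOn hSne hcont
  have h1 : g p = g e := by
    by_contra hc
    obtain ⟨⟨r, hr, hlt⟩, -⟩ := notmult p (hne0 p hpS) hc
    obtain ⟨r', hr', hrr⟩ := hnorm r hr
    have := hpm hr'
    simp only [Set.mem_ofPred_eq] at this
    linarith
  have h2 : g q = g e := by
    by_contra hc
    obtain ⟨-, ⟨r, hr, hlt⟩⟩ := notmult q (hne0 q hqS) hc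
    obtain ⟨r', hr', hrr⟩ := hnorm r hr
    have := hqm hr'
    simp only [Set.mem_ofPred_eq] at this
    linarith
  obtain ⟨v', hv', hvv⟩ := hnorm v hv
  have a1 := hpm hv'
  have a2 := hqm hv'
  simp only [Set.mem_ofPred_eq] at a1 a2
  change g v = g e
  linarith

end Body

open MeasureTheory Set Filter Topology
open scoped NNReal ENNReal

lemma lint_r {ρ : ℝ} (hρ : 0 ≤ ρ) : ∫⁻ r in Ioc 0 ρ, ENNReal.ofReal r = ENNReal.ofReal (ρ ^ 2 / 2) := by
  have h1 : IntegrableOn (fun r : ℝ => r) (Ioc 0 ρ) := by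
    have := (continuous_id (X := ℝ)).integrableOn_Icc (μ := volume) (a := 0) (b := ρ)
    exact this.mono_set Ioc_subset_Icc_self
  rw [← ofReal_integral_eq_lintegral_ofReal h1]
  · congr 1
    rw [← intervalIntegral.integral_of_le hρ, integral_id]; ring
  · refine (ae_restrict_iff' measurableSet_Ioc).2 (Eventually.of_forall fun r hr => hr.1.le)

noncomputable def gg (S : Set (ℝ × ℝ)) (θ : ℝ) : ℝ≥0∞ :=
  ∫⁻ r in Ioi (0:ℝ), ENNReal.ofReal r * S.indicator 1 (r * Real.cos θ, r * Real.sin θ)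

lemma gg_le {S : Set (ℝ × ℝ)} {θ ρ : ℝ} (hρ : 0 ≤ ρ)
    (h : ∀ r, 0 < r → (r * Real.cos θ, r * Real.sin θ) ∈ S → r ≤ ρ) :
    gg S θ ≤ ENNReal.ofReal (ρ ^ 2 / 2) := by
  rw [← lint_r hρ, gg, ← lintegral_indicator measurableSet_Ioi, ← lintegral_indicator measurableSet_Ioc]
  refine lintegral_mono fun r => ?_
  by_cases hr : 0 < r
  · rw [indicator_of_mem (show r ∈ Ioi (0:ℝ) from hr)]
    by_cases hm : (r * Real.cos θ, r * Real.sin θ) ∈ S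
    · rw [indicator_of_mem hm, indicator_of_mem (show r ∈ Ioc 0 ρ from ⟨hr, h r hr hm⟩)]; simp
    · rw [indicator_of_notMem hm]; simp
  · rw [indicator_of_notMem (show r ∉ Ioi (0:ℝ) from hr)]; simp

lemma gg_zero {S : Set (ℝ × ℝ)} {θ : ℝ}
    (h : ∀ r, 0 < r → (r * Real.cos θ, r * Real.sin θ) ∉ S) : gg S θ = 0 := by
  have := gg_le (S := S) (θ := θ) le_rfl fun r hr hm => absurd hm (h r hr)
  simpa using this

lemma gg_prod {S : Set (ℝ × ℝ)} (hS : MeasurableSet S) :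
    Measurable (fun p : ℝ × ℝ => ENNReal.ofReal p.1 * S.indicator (1 : ℝ × ℝ → ℝ≥0∞) (p.1 * Real.cos p.2, p.1 * Real.sin p.2)) := by
  have h1 : Measurable (S.indicator (1 : ℝ × ℝ → ℝ≥0∞)) := measurable_one.indicator hS
  have h2 : Measurable (fun p : ℝ × ℝ => (p.1 * Real.cos p.2, p.1 * Real.sin p.2)) := by fun_prop
  exact (ENNReal.measurable_ofReal.comp measurable_fst).mul (h1.comp h2)

lemma gg_meas {S : Set (ℝ × ℝ)} (hS : MeasurableSet S) : Measurable (gg S) :=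
  (gg_prod hS).lintegral_prod_left' (μ := volume.restrict (Ioi 0))

lemma vol_gg {S : Set (ℝ × ℝ)} (hS : MeasurableSet S) :
    volume S = ∫⁻ θ in Ioo (-Real.pi) Real.pi, gg S θ := by
  rw [← lintegral_indicator_one hS, ← lintegral_comp_polarCoord_symm]
  rw [polarCoord_target, Measure.volume_eq_prod, ← Measure.prod_restrict]
  simp only [polarCoord_symm_apply, smul_eq_mul]
  rw [lintegral_prod_symm' _ (gg_prod hS)]
  rfl

lemma vol_gg2 {S : Set (ℝ × ℝ)} (hS : MeasurableSet S) (hy : ∀ x ∈ S, 0 ≤ x.2) :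
    volume S = ∫⁻ θ in Ioo 0 (Real.pi / 2), (gg S θ + gg S (θ + Real.pi / 2)) := by
  have hpi := Real.pi_pos
  rw [vol_gg hS, lintegral_add_left (gg_meas hS)]
  have e1 : ∫⁻ θ in Ioo (-Real.pi) Real.pi, gg S θ = ∫⁻ θ in Ioo 0 Real.pi, gg S θ := by
    rw [← lintegral_indicator measurableSet_Ioo, ← lintegral_indicator measurableSet_Ioo]
    refine lintegral_congr_ae ?_
    have : ∀ᵐ θ : ℝ, θ ≠ 0 := by simp [ae_iff]
    filter_upwards [this] with θ hθ
    by_cases h1 : θ ∈ Ioo 0 Real.pi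
    · rw [indicator_of_mem h1, indicator_of_mem (show θ ∈ Ioo (-Real.pi) Real.pi from ⟨by linarith [h1.1], h1.2⟩)]
    · rw [indicator_of_notMem h1]
      by_cases h2 : θ ∈ Ioo (-Real.pi) Real.pi
      · rw [indicator_of_mem h2]
        have h3 : θ < 0 := by
          by_contra hc; push Not at hc
          exact h1 ⟨lt_of_le_of_ne hc hθ.symm, h2.2⟩
        refine gg_zero fun r hr hm => ?_
        have h4 := hy _ hm
        have h5 := Real.sin_neg_of_neg_of_neg_pi_lt h3 h2.1
        simp only at h4
        nlinarith
      · rw [indicator_of_notMem h2]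
  have e2 : Ioo 0 Real.pi =ᵐ[volume] (Ioo 0 (Real.pi/2) ∪ Ioo (Real.pi/2) Real.pi : Set ℝ) := by
    have : ∀ᵐ θ : ℝ, θ ≠ Real.pi / 2 := by simp [ae_iff]
    filter_upwards [this] with θ hθ
    apply propext
    change θ ∈ Ioo 0 Real.pi ↔ θ ∈ (Ioo 0 (Real.pi/2) ∪ Ioo (Real.pi/2) Real.pi : Set ℝ)
    simp only [mem_union, mem_Ioo]
    rcases lt_or_gt_of_ne hθ with h | h
    · constructor
      · intro h1; left; exact ⟨h1.1, h⟩
      · rintro (h1 | h1)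
        · exact ⟨h1.1, by linarith⟩
        · linarith [h1.1]
    · constructor
      · intro h1; right; exact ⟨h, h1.2⟩
      · rintro (h1 | h1)
        · linarith [h1.2]
        · exact ⟨by linarith, h1.2⟩
  rw [e1, setLIntegral_congr e2, lintegral_union measurableSet_Ioo]
  · congr 1
    rw [← lintegral_indicator measurableSet_Ioo, ← lintegral_indicator measurableSet_Ioo,
      ← lintegral_add_right_eq_self _ (Real.pi / 2)]
    congr 1
    ext1 θ
    by_cases h : θ ∈ Ioo 0 (Real.pi/2)
    · rw [indicator_of_mem h, indicator_of_mem (show θ + Real.pi / 2 ∈ Ioo (Real.pi/2) Real.pi from ⟨by linarith [h.1], by linarith [h.2]⟩)]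
    · rw [indicator_of_notMem h, indicator_of_notMem]
      intro h2
      exact h ⟨by linarith [h2.1], by linarith [h2.2]⟩
  · rw [Set.disjoint_left]
    intro θ h1 h2
    linarith [h1.2, h2.1]

/-- admissible pairs of radii -/
def RP (S : Set (ℝ × ℝ)) (w : ℝ) (θ r s : ℝ) : Prop :=
  0 ≤ r ∧ 0 ≤ s ∧ r ^ 2 + s ^ 2 = w ^ 2 ∧ (r * Real.cos θ, r * Real.sin θ) ∈ S ∧
    (s * Real.cos (θ + Real.pi / 2), s * Real.sin (θ + Real.pi / 2)) ∈ S

lemma RP_closed {S : Set (ℝ × ℝ)} {w : ℝ} (hS : IsCompact S) (hw : 0 ≤ w) {P : ℝ → ℝ → ℝ → Prop}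
    (hP : IsClosed {p : ℝ × ℝ × ℝ | P p.1 p.2.1 p.2.2}) :
    IsClosed {θ | θ ∈ Icc 0 (Real.pi / 2) ∧ ∃ r s, RP S w θ r s ∧ P θ r s} := by
  have hc : IsClosed {p : ℝ × ℝ × ℝ | RP S w p.1 p.2.1 p.2.2} := by
    unfold RP
    refine IsClosed.and ?_ (IsClosed.and ?_ (IsClosed.and ?_ (IsClosed.and ?_ ?_)))
    · exact isClosed_le (by fun_prop) (by fun_prop)
    · exact isClosed_le (by fun_prop) (by fun_prop)
    · exact isClosed_eq (by fun_prop) (by fun_prop)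
    · exact hS.isClosed.preimage (f := fun p : ℝ × ℝ × ℝ => (p.2.1 * Real.cos p.1, p.2.1 * Real.sin p.1)) (by fun_prop)
    · exact hS.isClosed.preimage (f := fun p : ℝ × ℝ × ℝ => (p.2.2 * Real.cos (p.1 + Real.pi / 2), p.2.2 * Real.sin (p.1 + Real.pi / 2))) (by fun_prop)
  have hk : IsCompact ((Icc 0 (Real.pi/2) ×ˢ (Icc 0 w ×ˢ Icc 0 w)) ∩ ({p : ℝ × ℝ × ℝ | RP S w p.1 p.2.1 p.2.2} ∩ {p : ℝ × ℝ × ℝ | P p.1 p.2.1 p.2.2})) :=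
    (isCompact_Icc.prod (isCompact_Icc.prod isCompact_Icc)).inter_right (hc.inter hP)
  have := (hk.image continuous_fst).isClosed
  convert this using 1
  ext θ
  constructor
  · rintro ⟨h1, r, s, h2, h3⟩
    refine ⟨(θ, r, s), ⟨⟨h1, ⟨h2.1, ?_⟩, ⟨h2.2.1, ?_⟩⟩, h2, h3⟩, rfl⟩
    · have := h2.2.2.1; show r ≤ w; nlinarith [h2.1]
    · have := h2.2.2.1; show s ≤ w; nlinarith [h2.2.1]
  · rintro ⟨⟨θ', r, s⟩, ⟨⟨h1, -⟩, h2, h3⟩, rfl⟩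
    exact ⟨h1, r, s, h2, h3⟩

lemma max_rad {S : Set (ℝ × ℝ)} (hS : IsCompact S) (h0 : (0,0) ∈ S) (θ : ℝ) :
    ∃ ρ, 0 ≤ ρ ∧ (ρ * Real.cos θ, ρ * Real.sin θ) ∈ S ∧
      ∀ r, 0 < r → (r * Real.cos θ, r * Real.sin θ) ∈ S → r ≤ ρ := by
  set f : ℝ × ℝ → ℝ := fun p => p.1 * Real.cos θ + p.2 * Real.sin θ with hf
  have hfr : ∀ r : ℝ, f (r * Real.cos θ, r * Real.sin θ) = r := by
    intro r; simp only [hf]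
    have := Real.sin_sq_add_cos_sq θ
    linear_combination r * this
  set A : Set ℝ := {r | 0 ≤ r ∧ (r * Real.cos θ, r * Real.sin θ) ∈ S}
  have hA : IsCompact A := by
    refine IsCompact.of_isClosed_subset (hS.image (f := f) (by fun_prop)) ?_ ?_
    · exact isClosed_Ici.inter (hS.isClosed.preimage (f := fun r : ℝ => (r * Real.cos θ, r * Real.sin θ)) (by fun_prop))
    · rintro r ⟨-, hr⟩; exact ⟨_, hr, hfr r⟩
  obtain ⟨ρ, ⟨h1, h2⟩, h3⟩ := hA.exists_isMaxOn ⟨0, le_rfl, by simpa using h0⟩ continuousOn_id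
  exact ⟨ρ, h1, h2, fun r hr hm => h3 (a := r) ⟨hr.le, hm⟩⟩

lemma planar {S : Set (ℝ × ℝ)} {w : ℝ} (hS : IsCompact S) (h0 : (0,0) ∈ S) (hy : ∀ x ∈ S, 0 ≤ x.2)
    (hd : ∀ x ∈ S, ∀ y ∈ S, (x.1 - y.1) ^ 2 + (x.2 - y.2) ^ 2 ≤ w ^ 2) (hw : 0 ≤ w)
    (hvol : volume S = ENNReal.ofReal (Real.pi * w ^ 2 / 4)) :
    ∀ θ ∈ Icc 0 (Real.pi / 2), ∃ r s, RP S w θ r s := by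
  have hpi := Real.pi_pos
  have hm := hS.measurableSet
  have key : ∀ θ, gg S θ + gg S (θ + Real.pi / 2) ≤ ENNReal.ofReal (w ^ 2 / 2) ∧
     (gg S θ + gg S (θ + Real.pi / 2) = ENNReal.ofReal (w ^ 2 / 2) → ∃ r s, RP S w θ r s) := by
    intro θ
    obtain ⟨r, r0, rm, rM⟩ := max_rad hS h0 θ
    obtain ⟨s, s0, sm, sM⟩ := max_rad hS h0 (θ + Real.pi / 2)
    have hb : gg S θ + gg S (θ + Real.pi / 2) ≤ ENNReal.ofReal ((r ^ 2 + s ^ 2) / 2) := by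
      rw [add_div, ENNReal.ofReal_add (by positivity) (by positivity)]
      exact add_le_add (gg_le r0 rM) (gg_le s0 sM)
    have hle : r ^ 2 + s ^ 2 ≤ w ^ 2 := by
      have := hd _ rm _ sm
      simp only [Real.cos_add_pi_div_two, Real.sin_add_pi_div_two] at this
      have h2 := Real.sin_sq_add_cos_sq θ
      nlinarith
    refine ⟨hb.trans (ENNReal.ofReal_le_ofReal (by linarith)), fun he => ?_⟩
    rw [he] at hb
    have := (ENNReal.ofReal_le_ofReal_iff (by positivity)).1 hb
    exact ⟨r, s, r0, s0, by linarith, rm, sm⟩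
  have hi := vol_gg2 hm hy
  have hae : (fun θ => gg S θ + gg S (θ + Real.pi / 2)) =ᵐ[volume.restrict (Ioo 0 (Real.pi / 2))] fun _ => ENNReal.ofReal (w ^ 2 / 2) := by
    refine ae_eq_of_ae_le_of_lintegral_le (Eventually.of_forall fun θ => (key θ).1) ?_ aemeasurable_const ?_
    · rw [← hi, hvol]; exact ENNReal.ofReal_ne_top
    · rw [← hi, hvol, setLIntegral_const, Real.volume_Ioo, ← ENNReal.ofReal_mul (by positivity)]
      apply ENNReal.ofReal_le_ofReal; apply le_of_eq; ring
  have hcl := RP_closed hS hw (P := fun _ _ _ => True) (by simp)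
  set T := {θ | θ ∈ Icc 0 (Real.pi / 2) ∧ ∃ r s, RP S w θ r s ∧ True} with hT
  have hsub : Ioo 0 (Real.pi/2) ⊆ T := by
    have ho : IsOpen (Ioo 0 (Real.pi/2) \ T) := isOpen_Ioo.sdiff hcl
    have hz : volume (Ioo 0 (Real.pi/2) \ T) = 0 := by
      have h1 := (ae_restrict_iff' measurableSet_Ioo).1 hae
      refine measure_mono_null ?_ (ae_iff.1 h1)
      rintro θ ⟨h2, h3⟩ hc
      obtain ⟨r, s, hrs⟩ := (key θ).2 (hc h2)
      exact h3 ⟨⟨h2.1.le, h2.2.le⟩, r, s, hrs, trivial⟩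
    exact sdiff_eq_empty.1 ((ho.measure_eq_zero_iff volume).1 hz)
  intro θ hθ
  have h1 : closure (Ioo 0 (Real.pi/2)) ⊆ T := closure_minimal hsub hcl
  rw [closure_Ioo (by positivity)] at h1
  obtain ⟨-, r, s, h2, -⟩ := h1 hθ
  exact ⟨r, s, h2⟩

open MeasureTheory Set Filter Topology
open scoped NNReal ENNReal

lemma planar2 {S : Set (ℝ × ℝ)} {w : ℝ} (hS : IsCompact S) (h0 : (0,0) ∈ S) (hy : ∀ x ∈ S, 0 ≤ x.2)
    (hu : ∀ x ∈ S, x.2 = 0 → x.1 = 0)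
    (hd : ∀ x ∈ S, ∀ y ∈ S, (x.1 - y.1) ^ 2 + (x.2 - y.2) ^ 2 ≤ w ^ 2) (hw : 0 ≤ w)
    (hvol : volume S = ENNReal.ofReal (Real.pi * w ^ 2 / 4)) (a b : ℝ) :
    ∃ x ∈ S, ∃ y ∈ S, x.1 * y.1 + x.2 * y.2 = 0 ∧ (y.1 - x.1) ^ 2 + (y.2 - x.2) ^ 2 = w ^ 2 ∧
      a * (y.1 - x.1) + b * (y.2 - x.2) = 0 := by
  have hpi := Real.pi_pos
  have hpl := planar hS h0 hy hd hw hvol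
  set L : ℝ → ℝ → ℝ → ℝ := fun θ r s => a * (s * Real.cos (θ + Real.pi / 2) - r * Real.cos θ)
    + b * (s * Real.sin (θ + Real.pi / 2) - r * Real.sin θ) with hL
  have hA := RP_closed hS hw (P := fun θ r s => 0 ≤ L θ r s) (isClosed_le (by fun_prop) (by fun_prop))
  have hB := RP_closed hS hw (P := fun θ r s => L θ r s ≤ 0) (isClosed_le (by fun_prop) (by fun_prop))
  have z1 : ∀ r s, RP S w 0 r s → L 0 r s = b * w := by
    rintro r s ⟨r0, s0, e, m1, m2⟩
    have : r = 0 := by simpa using hu _ m1 (by simp)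
    have e2 : s = w := by subst this; nlinarith
    simp [hL, this, e2]
  have z2 : ∀ r s, RP S w (Real.pi / 2) r s → L (Real.pi / 2) r s = - (b * w) := by
    rintro r s ⟨r0, s0, e, m1, m2⟩
    have : s = 0 := by simpa using hu _ m2 (by simp)
    have e2 : r = w := by subst this; nlinarith
    simp [hL, this, e2]
  have i0 : (0:ℝ) ∈ Icc 0 (Real.pi / 2) := ⟨le_rfl, by positivity⟩
  have i1 : (Real.pi / 2) ∈ Icc 0 (Real.pi / 2) := ⟨by positivity, le_rfl⟩
  obtain ⟨r1, s1, rs1⟩ := hpl 0 i0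
  obtain ⟨r2, s2, rs2⟩ := hpl _ i1
  have l1 := z1 _ _ rs1
  have l2 := z2 _ _ rs2
  have hne : (Icc 0 (Real.pi / 2) ∩ {θ | θ ∈ Icc 0 (Real.pi / 2) ∧ ∃ r s, RP S w θ r s ∧ 0 ≤ L θ r s}).Nonempty ∧
    (Icc 0 (Real.pi / 2) ∩ {θ | θ ∈ Icc 0 (Real.pi / 2) ∧ ∃ r s, RP S w θ r s ∧ L θ r s ≤ 0}).Nonempty := by
    rcases le_total 0 (b * w) with h | h
    · exact ⟨⟨0, i0, i0, r1, s1, rs1, by linarith⟩, ⟨_, i1, i1, r2, s2, rs2, by linarith⟩⟩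
    · exact ⟨⟨_, i1, i1, r2, s2, rs2, by linarith⟩, ⟨0, i0, i0, r1, s1, rs1, by linarith⟩⟩
  obtain ⟨θ, -, ⟨-, r, s, rs, hl⟩, ⟨-, r', s', rs', hl'⟩⟩ := isPreconnected_closed_iff.1 (isPreconnected_Icc (a := (0:ℝ)) (b := Real.pi / 2)) _ _ hA hB (by
    intro θ hθ
    obtain ⟨r, s, rs⟩ := hpl θ hθ
    rcases le_total 0 (L θ r s) with h | h
    · exact Or.inl ⟨hθ, r, s, rs, h⟩
    · exact Or.inr ⟨hθ, r, s, rs, h⟩) hne.1 hne.2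
  have hsc := Real.sin_sq_add_cos_sq θ
  obtain ⟨r0, s0, e, m1, m2⟩ := rs
  obtain ⟨r0', s0', e', m1', m2'⟩ := rs'
  have d1 := hd _ m1 _ m2'
  have d2 := hd _ m1' _ m2
  simp only [Real.cos_add_pi_div_two, Real.sin_add_pi_div_two] at d1 d2
  have d1' : r ^ 2 + s' ^ 2 ≤ w ^ 2 := le_trans (le_of_eq (by linear_combination (-(r ^ 2 + s' ^ 2)) * hsc)) d1
  have d2' : r' ^ 2 + s ^ 2 ≤ w ^ 2 := le_trans (le_of_eq (by linear_combination (-(r' ^ 2 + s ^ 2)) * hsc)) d2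
  have er : r' = r := by
    have : r' ^ 2 = r ^ 2 := by linarith
    exact (sq_eq_sq₀ r0' r0).1 this
  have es : s' = s := by
    have : s' ^ 2 = s ^ 2 := by linarith
    exact (sq_eq_sq₀ s0' s0).1 this
  subst er es
  have hL0 := le_antisymm hl' hl
  refine ⟨_, m1, _, m2, ?_, ?_, hL0⟩
  · simp only [Real.cos_add_pi_div_two, Real.sin_add_pi_div_two]; ring
  · simp only [Real.cos_add_pi_div_two, Real.sin_add_pi_div_two]
    rw [← e]; linear_combination (r' ^ 2 + s' ^ 2) * hsc

namespace Body
variable {K : Set E3} {w : ℝ} {F : E3 → E3}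

lemma diam (h : Body K w F) {z z' : E3} (hz : z ∈ K) (hz' : z' ∈ K) : ‖z - z'‖ ≤ w := by
  set u := z - z' with hu
  have h1 := h.max u z hz
  have h2 := h.max (-u) z' hz'
  rw [inner_neg_left, inner_neg_left] at h2
  have h3 : ‖u‖ * inner ℝ u (F u - F (-u)) = w * ‖u‖ ^ 2 := by
    rw [← inner_smul_right, h.opp, inner_smul_right, real_inner_self_eq_norm_sq]
  have h4 : ‖u‖ ^ 2 ≤ inner ℝ u (F u - F (-u)) := by
    rw [← real_inner_self_eq_norm_sq]; nth_rewrite 2 [hu]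
    rw [inner_sub_right, inner_sub_right]; linarith
  rcases (norm_nonneg u).eq_or_lt with h0 | h0
  · rw [← h0]; exact h.w0
  · by_contra hc; push Not at hc
    have : ‖u‖ * ‖u‖ ^ 2 ≤ w * ‖u‖ ^ 2 := by rw [← h3]; gcongr
    have h5 : 0 < ‖u‖ ^ 2 := by positivity
    nlinarith

lemma antip (h : Body K w F) {v z z' : E3} (hv : ‖v‖ = 1) (hz : z ∈ K) (hz' : z' ∈ K)
    (he : inner ℝ v (z' - z) = w) : z' = F v ∧ z = F (-v) := by
  have hv0 : v ≠ 0 := norm_ne_zero_iff.1 (by rw [hv]; norm_num)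
  have ho := h.opp v
  rw [hv, one_smul] at ho
  have h3 : (inner ℝ v (F v - F (-v)) : ℝ) = w := by
    rw [ho, inner_smul_right, real_inner_self_eq_norm_sq, hv]; ring
  have h1 := h.max v z' hz'
  have h2 := h.max (-v) z hz
  rw [inner_neg_left, inner_neg_left] at h2
  rw [inner_sub_right] at h3 he
  constructor
  · exact h.uniq hv0 hz' (by linarith)
  · exact h.uniq (neg_ne_zero.2 hv0) hz (by rw [inner_neg_left, inner_neg_left]; linarith)

lemma planar_body (h : Body K w F) (hvol : volume (TT '' K) = ENNReal.ofReal (Real.pi * w ^ 2 / 4))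
    {v : E3} (hv : ‖v‖ = 1) (hv2 : v 2 = 0) {p : E3} (hp : p = F (-EuclideanSpace.single 1 1)) :
    ((F v) 0 + (F (-v)) 0 - 2 * p 0) ^ 2 + ((F v) 1 + (F (-v)) 1 - 2 * p 1) ^ 2 = w ^ 2 := by
  have hn : (-EuclideanSpace.single 1 1 : E3) ≠ 0 := by
    intro h0; have := congrArg (fun z : E3 => z 1) h0; simp at this
  have hpK : p ∈ K := hp ▸ h.mem _
  have hin : ∀ z : E3, (inner ℝ (-EuclideanSpace.single 1 1 : E3) z : ℝ) = - z 1 := by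
    intro z; rw [inner3]; simp
  set S : Set (ℝ × ℝ) := (fun x => (-TT p) + x) '' (TT '' K) with hSdef
  have hS : IsCompact S := (h.comp.image TT.continuous).image (by fun_prop)
  have hSv : volume S = ENNReal.ofReal (Real.pi * w ^ 2 / 4) := by
    rw [hSdef, ← hvol, image_add_left, measure_preimage_add]
  have hcoord : ∀ x ∈ S, ∃ z ∈ K, x = (z 0 - p 0, z 1 - p 1) := by
    rintro _ ⟨_, ⟨z, hz, rfl⟩, rfl⟩
    refine ⟨z, hz, ?_⟩
    simp only [TT_apply]; ext <;> simp <;> ring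
  obtain ⟨x, hx, y, hyy, o, l, d⟩ := planar2 (w := w) hS ⟨_, ⟨p, hpK, rfl⟩, by simp; rfl⟩ (by
      intro x hx
      obtain ⟨z, hz, rfl⟩ := hcoord x hx
      have := h.max (-EuclideanSpace.single 1 1) z hz
      rw [hin, hin, ← hp] at this
      simp only; linarith) (by
      intro x hx h0
      obtain ⟨z, hz, rfl⟩ := hcoord x hx
      simp only at h0 ⊢
      have : z = p := by
        rw [hp]
        refine h.uniq hn hz ?_
        rw [hin, hin, ← hp]; linarith
      rw [this]; ring) (by
      intro x hx y hy
      obtain ⟨z, hz, rfl⟩ := hcoord x hx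
      obtain ⟨z', hz', rfl⟩ := hcoord y hy
      have h1 := h.diam hz hz'
      have h2 : ‖z - z'‖ ^ 2 ≤ w ^ 2 := by gcongr
      rw [norm3] at h2
      simp at h2 ⊢
      nlinarith [sq_nonneg (z 2 - z' 2)]) h.w0 hSv (-(v 1)) (v 0)
  obtain ⟨z, hz, rfl⟩ := hcoord x hx
  obtain ⟨z', hz', rfl⟩ := hcoord y hyy
  simp only at o l d
  have hvn := norm3 v
  rw [hv, hv2] at hvn
  have hin2 : ∀ z : E3, (inner ℝ v z : ℝ) = v 0 * z 0 + v 1 * z 1 := by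
    intro z; rw [inner3, hv2]; ring
  have hc : (inner ℝ v (z' - z) : ℝ) ^ 2 = w ^ 2 := by
    rw [hin2, ← l]
    simp only [PiLp.sub_apply]
    have : (v 0 * (z' 0 - z 0) + v 1 * (z' 1 - z 1)) ^ 2 + (-(v 1) * (z' 0 - p 0 - (z 0 - p 0)) + v 0 * (z' 1 - p 1 - (z 1 - p 1))) ^ 2
      = (v 0 ^ 2 + v 1 ^ 2) * ((z' 0 - z 0) ^ 2 + (z' 1 - z 1) ^ 2) := by ring
    rw [d] at this
    have h2 : v 0 ^ 2 + v 1 ^ 2 = 1 := by linarith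
    rw [h2] at this
    linarith
  have fin : (z' 0 + z 0 - 2 * p 0) ^ 2 + (z' 1 + z 1 - 2 * p 1) ^ 2 = w ^ 2 := by
    rw [← l]; linear_combination 4 * o
  rcases sq_eq_sq_iff_eq_or_eq_neg.1 hc with h1 | h1
  · obtain ⟨e1, e2⟩ := h.antip hv hz hz' h1
    rw [← e1, ← e2]; exact fin
  · obtain ⟨e1, e2⟩ := h.antip hv hz' hz (by rw [← neg_sub, inner_neg_right, h1]; ring)
    rw [← e1, ← e2]; linarith

lemma const_of_zero (h : Body K w F)
    (hvol : ∀ R : E3 ≃ₗᵢ[ℝ] E3, volume (TT '' (R '' K)) = ENNReal.ofReal (Real.pi * w ^ 2 / 4))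
    {e : E3} (he : ‖e‖ = 1) {v : E3} (hv : v ≠ 0) :
    (inner ℝ e (Fg F w v) : ℝ) = inner ℝ e (Fg F w e) := by
  have he0 : e ≠ 0 := norm_ne_zero_iff.1 (by rw [he]; norm_num)
  by_cases hp : ∃ t : ℝ, v = t • e
  · obtain ⟨t, rfl⟩ := hp
    rw [h.Fg_smul' he0 (by rintro rfl; simp at hv)]
  push Not at hp
  obtain ⟨α, β, n, hβ, hn, hen, hve⟩ := decomp he hp
  have hvn : 0 < ‖v‖ := norm_pos_iff.2 hv
  have key : ∀ e' : E3, ‖e'‖ = 1 → inner ℝ e' n = (0:ℝ) → ∀ u : E3, ‖u‖ = 1 → (∃ a b : ℝ, u = a • e' + b • n) →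
      (w * inner ℝ e' (Fg F w u - Fg F w e') + inner ℝ n (Fg F w u - Fg F w e') ^ 2 + inner ℝ e' (Fg F w u - Fg F w e') ^ 2 : ℝ) = 0 := by
    rintro e' he' hen' u hu ⟨a, b, hab⟩
    have he0' : e' ≠ 0 := norm_ne_zero_iff.1 (by rw [he']; norm_num)
    have hu0 : u ≠ 0 := norm_ne_zero_iff.1 (by rw [hu]; norm_num)
    obtain ⟨R, hR1, hR0⟩ := exists_rot_two (i := 1) (j := 0) (by decide) he' hn hen'
    have hc0 : ∀ z : E3, (R z) 0 = inner ℝ n z := by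
      intro z
      rw [← R.inner_map_map, ← hR0, R.apply_symm_apply, EuclideanSpace.inner_single_left]; simp
    have hc1 : ∀ z : E3, (R z) 1 = inner ℝ e' z := by
      intro z
      rw [← R.inner_map_map, ← hR1, R.apply_symm_apply, EuclideanSpace.inner_single_left]; simp
    have h1 := (h.rot R).planar_body (hvol R) (v := R u) (by rw [R.norm_map, hu]) (by
      rw [hab, ← hR0, ← hR1, ← map_smul, ← map_smul, ← map_add, R.apply_symm_apply]; simp) rfl
    simp only [map_neg, hR1, R.symm_apply_apply, hc0, hc1] at h1
    have hF : ∀ u : E3, ‖u‖ = 1 → F u = Fg F w u + (w/2) • u ∧ F (-u) = Fg F w u - (w/2) • u := by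
      intro u hu
      have hu0 : u ≠ 0 := norm_ne_zero_iff.1 (by rw [hu]; norm_num)
      have h2 : F (-u) = Fg F w (-u) + (w/2) • (-u) := by
        unfold Fg F0; rw [norm_neg, hu]; simp
      constructor
      · unfold Fg F0; rw [hu]; simp
      · rw [h2, h.Fg_even hu0]; module
    rw [(hF u hu).1, (hF u hu).2, (hF e' he').2] at h1
    simp only [inner_add_right, inner_sub_right, inner_smul_right, real_inner_self_eq_norm_sq, he', real_inner_comm e' n, hen'] at h1 ⊢
    simp only [real_inner_comm] at h1 hen' ⊢
    try rw [hen'] at h1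
    nlinarith
  set u := ‖v‖⁻¹ • v with hu
  have hun : ‖u‖ = 1 := by rw [hu, norm_smul, norm_inv, norm_norm, inv_mul_cancel₀ hvn.ne']
  have hFu : Fg F w u = Fg F w v := h.Fg_smul hv (inv_pos.2 hvn)
  have k1 := key e he hen u hun ⟨‖v‖⁻¹ * α, ‖v‖⁻¹ * β, by rw [hu]; nth_rewrite 2 [hve]; module⟩
  have k2 := key (-e) (by rw [norm_neg, he]) (by rw [inner_neg_left, hen, neg_zero]) u hun ⟨-(‖v‖⁻¹ * α), ‖v‖⁻¹ * β, by rw [hu]; nth_rewrite 2 [hve]; module⟩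
  rw [h.Fg_even he0, inner_neg_left] at k2
  rw [hFu] at k1 k2
  have h3 : (inner ℝ e (Fg F w v - Fg F w e) : ℝ) ^ 2 ≤ 0 := by
    nlinarith [sq_nonneg (inner ℝ n (Fg F w v - Fg F w e) : ℝ)]
  have h4 : (inner ℝ e (Fg F w v - Fg F w e) : ℝ) = 0 := pow_eq_zero_iff two_ne_zero |>.1 (le_antisymm h3 (sq_nonneg _))
  rw [inner_sub_right] at h4
  linarith

end Body

open MeasureTheory Set Filter Topology
open scoped NNReal ENNReal

lemma disc_area_pi : volume (TT '' ((LinearIsometryEquiv.refl ℝ E3) '' Metric.closedBall (0:E3) 1)) = ENNReal.ofReal Real.pi := by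
  have e : TT '' ((LinearIsometryEquiv.refl ℝ E3) '' Metric.closedBall (0:E3) 1) = {x : ℝ × ℝ | x.1 ^ 2 + x.2 ^ 2 ≤ 1} := by
    ext x
    constructor
    · rintro ⟨_, ⟨z, hz, rfl⟩, rfl⟩
      rw [mem_closedBall_zero_iff] at hz
      have h1 : ‖z‖ ^ 2 ≤ 1 := by
        have := norm_nonneg z; nlinarith
      rw [norm3] at h1
      simp [TT_apply]
      nlinarith [sq_nonneg (z 2)]
    · intro hx
      simp only [Set.mem_ofPred_eq] at hx
      refine ⟨!₂[x.1, x.2, 0], ⟨!₂[x.1, x.2, 0], ?_, rfl⟩, rfl⟩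
      rw [mem_closedBall_zero_iff]
      have h1 := norm3 (!₂[x.1, x.2, 0])
      simp at h1
      have := norm_nonneg (!₂[x.1, x.2, 0] : E3)
      nlinarith
  rw [e, ← Complex.volume_preserving_equiv_real_prod.measure_preimage_equiv]
  have e2 : Complex.measurableEquivRealProd ⁻¹' {x : ℝ × ℝ | x.1 ^ 2 + x.2 ^ 2 ≤ 1} = Metric.closedBall (0:ℂ) 1 := by
    ext z
    rw [mem_closedBall_zero_iff, mem_preimage]
    have h1 : ‖z‖ ^ 2 = z.re ^ 2 + z.im ^ 2 := by rw [Complex.sq_norm, Complex.normSq_apply]; ring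
    have h2 := norm_nonneg z
    simp only [Complex.measurableEquivRealProd_apply, Set.mem_ofPred_eq]
    rw [← h1]
    constructor
    · intro h; nlinarith
    · intro h; nlinarith
  rw [e2, Complex.volume_closedBall]
  simp
  rw [← NNReal.coe_real_pi, ENNReal.ofReal_coe_nnreal]

lemma final_const {K : Set E3} {w : ℝ} {F : E3 → E3} (h : Body K w F)
    {β : ℝ≥0∞} (hβ : ∀ R : E3 ≃ₗᵢ[ℝ] E3, volume (TT '' (R '' K)) = β)
    {e : E3} (he : ‖e‖ = 1) {v : E3} (hv : v ≠ 0) :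
    (inner ℝ e (Fg F w v) : ℝ) = inner ℝ e (Fg F w e) := by
  obtain ⟨b0, hb0, hball⟩ := ball_vol
  have hpi : b0 = Real.pi := by
    have := (hball (LinearIsometryEquiv.refl ℝ E3)).symm.trans disc_area_pi
    exact (ENNReal.ofReal_eq_ofReal_iff hb0.le Real.pi_pos.le).1 this
  have hfin : β ≠ ⊤ := by
    rw [← hβ (LinearIsometryEquiv.refl ℝ E3)]
    exact ((h.comp.image (LinearIsometryEquiv.refl ℝ E3).continuous).image TT.continuous).measure_lt_top.ne
  set b := β.toReal with hb
  have hbβ : β = ENNReal.ofReal b := (ENNReal.ofReal_toReal hfin).symm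
  have hb' : 0 ≤ b := ENNReal.toReal_nonneg
  by_cases hk : b / b0 - w ^ 2 / 4 = 0
  · refine h.const_of_zero (fun R => ?_) he hv
    rw [hβ, hbβ]; congr 1
    rw [← hpi]
    field_simp at hk
    linarith
  · refine h.const_of_ne hk (fun R => ?_) he hv
    refine (h.rot R).det_phi hb0 hb' hball fun R' => ?_
    rw [← hbβ, ← hβ (R.trans R'), image_image R' R]
    rfl

lemma final_ball {K : Set E3} {w : ℝ} {F : E3 → E3} (h : Body K w F)
    (hc : ∀ e : E3, ‖e‖ = 1 → ∀ v : E3, v ≠ 0 → (inner ℝ e (Fg F w v) : ℝ) = inner ℝ e (Fg F w e)) :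
    ∃ (c : E3) (r : ℝ), K = Metric.closedBall c r := by
  have hs : ∀ i : Fin 3, ‖(EuclideanSpace.single i 1 : E3)‖ = 1 := fun i => by simp
  set u0 : E3 := EuclideanSpace.single 0 1 with hu0
  have hu00 : u0 ≠ 0 := norm_ne_zero_iff.1 (by rw [hs]; norm_num)
  set c := Fg F w u0 with hcdef
  have hF : ∀ v : E3, v ≠ 0 → Fg F w v = c := by
    intro v hv
    ext i
    have h1 := hc _ (hs i) v hv
    have h2 := hc _ (hs i) u0 hu00
    rw [← h2, EuclideanSpace.inner_single_left, EuclideanSpace.inner_single_left] at h1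
    simpa using h1
  have hFv : ∀ v : E3, v ≠ 0 → (inner ℝ v (F v) : ℝ) = inner ℝ v c + (w/2) * ‖v‖ := by
    intro v hv
    have hn : ‖v‖ ≠ 0 := norm_ne_zero_iff.2 hv
    rw [← hF v hv]
    unfold Fg F0
    rw [inner_sub_right, inner_smul_right, inner_smul_right, real_inner_self_eq_norm_sq]
    field_simp; ring
  have hw := h.w0
  refine ⟨c, w / 2, Set.Subset.antisymm ?_ ?_⟩
  · intro z hz
    rw [mem_closedBall_iff_norm]
    by_cases h0 : z - c = 0
    · rw [h0, norm_zero]; positivity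
    have h1 := h.max (z - c) z hz
    rw [hFv _ h0] at h1
    have h2 : ‖z - c‖ ^ 2 ≤ (w / 2) * ‖z - c‖ := by
      rw [← real_inner_self_eq_norm_sq, inner_sub_right]; linarith
    have h3 : 0 < ‖z - c‖ := norm_pos_iff.2 h0
    nlinarith
  · intro z hz
    rw [mem_closedBall_iff_norm] at hz
    by_contra hzK
    obtain ⟨f, u, h1, h2⟩ := geometric_hahn_banach_closed_point h.conv h.comp.isClosed hzK
    set v := (InnerProductSpace.toDual ℝ E3).symm f with hvdef
    have hfv : ∀ y, f y = inner ℝ v y := by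
      intro y; rw [hvdef, InnerProductSpace.toDual_symm_apply]
    have hv : v ≠ 0 := by
      intro h0
      have h3 := h1 (F 0) (h.mem 0)
      rw [hfv, h0, inner_zero_left] at h3
      rw [hfv, h0, inner_zero_left] at h2
      linarith
    have h3 := h1 (F v) (h.mem v)
    rw [hfv, hFv v hv] at h3
    rw [hfv] at h2
    have h4 := real_inner_le_norm v (z - c)
    rw [inner_sub_right] at h4
    have h5 : ‖v‖ * ‖z - c‖ ≤ ‖v‖ * (w / 2) := by gcongr
    linarith


theorem constant_width_and_brightness_is_ball
    (K : Set (EuclideanSpace ℝ (Fin 3)))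
    (hKcomp : IsCompact K) (hKconv : Convex ℝ K) (hKint : (interior K).Nonempty)
    (hwidth : ∃ d : ℝ, ∀ u : EuclideanSpace ℝ (Fin 3), ‖u‖ = 1 →
      suppFn K u + suppFn K (-u) = d)
    (hbright : ∃ b : ENNReal, ∀ u : EuclideanSpace ℝ (Fin 3), ‖u‖ = 1 →
      μH[(2 : ℝ)] (shadow u K) = b) :
    ∃ (c : EuclideanSpace ℝ (Fin 3)) (r : ℝ), K = Metric.closedBall c r := by
  obtain ⟨w, hw⟩ := hwidth
  obtain ⟨F, h⟩ := exists_body hKcomp hKconv hKint hw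
  obtain ⟨β, hβ⟩ := bright_const hbright
  exact final_ball h fun e he v hv => final_const h hβ he hv
end
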